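/- arXiv:2604.07688 — 3 statements merged into one kernel-verified Lean document; each statement's English description precedes it below -/
import Mathlib

section
/- Let B be a unital C*-algebra with an AF-action given by data (e^{(i)}_{j;s,t}, A, D) as described. Then B is singly generated: there exists an element 𝔊 ∈ B such that C*({𝔊}) = B, where C*(S) denotes the smallest norm-closed *-subalgebra of B containing S. -/
/-- The smallest norm-closed star-subalgebra of `B` containing `S`. -/
def cstarGen {B : Type*} [NonUnitalCStarAlgebra B] (S : Set B) : Set B :=
  closure ((NonUnitalStarAlgebra.adjoin ℂ S : NonUnitalStarSubalgebra ℂ B) : Set B)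

/-- `x` is invertible in the corner algebra `pBp` (with unit `p`). -/
def cornerInvertible {B : Type*} [CStarAlgebra B] (p x : B) : Prop :=
  ∃ y : B, p * y * p = y ∧ x * y = p ∧ y * x = p

/-- A compatible tower of systems of matrix units in a unital C*-algebra `B`.
At level `i` there are `K i` summands, the `j`-th of which has matrix units
`e i j s t` (`s, t : Fin (n i j)`); the level-`i` units are sums of level-`(i+1)`
units according to the injections `L` (with multiplicities `m`), whose images are
pairwise disjoint and cover each `Fin (n (i+1) j)` (encoded as bijectivity of the
associated map on sigma types). -/
structure MatrixUnitTower (B : Type*) [CStarAlgebra B] where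
  K : ℕ → ℕ
  K_pos : ∀ i, 0 < K i
  n : (i : ℕ) → Fin (K i) → ℕ
  n_pos : ∀ i j, 0 < n i j
  e : (i : ℕ) → (j : Fin (K i)) → Fin (n i j) → Fin (n i j) → B
  e_ne_zero : ∀ i j s t, e i j s t ≠ 0
  e_mul_same : ∀ i j s t u w, e i j s t * e i j u w = if t = u then e i j s w else 0
  e_mul_ne : ∀ i (j j' : Fin (K i)), j ≠ j' → ∀ s t u w, e i j s t * e i j' u w = 0
  e_star : ∀ i j s t, star (e i j s t) = e i j t s
  sum_diag_eq_one : ∀ i, ∑ j, ∑ s, e i j s s = (1 : B)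
  m : (i : ℕ) → Fin (K i) → Fin (K (i + 1)) → ℕ
  L : (i : ℕ) → (j' : Fin (K i)) → (j : Fin (K (i + 1))) → Fin (m i j' j) →
      Fin (n i j') → Fin (n (i + 1) j)
  L_bij : ∀ (i : ℕ) (j : Fin (K (i + 1))),
    Function.Bijective (fun x : Σ j' : Fin (K i), Fin (m i j' j) × Fin (n i j') =>
      L i x.1 j x.2.1 x.2.2)
  e_compat : ∀ (i : ℕ) (j' : Fin (K i)) (l k : Fin (n i j')),
    e i j' l k = ∑ j : Fin (K (i + 1)), ∑ t : Fin (m i j' j),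
      e (i + 1) j (L i j' j t l) (L i j' j t k)

namespace MatrixUnitTower

variable {B : Type*} [CStarAlgebra B]

/-- The set `V` of all matrix units of the tower. -/
def unitsSet (T : MatrixUnitTower B) : Set B :=
  {x | ∃ i j s t, x = T.e i j s t}

/-- The set `E` of all diagonal matrix units of the tower. -/
def diagSet (T : MatrixUnitTower B) : Set B :=
  {x | ∃ i j s, x = T.e i j s s}

/-- The AF subalgebra `A`: the norm closure of the union of the linear spans of the
level-`i` matrix units (equivalently, the norm-closed star-subalgebra they generate). -/
def Aalg (T : MatrixUnitTower B) : StarSubalgebra ℂ B :=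
  (StarAlgebra.adjoin ℂ T.unitsSet).topologicalClosure

/-- The "diagonal" subalgebra `D₀ = C*(E)`. -/
def D0 (T : MatrixUnitTower B) : Set B := cstarGen T.diagSet

/-- `A` is simple: its only norm-closed two-sided ideals are `{0}` and `A`. -/
def ASimple (T : MatrixUnitTower B) : Prop :=
  ∀ I : TwoSidedIdeal T.Aalg, IsClosed (I : Set T.Aalg) → I = ⊥ ∨ I = ⊤

end MatrixUnitTower


namespace MatrixUnitTower

section tower
variable {B : Type*} [CStarAlgebra B] (T : MatrixUnitTower B)

/-- The linear span of the level `i` matrix units. -/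
noncomputable def W (i : ℕ) : Submodule ℂ B := Submodule.span ℂ {x | ∃ j s t, x = T.e i j s t}

lemma e_mem_W (i : ℕ) (j : Fin (T.K i)) (s t : Fin (T.n i j)) : T.e i j s t ∈ T.W i :=
  Submodule.subset_span ⟨j, s, t, rfl⟩

lemma W_succ (i : ℕ) : T.W i ≤ T.W (i + 1) := by
  refine Submodule.span_le.2 ?_
  rintro x ⟨j, s, t, rfl⟩
  rw [SetLike.mem_coe, T.e_compat]
  exact Submodule.sum_mem _ fun _ _ => Submodule.sum_mem _ fun _ _ => T.e_mem_W _ _ _ _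

lemma W_mono {i i' : ℕ} (h : i ≤ i') : T.W i ≤ T.W i' :=
  monotone_nat_of_le_succ T.W_succ h

lemma W_mul (i : ℕ) {x y : B} (hx : x ∈ T.W i) (hy : y ∈ T.W i) : x * y ∈ T.W i := by
  induction hx using Submodule.span_induction with
  | zero => simp
  | add a b _ _ ha hb => rw [add_mul]; exact add_mem ha hb
  | smul c a _ ha => rw [smul_mul_assoc]; exact Submodule.smul_mem _ _ ha
  | mem a ha =>
    obtain ⟨j, s, t, rfl⟩ := ha
    induction hy using Submodule.span_induction with
    | zero => simp
    | add a b _ _ ha hb => rw [mul_add]; exact add_mem ha hb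
    | smul c a _ ha => rw [mul_smul_comm]; exact Submodule.smul_mem _ _ ha
    | mem a ha =>
      obtain ⟨j', u, w, rfl⟩ := ha
      by_cases h : j = j'
      · subst h
        rw [T.e_mul_same]
        split_ifs
        · exact T.e_mem_W _ _ _ _
        · exact zero_mem _
      · rw [T.e_mul_ne _ _ _ h]; exact zero_mem _

lemma W_star (i : ℕ) {x : B} (hx : x ∈ T.W i) : star x ∈ T.W i := by
  induction hx using Submodule.span_induction with
  | zero => simp
  | add a b _ _ ha hb => rw [star_add]; exact add_mem ha hb
  | smul c a _ ha => rw [star_smul]; exact Submodule.smul_mem _ _ ha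
  | mem a ha =>
    obtain ⟨j, s, t, rfl⟩ := ha
    rw [T.e_star]; exact T.e_mem_W _ _ _ _

lemma W_one (i : ℕ) : (1 : B) ∈ T.W i := by
  rw [← T.sum_diag_eq_one i]
  exact Submodule.sum_mem _ fun _ _ => Submodule.sum_mem _ fun _ _ => T.e_mem_W _ _ _ _

instance W_fin (i : ℕ) : FiniteDimensional ℂ (T.W i) := by
  refine FiniteDimensional.span_of_finite ℂ ?_
  have : {x | ∃ j s t, x = T.e i j s t} =
      Set.range (fun p : Σ j : Fin (T.K i), Fin (T.n i j) × Fin (T.n i j) => T.e i p.1 p.2.1 p.2.2) := by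
    ext x; constructor
    · rintro ⟨j, s, t, rfl⟩; exact ⟨⟨j, s, t⟩, rfl⟩
    · rintro ⟨⟨j, s, t⟩, rfl⟩; exact ⟨j, s, t, rfl⟩
  rw [this]; exact Set.finite_range _

lemma finrank_W_le (i : ℕ) : Module.finrank ℂ (T.W i) ≤ (∑ j, T.n i j) ^ 2 := by
  have : {x | ∃ j s t, x = T.e i j s t} =
      Set.range (fun p : Σ j : Fin (T.K i), Fin (T.n i j) × Fin (T.n i j) => T.e i p.1 p.2.1 p.2.2) := by
    ext x; constructor
    · rintro ⟨j, s, t, rfl⟩; exact ⟨⟨j, s, t⟩, rfl⟩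
    · rintro ⟨⟨j, s, t⟩, rfl⟩; exact ⟨j, s, t, rfl⟩
  unfold W
  rw [this]
  refine (finrank_range_le_card (R := ℂ) _).trans ?_
  simp only [Fintype.card_sigma, Fintype.card_prod, Fintype.card_fin]
  simp only [← sq]
  rw [sq, Finset.sum_mul]
  refine Finset.sum_le_sum fun j _ => ?_
  rw [sq]
  exact Nat.mul_le_mul_left _ (Finset.single_le_sum (f := fun j => T.n i j)
    (fun _ _ => Nat.zero_le _) (Finset.mem_univ j))

/-- The union of the `W i`, as a star subalgebra. -/
def Winf : StarSubalgebra ℂ B where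
  carrier := {x | ∃ i, x ∈ T.W i}
  mul_mem' := by
    rintro a b ⟨i, hi⟩ ⟨i', hi'⟩
    exact ⟨max i i', T.W_mul _ (T.W_mono (le_max_left _ _) hi) (T.W_mono (le_max_right _ _) hi')⟩
  add_mem' := by
    rintro a b ⟨i, hi⟩ ⟨i', hi'⟩
    exact ⟨max i i', add_mem (T.W_mono (le_max_left _ _) hi) (T.W_mono (le_max_right _ _) hi')⟩
  algebraMap_mem' := fun r => ⟨0, by
    rw [Algebra.algebraMap_eq_smul_one]; exact Submodule.smul_mem _ _ (T.W_one 0)⟩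
  star_mem' := by
    rintro a ⟨i, hi⟩
    exact ⟨i, T.W_star _ hi⟩

lemma adjoin_le_Winf : StarAlgebra.adjoin ℂ T.unitsSet ≤ T.Winf := by
  refine StarAlgebra.adjoin_le ?_
  rintro x ⟨i, j, s, t, rfl⟩
  exact ⟨i, T.e_mem_W _ _ _ _⟩

lemma Aalg_approx {x : B} (hx : x ∈ T.Aalg) {ε : ℝ} (hε : 0 < ε) :
    ∃ i, ∃ y ∈ T.W i, ‖x - y‖ < ε := by
  have hx' : x ∈ closure ((StarAlgebra.adjoin ℂ T.unitsSet : StarSubalgebra ℂ B) : Set B) := hx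
  obtain ⟨y, hy, hd⟩ := Metric.mem_closure_iff.1 hx' ε hε
  obtain ⟨i, hi⟩ := T.adjoin_le_Winf hy
  exact ⟨i, y, hi, by rwa [dist_eq_norm] at hd⟩

lemma e_mem_Aalg (i : ℕ) (j : Fin (T.K i)) (s t : Fin (T.n i j)) : T.e i j s t ∈ T.Aalg :=
  subset_closure (StarAlgebra.subset_adjoin ℂ _ ⟨i, j, s, t, rfl⟩)

/-- Sizes are unbounded. -/
lemma size_unbounded (hA : ¬ FiniteDimensional ℂ T.Aalg) (i N : ℕ) :
    ∃ k, i ≤ k ∧ N ≤ ∑ j, T.n k j := by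
  by_contra hcon
  push Not at hcon
  apply hA
  have hbd : ∀ k, i ≤ k → Module.finrank ℂ (T.W k) ≤ N ^ 2 := fun k hk =>
    (T.finrank_W_le k).trans (Nat.pow_le_pow_left (hcon k hk).le 2)
  -- pick level of maximal dimension
  have hne : ∃ d, ∃ k, i ≤ k ∧ N ^ 2 - Module.finrank ℂ (T.W k) = d := ⟨_, i, le_rfl, rfl⟩
  classical
  obtain ⟨k, hk, hkd⟩ := Nat.find_spec hne
  have hmax : ∀ k', T.W k' ≤ T.W k := by
    intro k'
    have h1 : T.W k ≤ T.W (max k k') := T.W_mono (le_max_left _ _)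
    have h2 : Module.finrank ℂ (T.W (max k k')) ≤ Module.finrank ℂ (T.W k) := by
      have := Nat.find_min' hne ⟨max k k', hk.trans (le_max_left _ _), rfl⟩
      rw [← hkd] at this
      have h3 := hbd k hk
      have h4 := hbd (max k k') (hk.trans (le_max_left _ _))
      omega
    have := Submodule.eq_of_le_of_finrank_le h1 h2
    rw [this]
    exact T.W_mono (le_max_right _ _)
  have hsub : (T.Aalg : Set B) ⊆ T.W k := by
    have hc : IsClosed (T.W k : Set B) := Submodule.closed_of_finiteDimensional _
    refine closure_minimal ?_ hc
    intro x hx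
    obtain ⟨k', hk'⟩ := T.adjoin_le_Winf hx
    exact hmax k' hk'
  have hle : Subalgebra.toSubmodule T.Aalg.toSubalgebra ≤ T.W k := hsub
  have := Submodule.finiteDimensional_of_le hle
  exact this

lemma e_mul_diag (i : ℕ) (j : Fin (T.K i)) (s t : Fin (T.n i j)) :
    T.e i j s t * T.e i j t t = T.e i j s t := by simp [T.e_mul_same]

lemma diag_mul_e (i : ℕ) (j : Fin (T.K i)) (s t : Fin (T.n i j)) :
    T.e i j s s * T.e i j s t = T.e i j s t := by simp [T.e_mul_same]

lemma sandwich_succ (i : ℕ) (j1 : Fin (T.K i)) (u v : Fin (T.n i j1))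
    (j : Fin (T.K (i + 1))) (s s' : Fin (T.n (i + 1) j)) :
    T.e (i + 1) j s s * T.e i j1 u v * T.e (i + 1) j s' s' =
      ∑ t, if s = T.L i j1 j t u ∧ s' = T.L i j1 j t v then T.e (i + 1) j s s' else 0 := by
  rw [T.e_compat i j1 u v, Finset.mul_sum, Finset.sum_mul, Finset.sum_eq_single j]
  · rw [Finset.mul_sum, Finset.sum_mul]
    refine Finset.sum_congr rfl fun t _ => ?_
    rw [T.e_mul_same]
    by_cases h1 : s = T.L i j1 j t u
    · by_cases h2 : s' = T.L i j1 j t v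
      · simp [T.e_mul_same, ← h1, ← h2]
      · simp [T.e_mul_same, ← h1, h2, Ne.symm h2]
    · simp [h1]
  · intro j2 _ h
    rw [Finset.mul_sum, Finset.sum_mul]
    refine Finset.sum_eq_zero fun t _ => ?_
    rw [T.e_mul_ne _ _ _ h.symm, zero_mul]
  · simp

lemma diag_parent_succ (i : ℕ) (j1 : Fin (T.K i)) (j : Fin (T.K (i + 1)))
    (t : Fin (T.m i j1 j)) (l : Fin (T.n i j1)) :
    T.e (i + 1) j (T.L i j1 j t l) (T.L i j1 j t l) * T.e i j1 l l =
      T.e (i + 1) j (T.L i j1 j t l) (T.L i j1 j t l) := by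
  have hinj := (T.L_bij i j).1
  rw [T.e_compat i j1 l l, Finset.mul_sum, Finset.sum_eq_single j]
  · rw [Finset.mul_sum, Finset.sum_eq_single t]
    · simp [T.e_mul_same]
    · intro t' _ h
      rw [T.e_mul_same, if_neg]
      intro heq
      have := @hinj ⟨j1, t, l⟩ ⟨j1, t', l⟩ heq
      simp at this
      exact h this.symm
    · simp
  · intro j2 _ h
    rw [Finset.mul_sum]
    exact Finset.sum_eq_zero fun t _ => T.e_mul_ne _ _ _ h.symm _ _ _ _
  · simp

lemma exists_parent {i i' : ℕ} (h : i ≤ i') : ∀ (j : Fin (T.K i')) (s : Fin (T.n i' j)),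
    ∃ p : Σ j' : Fin (T.K i), Fin (T.n i j'),
      T.e i' j s s * T.e i p.1 p.2 p.2 = T.e i' j s s := by
  induction i', h using Nat.le_induction with
  | base => exact fun j s => ⟨⟨j, s⟩, by simp [T.e_mul_same]⟩
  | succ i' h ih =>
    intro j s
    obtain ⟨⟨j1, t, l⟩, rfl⟩ := (T.L_bij i' j).2 s
    obtain ⟨p, hp⟩ := ih j1 l
    refine ⟨p, ?_⟩
    dsimp only
    rw [← T.diag_parent_succ i' j1 j t l, mul_assoc, hp]

lemma exists_blocks {i i' : ℕ} (h : i ≤ i') (N : ℕ) (hN : ∀ j, T.n i j ≤ N) :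
    ∀ (j : Fin (T.K i')), ∃ (Q : Type) (blk : Fin (T.n i' j) → Q),
      (∀ q, Set.ncard {s | blk s = q} ≤ N) ∧
      (∀ s t, blk s ≠ blk t → ∀ x ∈ T.W i, T.e i' j s s * x * T.e i' j t t = 0) := by
  induction i', h using Nat.le_induction with
  | base =>
    intro j
    refine ⟨Unit, fun _ => (), fun q => ?_, fun s t h => absurd rfl h⟩
    refine le_trans ?_ (hN j)
    refine (Set.ncard_le_card _).trans ?_
    simp
  | succ i' h ih =>
    intro j
    choose Q blk hblk1 hblk2 using ih
    let E := Equiv.ofBijective _ (T.L_bij i' j)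
    let f : (Σ j' : Fin (T.K i'), Fin (T.m i' j' j) × Fin (T.n i' j')) →
      Σ j' : Fin (T.K i'), Fin (T.m i' j' j) × Q j' := fun p => ⟨p.1, p.2.1, blk p.1 p.2.2⟩
    refine ⟨Σ j' : Fin (T.K i'), Fin (T.m i' j' j) × Q j', fun s => f (E.symm s), ?_, ?_⟩
    · rintro ⟨j1, t, q⟩
      refine le_trans ?_ (hblk1 j1 q)
      refine (Set.ncard_le_ncard (t := (fun l => E ⟨j1, t, l⟩) '' {l | blk j1 l = q}) ?_
        (Set.toFinite _)).trans (Set.ncard_image_le (Set.toFinite _))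
      intro s hs
      obtain ⟨⟨j2, t2, l2⟩, rfl⟩ := E.surjective s
      rw [Set.mem_ofPred_eq] at hs
      beta_reduce at hs
      rw [Equiv.symm_apply_apply] at hs
      obtain ⟨rfl, hs⟩ := Sigma.mk.inj_iff.1 hs
      have hs := eq_of_heq hs
      obtain ⟨rfl, hs2⟩ := Prod.mk_inj.1 hs
      exact ⟨l2, hs2, rfl⟩
    · intro s s' hne x hx
      obtain ⟨⟨j1, t, l⟩, rfl⟩ := E.surjective s
      obtain ⟨⟨j2, t2, l2⟩, rfl⟩ := E.surjective s'
      beta_reduce at hne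
      rw [Equiv.symm_apply_apply, Equiv.symm_apply_apply] at hne
      have e1 : E ⟨j1, t, l⟩ = T.L i' j1 j t l := rfl
      have e2 : E ⟨j2, t2, l2⟩ = T.L i' j2 j t2 l2 := rfl
      by_cases hjt : (⟨j1, t⟩ : Σ j', Fin (T.m i' j' j)) = ⟨j2, t2⟩
      · obtain ⟨rfl, hjt⟩ := Sigma.mk.inj_iff.1 hjt
        have hjt := eq_of_heq hjt
        subst hjt
        have hb : blk j1 l ≠ blk j1 l2 := fun hh => hne (by simp only [f, hh])
        have h0 := hblk2 j1 l l2 hb x hx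
        have h1 := T.diag_parent_succ i' j1 j t l
        have h2 := congrArg star (T.diag_parent_succ i' j1 j t l2)
        rw [star_mul, T.e_star, T.e_star] at h2
        rw [e1, e2, ← h1, ← h2]
        calc _ = T.e (i' + 1) j (T.L i' j1 j t l) (T.L i' j1 j t l) *
              (T.e i' j1 l l * x * T.e i' j1 l2 l2) *
              T.e (i' + 1) j (T.L i' j1 j t l2) (T.L i' j1 j t l2) := by simp only [mul_assoc]
          _ = 0 := by rw [h0]; simp
      · have key : ∀ y ∈ T.W i', T.e (i' + 1) j (E ⟨j1, t, l⟩) (E ⟨j1, t, l⟩) * y *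
            T.e (i' + 1) j (E ⟨j2, t2, l2⟩) (E ⟨j2, t2, l2⟩) = 0 := by
          intro y hy
          induction hy using Submodule.span_induction with
          | zero => simp
          | add a b _ _ ha hb => rw [mul_add, add_mul, ha, hb, add_zero]
          | smul c a _ ha => rw [mul_smul_comm, smul_mul_assoc, ha, smul_zero]
          | mem a ha =>
            obtain ⟨j3, u, v, rfl⟩ := ha
            rw [T.sandwich_succ]
            refine Finset.sum_eq_zero fun t3 _ => if_neg ?_
            rintro ⟨h1, h2⟩
            have h1 := E.injective (a₂ := ⟨j3, t3, u⟩) h1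
            have h2 := E.injective (a₂ := ⟨j3, t3, v⟩) h2
            apply hjt
            obtain ⟨rfl, h1⟩ := Sigma.mk.inj_iff.1 h1
            obtain ⟨rfl, h2⟩ := Sigma.mk.inj_iff.1 h2
            have h1 := (Prod.mk_inj.1 (eq_of_heq h1)).1
            have h2 := (Prod.mk_inj.1 (eq_of_heq h2)).1
            rw [h1, h2]
        exact key x (T.W_mono h hx)

end tower

end MatrixUnitTower

namespace MatrixUnitTower

section growth
variable {B : Type*} [CStarAlgebra B] (T : MatrixUnitTower B)

/-- The central projection of the `j`-th summand at level `i`. -/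
noncomputable def z (i : ℕ) (j : Fin (T.K i)) : B := ∑ s, T.e i j s s

lemma z_comm (i : ℕ) (j : Fin (T.K i)) {x : B} (hx : x ∈ T.W i) :
    T.z i j * x = x * T.z i j := by
  induction hx using Submodule.span_induction with
  | zero => simp
  | add a b _ _ ha hb => rw [mul_add, add_mul, ha, hb]
  | smul c a _ ha => rw [mul_smul_comm, smul_mul_assoc, ha]
  | mem a ha =>
    obtain ⟨j3, u, v, rfl⟩ := ha
    unfold z
    rw [Finset.sum_mul, Finset.mul_sum]
    by_cases h : j = j3
    · subst h
      simp [T.e_mul_same]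
    · simp [T.e_mul_ne _ _ _ h, T.e_mul_ne _ _ _ (Ne.symm h)]

lemma z_proj (i : ℕ) (j : Fin (T.K i)) : IsStarProjection (T.z i j) := by
  constructor
  · unfold IsIdempotentElem z
    rw [Finset.sum_mul_sum]
    simp [T.e_mul_same]
  · unfold IsSelfAdjoint z
    rw [star_sum]
    simp [T.e_star]

lemma z_ne_zero (i : ℕ) (j : Fin (T.K i)) : T.z i j ≠ 0 := by
  intro h
  have h1 : T.e i j ⟨0, T.n_pos i j⟩ ⟨0, T.n_pos i j⟩ * T.z i j = 0 := by rw [h, mul_zero]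
  unfold z at h1
  rw [Finset.mul_sum] at h1
  simp [T.e_mul_same] at h1
  exact T.e_ne_zero _ _ _ _ h1

lemma z_norm_le (i : ℕ) (j : Fin (T.K i)) : ‖T.z i j‖ ≤ 1 :=
  IsStarProjection.norm_le _ (T.z_proj i j)

lemma z_norm_ge (i : ℕ) (j : Fin (T.K i)) : 1 ≤ ‖T.z i j‖ := by
  have h := norm_mul_le (T.z i j) (T.z i j)
  rw [(T.z_proj i j).isIdempotentElem] at h
  have : 0 < ‖T.z i j‖ := norm_pos_iff.2 (T.z_ne_zero i j)
  nlinarith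

/-- Asymptotic smallness on the summands killed by `p`. -/
def Small (p w : B) : Prop :=
  ∀ ε : ℝ, 0 < ε → ∃ i0, ∀ i, i0 ≤ i → ∀ j : Fin (T.K i), T.z i j * p = 0 → ‖T.z i j * w‖ ≤ ε

lemma small_closed (p w : B) (h : ∀ ε : ℝ, 0 < ε → ∃ w', T.Small p w' ∧ ‖w - w'‖ ≤ ε) :
    T.Small p w := by
  intro ε hε
  obtain ⟨w', hw', hd⟩ := h (ε / 2) (by positivity)
  obtain ⟨i0, hi0⟩ := hw' (ε / 2) (by positivity)
  refine ⟨i0, fun i hi j hj => ?_⟩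
  have h1 := hi0 i hi j hj
  have h2 : T.z i j * w = T.z i j * w' + T.z i j * (w - w') := by noncomm_ring
  rw [h2]
  refine (norm_add_le _ _).trans ?_
  have h3 := norm_mul_le (T.z i j) (w - w')
  have h4 := T.z_norm_le i j
  have h5 := norm_nonneg (w - w')
  nlinarith

lemma small_add (p w w' : B) (h : T.Small p w) (h' : T.Small p w') : T.Small p (w + w') := by
  intro ε hε
  obtain ⟨i0, hi0⟩ := h (ε / 2) (by positivity)
  obtain ⟨i1, hi1⟩ := h' (ε / 2) (by positivity)
  refine ⟨max i0 i1, fun i hi j hj => ?_⟩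
  have h1 := hi0 i ((le_max_left _ _).trans hi) j hj
  have h2 := hi1 i ((le_max_right _ _).trans hi) j hj
  rw [mul_add]
  refine (norm_add_le _ _).trans (by linarith)

lemma small_mul_right (p w x : B) (h : T.Small p w) : T.Small p (w * x) := by
  intro ε hε
  obtain ⟨i0, hi0⟩ := h (ε / (‖x‖ + 1)) (by positivity)
  refine ⟨i0, fun i hi j hj => ?_⟩
  have h1 := hi0 i hi j hj
  rw [← mul_assoc]
  refine (norm_mul_le _ _).trans ?_
  rw [le_div_iff₀ (by positivity)] at h1
  have := norm_nonneg (T.z i j * w)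
  nlinarith

lemma small_mul_left_W (p w x : B) (k : ℕ) (hx : x ∈ T.W k) (h : T.Small p w) :
    T.Small p (x * w) := by
  intro ε hε
  obtain ⟨i0, hi0⟩ := h (ε / (‖x‖ + 1)) (by positivity)
  refine ⟨max i0 k, fun i hi j hj => ?_⟩
  have h1 := hi0 i ((le_max_left _ _).trans hi) j hj
  rw [← mul_assoc, T.z_comm i j (T.W_mono ((le_max_right _ _).trans hi) hx), mul_assoc]
  refine (norm_mul_le _ _).trans ?_
  rw [le_div_iff₀ (by positivity)] at h1
  have := norm_nonneg (T.z i j * w)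
  nlinarith

lemma small_mul_left (p w x : B) (hx : x ∈ T.Aalg) (h : T.Small p w) :
    T.Small p (x * w) := by
  refine T.small_closed _ _ fun ε hε => ?_
  obtain ⟨k, y, hy, hd⟩ := T.Aalg_approx hx (ε := ε / (‖w‖ + 1)) (by positivity)
  refine ⟨y * w, T.small_mul_left_W _ _ _ k hy h, ?_⟩
  rw [← sub_mul]
  refine (norm_mul_le _ _).trans ?_
  rw [lt_div_iff₀ (by positivity)] at hd
  have := norm_nonneg (x - y)
  nlinarith

lemma small_neg (p w : B) (h : T.Small p w) : T.Small p (-w) := by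
  have := T.small_mul_right p w (-1) h
  simpa using this

/-- The ideal of asymptotically small elements. -/
def smallIdeal (p : B) : TwoSidedIdeal T.Aalg :=
  TwoSidedIdeal.mk' {w | T.Small p (w : B)}
    (show T.Small p ((0 : T.Aalg) : B) from fun ε hε => ⟨0, fun i _ j _ => by simpa using hε.le⟩)
    (fun {x y} hx hy => T.small_add p x y hx hy)
    (fun {x} hx => T.small_neg p x hx)
    (fun {x y} hy => T.small_mul_left p y x x.2 hy)
    (fun {x y} hx => T.small_mul_right p x y hx)

lemma mem_smallIdeal (p : B) (w : T.Aalg) : w ∈ T.smallIdeal p ↔ T.Small p (w : B) := by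
  exact TwoSidedIdeal.mem_mk' _ _ _ _ _ _ _

lemma eventually_full (hA : T.ASimple) (p : B) (hp : p ∈ T.Aalg) (hp0 : p ≠ 0) :
    ∃ i0, ∀ i, i0 ≤ i → ∀ j, T.z i j * p ≠ 0 := by
  have hcl : IsClosed (T.smallIdeal p : Set T.Aalg) := by
    rw [← closure_subset_iff_isClosed]
    intro w hw
    rw [SetLike.mem_coe, T.mem_smallIdeal]
    refine T.small_closed _ _ fun ε hε => ?_
    obtain ⟨w', hw', hd⟩ := Metric.mem_closure_iff.1 hw ε hε
    refine ⟨w', (T.mem_smallIdeal p w').1 hw', ?_⟩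
    rw [Subtype.dist_eq, dist_eq_norm] at hd
    exact hd.le
  have hpm : (⟨p, hp⟩ : T.Aalg) ∈ T.smallIdeal p := by
    rw [T.mem_smallIdeal]
    exact fun ε hε => ⟨0, fun i _ j hj => by simp only [hj, norm_zero]; exact hε.le⟩
  rcases hA _ hcl with h | h
  · rw [h] at hpm
    exact absurd (congrArg Subtype.val ((TwoSidedIdeal.mem_bot _).1 hpm)) hp0
  · have h1 : (1 : T.Aalg) ∈ T.smallIdeal p := by rw [h]; trivial
    rw [T.mem_smallIdeal] at h1
    obtain ⟨i0, hi0⟩ := h1 (1 / 2) (by norm_num)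
    refine ⟨i0, fun i hi j hj => ?_⟩
    have h2 := hi0 i hi j hj
    have h3 := T.z_norm_ge i j
    simp only [OneMemClass.coe_one, mul_one] at h2
    linarith

lemma sizes_grow (hA : T.ASimple) (hinf : ¬ FiniteDimensional ℂ T.Aalg) (i N : ℕ) :
    ∃ k, i ≤ k ∧ ∀ j, N ≤ T.n k j := by
  obtain ⟨i1, hi1, hN⟩ := T.size_unbounded hinf i N
  have := fun y : Σ j : Fin (T.K i1), Fin (T.n i1 j) =>
    T.eventually_full hA (T.e i1 y.1 y.2 y.2) (T.e_mem_Aalg _ _ _ _) (T.e_ne_zero _ _ _ _)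
  choose f hf using this
  let k := max i1 (Finset.univ.sup f)
  have hk : i1 ≤ k := le_max_left _ _
  refine ⟨k, hi1.trans hk, fun j => hN.trans ?_⟩
  choose par hpar using T.exists_parent hk j
  have hsurj : Function.Surjective par := by
    intro y
    by_contra hcon
    push Not at hcon
    apply hf y k ((Finset.le_sup (Finset.mem_univ y)).trans (le_max_right _ _)) j
    unfold z
    rw [Finset.sum_mul]
    refine Finset.sum_eq_zero fun s _ => ?_
    rw [← hpar s, mul_assoc]
    have hne := hcon s
    obtain ⟨j1, l1⟩ := y
    generalize par s = q at hne ⊢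
    obtain ⟨j2, l2⟩ := q
    by_cases h : j2 = j1
    · subst h
      rw [T.e_mul_same, if_neg, mul_zero]
      rintro rfl
      exact hne rfl
    · rw [T.e_mul_ne _ _ _ h, mul_zero]
  have := Fintype.card_le_of_surjective _ hsurj
  simpa using this

end growth

end MatrixUnitTower

lemma cyc_maps {n N : ℕ} {Q : Type} (blk : Fin n → Q)
    (hblk : ∀ q, Set.ncard {s | blk s = q} ≤ N) (hn : 4 * N < n) :
    ∃ σ τ : Fin n → Fin n, (∀ s, blk s ≠ blk (σ s)) ∧ (∀ s, blk s ≠ blk (τ s)) ∧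
      (∀ s, σ s ≠ τ s) ∧ (∀ s, σ (σ s) ≠ s) ∧ (∀ s, τ (σ s) ≠ s) ∧ (∀ s, σ (τ s) ≠ s) ∧
      (∀ s, τ (τ s) ≠ s) ∧
      ∀ R : Fin n → Fin n → Prop, Equivalence R → (∀ s, R s (σ s)) → ∀ s t, R s t := by
  classical
  let P := Set.range blk
  have hr : 4 < Fintype.card P := by
    by_contra hcon
    push Not at hcon
    have h1 := Finset.card_le_mul_card_image (f := fun s : Fin n => (⟨blk s, s, rfl⟩ : P))
      (s := Finset.univ) N (by
        intro b _
        have := hblk b.1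
        rw [Set.ncard_eq_toFinset_card'] at this
        refine le_trans (Finset.card_le_card ?_) this
        intro s hs
        simp only [Finset.mem_filter, Finset.mem_univ, true_and] at hs
        simp [← hs])
    have h2 := Finset.card_le_univ
      (Finset.image (fun s : Fin n => (⟨blk s, s, rfl⟩ : P)) Finset.univ)
    simp only [Finset.card_univ, Fintype.card_fin] at h1
    have : n ≤ N * 4 := h1.trans (Nat.mul_le_mul_left _ (h2.trans hcon))
    omega
  obtain ⟨r, hr5⟩ : ∃ r, Fintype.card P = r + 5 := ⟨Fintype.card P - 5, by omega⟩
  have eqv : P ≃ ZMod (r + 5) := Fintype.equivOfCardEq (by rw [hr5, ZMod.card])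
  let b : Fin n → ZMod (r + 5) := fun s => eqv ⟨blk s, s, rfl⟩
  have hb : ∀ s t, b s ≠ b t → blk s ≠ blk t := by
    intro s t h h'
    apply h
    simp only [b]
    congr 1
    exact Subtype.ext h'
  have hrep : ∀ q, ∃ s, b s = q := by
    intro q
    obtain ⟨s, hs⟩ := (eqv.symm q).2
    refine ⟨s, ?_⟩
    simp only [b]
    rw [← eqv.apply_symm_apply q]
    congr 1
    exact Subtype.ext hs
  choose rep hrep using hrep
  have hnum : ∀ m : ℕ, 0 < m → m < 5 → ((m : ℕ) : ZMod (r + 5)) ≠ 0 := by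
    intro m h0 h5 h
    rw [ZMod.natCast_eq_zero_iff] at h
    have := Nat.le_of_dvd h0 h
    omega
  have c1 := hnum 1 (by norm_num) (by norm_num)
  have c2 := hnum 2 (by norm_num) (by norm_num)
  have c3 := hnum 3 (by norm_num) (by norm_num)
  have c4 := hnum 4 (by norm_num) (by norm_num)
  push_cast at c1 c2 c3 c4
  have hσ : ∀ s, b (rep (b s + 1)) = b s + 1 := fun s => hrep _
  have hτ : ∀ s, b (rep (b s + 2)) = b s + 2 := fun s => hrep _
  refine ⟨fun s => rep (b s + 1), fun s => rep (b s + 2), ?_, ?_, ?_, ?_, ?_, ?_, ?_, ?_⟩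
  · intro s; apply hb; rw [hσ]; intro h; apply c1; linear_combination -h
  · intro s; apply hb; rw [hτ]; intro h; apply c2; linear_combination -h
  · intro s h
    have h := congrArg b h
    rw [hσ, hτ] at h
    apply c1; linear_combination -h
  · intro s h
    have h := congrArg b h
    simp only [hrep] at h
    apply c2; linear_combination h
  · intro s h
    have h := congrArg b h
    simp only [hrep] at h
    apply c3; linear_combination h
  · intro s h
    have h := congrArg b h
    simp only [hrep] at h
    apply c3; linear_combination h
  · intro s h
    have h := congrArg b h
    simp only [hrep] at h
    apply c4; linear_combination h
  · intro R hR hs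
    have h1 : ∀ m : ℕ, R (rep 0) (rep (m : ZMod (r + 5))) := by
      intro m
      induction m with
      | zero => simpa using hR.refl _
      | succ m ih =>
        refine hR.trans ih ?_
        have := hs (rep (m : ZMod (r + 5)))
        simp only [hrep] at this
        simpa using this
    have h2 : ∀ q, R (rep 0) (rep q) := by
      intro q
      have := h1 q.val
      rwa [ZMod.natCast_zmod_val] at this
    have h3 : ∀ s, R (rep 0) s := fun s => hR.trans (h2 _) (hR.symm (hs s))
    exact fun s t => hR.trans (hR.symm (h3 s)) (h3 t)

lemma adjoin_cont {B : Type*} [CStarAlgebra B] {G y : B}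
    (hy : y ∈ NonUnitalStarAlgebra.adjoin ℂ ({G} : Set B)) :
    ∃ f : B → B, Continuous f ∧ f G = y ∧
      ∀ G', f G' ∈ NonUnitalStarAlgebra.adjoin ℂ ({G'} : Set B) := by
  induction hy using NonUnitalStarAlgebra.adjoin_induction with
  | mem x hx =>
    rw [Set.mem_singleton_iff] at hx
    exact ⟨id, continuous_id, hx.symm, fun G' =>
      NonUnitalStarAlgebra.subset_adjoin ℂ _ (Set.mem_singleton G')⟩
  | add x y _ _ hx hy =>
    obtain ⟨f, hf, rfl, hf'⟩ := hx
    obtain ⟨g, hg, rfl, hg'⟩ := hy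
    exact ⟨fun G => f G + g G, hf.add hg, rfl, fun G' => add_mem (hf' G') (hg' G')⟩
  | zero => exact ⟨fun _ => 0, continuous_const, rfl, fun G' => zero_mem _⟩
  | mul x y _ _ hx hy =>
    obtain ⟨f, hf, rfl, hf'⟩ := hx
    obtain ⟨g, hg, rfl, hg'⟩ := hy
    exact ⟨fun G => f G * g G, hf.mul hg, rfl, fun G' => mul_mem (hf' G') (hg' G')⟩
  | smul r x _ hx =>
    obtain ⟨f, hf, rfl, hf'⟩ := hx
    exact ⟨fun G => r • f G, hf.const_smul r, rfl, fun G' => SMulMemClass.smul_mem r (hf' G')⟩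
  | star x _ hx =>
    obtain ⟨f, hf, rfl, hf'⟩ := hx
    exact ⟨fun G => star (f G), hf.star, rfl, fun G' => star_mem (hf' G')⟩

lemma perturb {I : Type*} [Fintype I] (α : I → ℝ) {δ : ℝ} (hδ : 0 < δ) :
    ∃ α' : I → ℝ, Function.Injective α' ∧ ∀ x, α' x ≠ 0 ∧ |α' x - α x| ≤ δ := by
  classical
  let e := Fintype.equivFin I
  let k : I → ℝ := fun x => (e x : ℝ) + 1
  have hk : Function.Injective k := by
    intro x y h
    simp only [k, add_left_inj, Nat.cast_inj] at h
    exact e.injective (Fin.ext h)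
  have hkpos : ∀ x, 0 < k x := fun x => by positivity
  have hkle : ∀ x, k x ≤ Fintype.card I := fun x => by
    have := (e x).2
    simp only [k]
    exact_mod_cast this
  let bad1 : Set ℝ := ⋃ p : I × I, {θ | p.1 ≠ p.2 ∧ α p.1 + θ * k p.1 = α p.2 + θ * k p.2}
  let bad2 : Set ℝ := ⋃ x : I, {θ | α x + θ * k x = 0}
  have hb1 : bad1.Finite := by
    refine Set.finite_iUnion fun p => Set.Subsingleton.finite ?_
    rintro θ ⟨hne, h⟩ θ' ⟨_, h'⟩
    have : k p.1 - k p.2 ≠ 0 := sub_ne_zero.2 (hk.ne hne)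
    apply mul_right_cancel₀ this
    linarith
  have hb2 : bad2.Finite := by
    refine Set.finite_iUnion fun x => Set.Subsingleton.finite ?_
    intro θ h θ' h'
    have h : α x + θ * k x = 0 := h
    have h' : α x + θ' * k x = 0 := h'
    apply mul_right_cancel₀ (hkpos x).ne'
    linarith
  let M : ℝ := δ / (Fintype.card I + 1)
  have hM : 0 < M := by positivity
  obtain ⟨θ, hθ, hθb⟩ := ((Set.Ioo_infinite hM).sdiff (hb1.union hb2)).nonempty
  refine ⟨fun x => α x + θ * k x, ?_, fun x => ⟨?_, ?_⟩⟩
  · intro x y h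
    by_contra hne
    exact hθb (Or.inl (Set.mem_iUnion.2 ⟨(x, y), hne, h⟩))
  · intro h
    exact hθb (Or.inr (Set.mem_iUnion.2 ⟨x, h⟩))
  · rw [add_sub_cancel_left, abs_of_pos (mul_pos hθ.1 (hkpos x))]
    have h1 := hkle x
    have h2 := hθ.2
    have h3 : M * (Fintype.card I + 1) = δ := by simp only [M]; field_simp
    have h4 := hkpos x
    have h5 := hθ.1
    nlinarith

lemma diag_mem {B : Type*} [CStarAlgebra B] (S : NonUnitalStarSubalgebra ℂ B) {I : Type*}
    [Fintype I] [DecidableEq I] (e : I → B) (he : ∀ x y, e x * e y = if x = y then e x else 0)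
    (α : I → ℝ) (hinj : Function.Injective α) (h0 : ∀ x, α x ≠ 0)
    (hmem : ∑ x, α x • e x ∈ S) (x : I) : e x ∈ S := by
  have hsm : ∀ (r : ℝ) (y : B), y ∈ S → r • y ∈ S := fun r y hy => by
    rw [← Complex.coe_smul]; exact SMulMemClass.smul_mem _ hy
  have key : ∀ F : Finset I, ∑ z, (α z * ∏ y ∈ F, (α z - α y)) • e z ∈ S := by
    intro F
    induction F using Finset.induction_on with
    | empty => simpa using hmem
    | insert y F hy ih =>
      have h1 : ∑ z, (α z * ∏ y ∈ insert y F, (α z - α y)) • e z =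
          (∑ z, α z • e z) * (∑ z, (α z * ∏ y ∈ F, (α z - α y)) • e z) -
            α y • (∑ z, (α z * ∏ y ∈ F, (α z - α y)) • e z) := by
        rw [Finset.sum_mul_sum, Finset.smul_sum, ← Finset.sum_sub_distrib]
        refine Finset.sum_congr rfl fun z _ => ?_
        rw [Finset.sum_eq_single z]
        · rw [smul_mul_smul_comm, he, if_pos rfl, smul_smul, ← sub_smul, Finset.prod_insert hy]
          congr 1
          ring
        · intro w _ hw
          rw [smul_mul_smul_comm, he, if_neg hw.symm, smul_zero]
        · simp
      rw [h1]
      exact sub_mem (mul_mem hmem ih) (hsm _ _ ih)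
  have h1 := key (Finset.univ.erase x)
  rw [Finset.sum_eq_single x] at h1
  · have hne : α x * ∏ y ∈ Finset.univ.erase x, (α x - α y) ≠ 0 := by
      refine mul_ne_zero (h0 x) (Finset.prod_ne_zero_iff.2 fun y hy => ?_)
      exact sub_ne_zero.2 (hinj.ne (Finset.ne_of_mem_erase hy).symm)
    have h2 := hsm (α x * ∏ y ∈ Finset.univ.erase x, (α x - α y))⁻¹ _ h1
    rwa [smul_smul, inv_mul_cancel₀ hne, one_smul] at h2
  · intro z _ hz
    rw [Finset.prod_eq_zero (i := z) (by simp [hz]) (by simp), mul_zero, zero_smul]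
  · simp

namespace MatrixUnitTower

section action
variable {B : Type*} [CStarAlgebra B] (T : MatrixUnitTower B) (D : StarSubalgebra ℂ B)

/-- Elements of level `i` with coefficients in `D`. -/
noncomputable def C (i : ℕ) : Submodule ℂ B :=
  Submodule.span ℂ {x | ∃ d ∈ D, ∃ j s t, x = d * T.e i j s t}

lemma mem_C (i : ℕ) {d : B} (hd : d ∈ D) (j : Fin (T.K i)) (s t : Fin (T.n i j)) :
    d * T.e i j s t ∈ T.C D i := Submodule.subset_span ⟨d, hd, j, s, t, rfl⟩

lemma C_succ (i : ℕ) : T.C D i ≤ T.C D (i + 1) := by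
  refine Submodule.span_le.2 ?_
  rintro x ⟨d, hd, j, s, t, rfl⟩
  rw [SetLike.mem_coe, T.e_compat, Finset.mul_sum]
  refine Submodule.sum_mem _ fun _ _ => ?_
  rw [Finset.mul_sum]
  exact Submodule.sum_mem _ fun _ _ => T.mem_C D _ hd _ _ _

lemma C_mono {i i' : ℕ} (h : i ≤ i') : T.C D i ≤ T.C D i' :=
  monotone_nat_of_le_succ (T.C_succ D) h

lemma e_mul_d (hcomm : ∀ d ∈ D, ∀ i j s, d * T.e i j s s = T.e i j s s * d)
    {d : B} (hd : d ∈ D) (i : ℕ) (j : Fin (T.K i)) (s t : Fin (T.n i j)) :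
    T.e i j s t * d = (T.e i j s t * d * T.e i j t s) * T.e i j s t := by
  rw [mul_assoc _ (T.e i j t s), T.e_mul_same, if_pos rfl, mul_assoc, hcomm d hd, ← mul_assoc,
    T.e_mul_diag]

lemma C_mul (hcomm : ∀ d ∈ D, ∀ i j s, d * T.e i j s s = T.e i j s s * d)
    (hconj : ∀ d ∈ D, ∀ i j s t, T.e i j s t * d * T.e i j t s ∈ D)
    (i : ℕ) {x y : B} (hx : x ∈ T.C D i) (hy : y ∈ T.C D i) : x * y ∈ T.C D i := by
  induction hx using Submodule.span_induction with
  | zero => simp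
  | add a b _ _ ha hb => rw [add_mul]; exact add_mem ha hb
  | smul c a _ ha => rw [smul_mul_assoc]; exact Submodule.smul_mem _ _ ha
  | mem a ha =>
    obtain ⟨d, hd, j, s, t, rfl⟩ := ha
    induction hy using Submodule.span_induction with
    | zero => simp
    | add a b _ _ ha hb => rw [mul_add]; exact add_mem ha hb
    | smul c a _ ha => rw [mul_smul_comm]; exact Submodule.smul_mem _ _ ha
    | mem a ha =>
      obtain ⟨d', hd', j', u, w, rfl⟩ := ha
      have h1 : d * T.e i j s t * (d' * T.e i j' u w) =
          (d * (T.e i j s t * d' * T.e i j t s)) * (T.e i j s t * T.e i j' u w) := by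
        calc _ = d * (T.e i j s t * d') * T.e i j' u w := by simp only [mul_assoc]
          _ = d * ((T.e i j s t * d' * T.e i j t s) * T.e i j s t) * T.e i j' u w := by
              rw [← T.e_mul_d D hcomm hd']
          _ = _ := by simp only [mul_assoc]
      rw [h1]
      by_cases h : j = j'
      · subst h
        rw [T.e_mul_same]
        split_ifs
        · exact T.mem_C D _ (mul_mem hd (hconj _ hd' _ _ _ _)) _ _ _
        · simp
      · rw [T.e_mul_ne _ _ _ h]; simp

lemma C_star (hcomm : ∀ d ∈ D, ∀ i j s, d * T.e i j s s = T.e i j s s * d)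
    (hconj : ∀ d ∈ D, ∀ i j s t, T.e i j s t * d * T.e i j t s ∈ D)
    (i : ℕ) {x : B} (hx : x ∈ T.C D i) : star x ∈ T.C D i := by
  induction hx using Submodule.span_induction with
  | zero => simp
  | add a b _ _ ha hb => rw [star_add]; exact add_mem ha hb
  | smul c a _ ha => rw [star_smul]; exact Submodule.smul_mem _ _ ha
  | mem a ha =>
    obtain ⟨d, hd, j, s, t, rfl⟩ := ha
    rw [star_mul, T.e_star, T.e_mul_d D hcomm (star_mem hd)]
    exact T.mem_C D _ (hconj _ (star_mem hd) _ _ _ _) _ _ _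

lemma C_dense (hcomm : ∀ d ∈ D, ∀ i j s, d * T.e i j s s = T.e i j s s * d)
    (hconj : ∀ d ∈ D, ∀ i j s t, T.e i j s t * d * T.e i j t s ∈ D)
    (hgen : cstarGen ((T.Aalg : Set B) ∪ (D : Set B)) = Set.univ) (b : B) {ε : ℝ}
    (hε : 0 < ε) : ∃ i, ∃ y ∈ T.C D i, ‖b - y‖ < ε := by
  let S : NonUnitalStarSubalgebra ℂ B :=
    { carrier := {x | ∃ i, x ∈ T.C D i}
      mul_mem' := by
        rintro a b ⟨i, hi⟩ ⟨i', hi'⟩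
        exact ⟨max i i', T.C_mul D hcomm hconj _ (T.C_mono D (le_max_left _ _) hi)
          (T.C_mono D (le_max_right _ _) hi')⟩
      add_mem' := by
        rintro a b ⟨i, hi⟩ ⟨i', hi'⟩
        exact ⟨max i i', add_mem (T.C_mono D (le_max_left _ _) hi)
          (T.C_mono D (le_max_right _ _) hi')⟩
      zero_mem' := ⟨0, zero_mem _⟩
      smul_mem' := by
        rintro c a ⟨i, hi⟩
        exact ⟨i, Submodule.smul_mem _ _ hi⟩
      star_mem' := by
        rintro a ⟨i, hi⟩
        exact ⟨i, T.C_star D hcomm hconj _ hi⟩ }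
  have hle : NonUnitalStarAlgebra.adjoin ℂ ((T.Aalg : Set B) ∪ (D : Set B)) ≤
      S.topologicalClosure := by
    refine NonUnitalStarAlgebra.adjoin_le ?_
    rintro x (hx | hx)
    · refine Metric.mem_closure_iff.2 fun ε hε => ?_
      obtain ⟨i, y, hy, hd⟩ := T.Aalg_approx hx hε
      refine ⟨y, ⟨i, ?_⟩, by rwa [dist_eq_norm]⟩
      have : T.W i ≤ T.C D i := by
        refine Submodule.span_le.2 ?_
        rintro x ⟨j, s, t, rfl⟩
        simpa using T.mem_C D i (one_mem D) j s t
      exact this hy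
    · refine subset_closure ⟨0, ?_⟩
      rw [← mul_one x, ← T.sum_diag_eq_one 0, Finset.mul_sum]
      refine Submodule.sum_mem _ fun _ _ => ?_
      rw [Finset.mul_sum]
      exact Submodule.sum_mem _ fun _ _ => T.mem_C D _ hx _ _ _
  have hb : b ∈ cstarGen ((T.Aalg : Set B) ∪ (D : Set B)) := by rw [hgen]; trivial
  have hb' : b ∈ closure (S : Set B) := by
    refine closure_minimal (s := ((NonUnitalStarAlgebra.adjoin ℂ
      ((T.Aalg : Set B) ∪ (D : Set B)) : NonUnitalStarSubalgebra ℂ B) : Set B)) hle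
      isClosed_closure hb
  obtain ⟨y, ⟨i, hi⟩, hd⟩ := Metric.mem_closure_iff.1 hb' ε hε
  exact ⟨i, y, hi, by rwa [dist_eq_norm] at hd⟩

lemma C_sandwich (hcomm : ∀ d ∈ D, ∀ i j s, d * T.e i j s s = T.e i j s s * d)
    {i k : ℕ} (j : Fin (T.K k)) (s t : Fin (T.n k j))
    (h : ∀ x ∈ T.W i, T.e k j s s * x * T.e k j t t = 0) {x : B} (hx : x ∈ T.C D i) :
    T.e k j s s * x * T.e k j t t = 0 := by
  induction hx using Submodule.span_induction with
  | zero => simp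
  | add a b _ _ ha hb => rw [mul_add, add_mul, ha, hb, add_zero]
  | smul c a _ ha => rw [mul_smul_comm, smul_mul_assoc, ha, smul_zero]
  | mem a ha =>
    obtain ⟨d, hd, j3, u, v, rfl⟩ := ha
    rw [← mul_assoc, ← hcomm d hd, mul_assoc, mul_assoc, ← mul_assoc (T.e k j s s),
      h _ (T.e_mem_W _ _ _ _), mul_zero]

end action

end MatrixUnitTower

namespace MatrixUnitTower

section core
variable {B : Type*} [CStarAlgebra B] (T : MatrixUnitTower B)

/-- The elementary perturbation element at level `k`. -/
noncomputable def pert (d : B) (k : ℕ) (σ τ : (j : Fin (T.K k)) → Fin (T.n k j) → Fin (T.n k j)) : B :=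
  ∑ j, ∑ s, (T.e k j s (σ j s) + d * T.e k j s (τ j s))

lemma pert_sandwich (d : B) (k : ℕ)
    (σ τ : (j : Fin (T.K k)) → Fin (T.n k j) → Fin (T.n k j))
    (hd : ∀ j s, d * T.e k j s s = T.e k j s s * d) (j : Fin (T.K k)) (s t : Fin (T.n k j)) :
    T.e k j s s * T.pert d k σ τ * T.e k j t t =
      (if σ j s = t then T.e k j s t else 0) + (if τ j s = t then d * T.e k j s t else 0) := by
  unfold pert
  rw [Finset.mul_sum, Finset.sum_mul, Finset.sum_eq_single j]
  · rw [Finset.mul_sum, Finset.sum_mul, Finset.sum_eq_single s]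
    · rw [mul_add, add_mul, ← mul_assoc, ← hd, mul_assoc d, T.diag_mul_e, T.diag_mul_e, mul_assoc d,
        T.e_mul_same, T.e_mul_same]
      by_cases h1 : σ j s = t <;> by_cases h2 : τ j s = t <;> simp [h1, h2]
    · intro u _ hu
      rw [mul_add, ← mul_assoc, ← hd, mul_assoc d, T.e_mul_same, T.e_mul_same]
      simp [hu.symm]
    · simp
  · intro j' _ hj
    rw [Finset.mul_sum, Finset.sum_mul]
    refine Finset.sum_eq_zero fun u _ => ?_
    rw [mul_add, ← mul_assoc, ← hd, mul_assoc d, T.e_mul_ne _ _ _ hj.symm,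
      T.e_mul_ne _ _ _ hj.symm]
    simp
  · simp

lemma pert_star_sandwich (d : B) (k : ℕ)
    (σ τ : (j : Fin (T.K k)) → Fin (T.n k j) → Fin (T.n k j))
    (hd : ∀ j s, d * T.e k j s s = T.e k j s s * d) (j : Fin (T.K k)) (s t : Fin (T.n k j))
    (h1 : σ j t ≠ s) (h2 : τ j t ≠ s) :
    T.e k j s s * star (T.pert d k σ τ) * T.e k j t t = 0 := by
  have h := congrArg star (T.pert_sandwich d k σ τ hd j t s)
  rw [if_neg h1, if_neg h2, star_mul, star_mul, T.e_star, T.e_star] at h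
  simpa [mul_assoc] using h

lemma core (S : NonUnitalStarSubalgebra ℂ B) (d : B) (k : ℕ)
    (σ τ : (j : Fin (T.K k)) → Fin (T.n k j) → Fin (T.n k j))
    (hd : ∀ j s, d * T.e k j s s = T.e k j s s * d)
    (hστ : ∀ j s, σ j s ≠ τ j s) (hσσ : ∀ j s, σ j (σ j s) ≠ s) (hτσ : ∀ j s, τ j (σ j s) ≠ s)
    (hστ' : ∀ j s, σ j (τ j s) ≠ s) (hττ : ∀ j s, τ j (τ j s) ≠ s)
    (hconn : ∀ j, ∀ R : Fin (T.n k j) → Fin (T.n k j) → Prop, Equivalence R →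
      (∀ s, R s (σ j s)) → ∀ s t, R s t)
    (b : B) (hbσ : ∀ j s, T.e k j s s * b * T.e k j (σ j s) (σ j s) = 0)
    (hbτ : ∀ j s, T.e k j s s * b * T.e k j (τ j s) (τ j s) = 0)
    (η : ℂ) (hη : η ≠ 0)
    (hS : ∀ j s, T.e k j s s ∈ S)
    (hbS : b + η • (T.pert d k σ τ + star (T.pert d k σ τ)) ∈ S) :
    (∀ j s t, T.e k j s t ∈ S) ∧ d ∈ S := by
  have key : ∀ j s t, T.e k j s s * b * T.e k j t t = 0 → σ j t ≠ s → τ j t ≠ s →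
      (if σ j s = t then T.e k j s t else 0) + (if τ j s = t then d * T.e k j s t else 0) ∈ S := by
    intro j s t h0 h1 h2
    have h3 := SMulMemClass.smul_mem η⁻¹ (mul_mem (mul_mem (hS j s) hbS) (hS j t))
    rw [mul_add, add_mul, h0, zero_add, mul_smul_comm, smul_mul_assoc, smul_smul,
      inv_mul_cancel₀ hη, one_smul, mul_add, add_mul, T.pert_star_sandwich d k σ τ hd j s t h1 h2,
      add_zero, T.pert_sandwich d k σ τ hd] at h3
    exact h3
  have h1 : ∀ j s, T.e k j s (σ j s) ∈ S := by
    intro j s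
    have := key j s (σ j s) (hbσ j s) (hσσ j s) (hτσ j s)
    rwa [if_pos rfl, if_neg (hστ j s).symm, add_zero] at this
  have h2 : ∀ j s, d * T.e k j s (τ j s) ∈ S := by
    intro j s
    have := key j s (τ j s) (hbτ j s) (hστ' j s) (hττ j s)
    rwa [if_pos rfl, if_neg (hστ j s), zero_add] at this
  have h3 : ∀ j s t, T.e k j s t ∈ S := by
    intro j
    refine hconn j (fun s t => T.e k j s t ∈ S) ⟨hS j, ?_, ?_⟩ (h1 j)
    · intro s t h
      have := star_mem h
      rwa [T.e_star] at this
    · intro s t u h h'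
      have := mul_mem h h'
      rwa [T.e_mul_same, if_pos rfl] at this
  refine ⟨h3, ?_⟩
  have h4 : d = ∑ j, ∑ s, (d * T.e k j s (τ j s)) * T.e k j (τ j s) s := by
    conv_lhs => rw [← mul_one d, ← T.sum_diag_eq_one k, Finset.mul_sum]
    refine Finset.sum_congr rfl fun j _ => ?_
    rw [Finset.mul_sum]
    refine Finset.sum_congr rfl fun s _ => ?_
    rw [mul_assoc, T.e_mul_same, if_pos rfl]
  rw [h4]
  exact sum_mem fun j _ => sum_mem fun s _ => mul_mem (h2 j s) (h3 _ _ _)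

/-- real span of the diagonal at level `i` -/
noncomputable def Vr (i : ℕ) : Submodule ℝ B :=
  Submodule.span ℝ (Set.range fun p : Σ j : Fin (T.K i), Fin (T.n i j) => T.e i p.1 p.2 p.2)

lemma Vr_mono {i i' : ℕ} (h : i ≤ i') : T.Vr i ≤ T.Vr i' := by
  refine monotone_nat_of_le_succ (f := T.Vr) (fun i => ?_) h
  refine Submodule.span_le.2 ?_
  rintro x ⟨p, rfl⟩
  dsimp only
  rw [SetLike.mem_coe, T.e_compat]
  exact Submodule.sum_mem _ fun j _ => Submodule.sum_mem _ fun t _ =>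
    Submodule.subset_span ⟨⟨j, T.L i p.1 j t p.2⟩, rfl⟩

/-- The complete space of candidates for generators. -/
def X : Set B := {G | G + star G ∈ closure {x | ∃ i, x ∈ T.Vr i}}

lemma X_closed : IsClosed T.X :=
  isClosed_closure.preimage (f := fun G : B => G + star G) (by fun_prop)

lemma X_zero : (0 : B) ∈ T.X := by
  refine subset_closure ⟨0, ?_⟩
  simp

lemma dense_core (hA_infdim : ¬ FiniteDimensional ℂ T.Aalg) (hA_simple : T.ASimple)
    (D : StarSubalgebra ℂ B)
    (hgen : cstarGen ((T.Aalg : Set B) ∪ (D : Set B)) = Set.univ)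
    (hcomm : ∀ d ∈ D, ∀ i j s, d * T.e i j s s = T.e i j s s * d)
    (hconj : ∀ d ∈ D, ∀ i j s t, T.e i j s t * d * T.e i j t s ∈ D)
    (G : B) (hG : G ∈ T.X) (ε : ℝ) (hε : 0 < ε) (d : B) (hd : d ∈ D) (k0 : ℕ) :
    ∃ G' ∈ T.X, ‖G - G'‖ < ε ∧ d ∈ NonUnitalStarAlgebra.adjoin ℂ ({G'} : Set B) ∧
      ∀ j s t, T.e k0 j s t ∈ NonUnitalStarAlgebra.adjoin ℂ ({G'} : Set B) := by
  classical
  obtain ⟨a, ha⟩ : ∃ a, a = G + star G := ⟨_, rfl⟩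
  obtain ⟨b, hb⟩ : ∃ b, b = -Complex.I • (G - star G) := ⟨_, rfl⟩
  have hbs : star b = b := by
    rw [hb, star_smul, star_sub, star_star]
    simp only [star_neg, Complex.star_def, Complex.conj_I, neg_neg]
    rw [neg_smul, ← smul_neg, neg_sub]
  have hGab : G = (1 / 2 : ℂ) • (a + Complex.I • b) := by
    rw [ha, hb, smul_smul, mul_neg, Complex.I_mul_I, neg_neg, one_smul]
    rw [show G + star G + (G - star G) = (2 : ℂ) • G by rw [two_smul]; abel, smul_smul]
    norm_num
  -- approximations
  have haX : a ∈ closure {x | ∃ i, x ∈ T.Vr i} := by rw [ha]; exact hG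
  obtain ⟨a₁, ⟨ia, ha₁⟩, hda⟩ := Metric.mem_closure_iff.1 haX (ε / 4) (by positivity)
  rw [dist_eq_norm] at hda
  obtain ⟨ib, y, hy, hdy⟩ := T.C_dense D hcomm hconj hgen b (ε := ε / 4) (by positivity)
  obtain ⟨i, hi⟩ : ∃ i, i = max (max ia ib) k0 := ⟨_, rfl⟩
  have hia : ia ≤ i := by omega
  have hib : ib ≤ i := by omega
  have hik : k0 ≤ i := by omega
  obtain ⟨b₁, hb₁⟩ : ∃ b₁, b₁ = (1 / 2 : ℂ) • (y + star y) := ⟨_, rfl⟩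
  have hb₁C : b₁ ∈ T.C D i := by
    rw [hb₁]
    have := T.C_mono D hib hy
    exact Submodule.smul_mem _ _ (add_mem this (T.C_star D hcomm hconj _ this))
  have hb₁s : star b₁ = b₁ := by
    rw [hb₁, star_smul, star_add, star_star, add_comm]
    simp
  have hdb : ‖b - b₁‖ < ε / 4 := by
    have h1 : b - b₁ = (1 / 2 : ℂ) • ((b - y) + star (b - y)) := by
      rw [hb₁, star_sub, hbs]
      have : b = (1 / 2 : ℂ) • (b + b) := by rw [← two_smul ℂ b, smul_smul]; norm_num
      conv_lhs => rw [this]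
      rw [← smul_sub]
      congr 1
      abel
    rw [h1, norm_smul]
    have h2 := norm_add_le (b - y) (star (b - y))
    rw [norm_star] at h2
    rw [show ‖(1 / 2 : ℂ)‖ = 1 / 2 by norm_num]
    linarith
  obtain ⟨k, hk, hsize⟩ := T.sizes_grow hA_simple hA_infdim i (4 * (∑ j, T.n i j) + 1)
  have hblk := T.exists_blocks hk (∑ j, T.n i j)
    (fun j => Finset.single_le_sum (f := fun j => T.n i j) (fun _ _ => Nat.zero_le _)
      (Finset.mem_univ j))
  choose Q blk hQ1 hQ2 using hblk
  have hcyc := fun j => cyc_maps (blk j) (hQ1 j) (hsize j)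
  choose σ τ hσ hτ hστ hσσ hτσ hστ' hττ hconn using hcyc
  -- the diagonal part
  have ha₁k : a₁ ∈ T.Vr k := T.Vr_mono (hia.trans hk) ha₁
  obtain ⟨α, hα⟩ := (Submodule.mem_span_range_iff_exists_fun ℝ).1 ha₁k
  let I := Σ j : Fin (T.K k), Fin (T.n k j)
  let f : I → B := fun p => T.e k p.1 p.2 p.2
  have hf : ∀ x y : I, f x * f y = if x = y then f x else 0 := by
    rintro ⟨j, s⟩ ⟨j', s'⟩
    by_cases h : j = j'
    · subst h
      simp only [f, T.e_mul_same]
      by_cases h' : s = s'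
      · subst h'; simp
      · rw [if_neg h', if_neg]
        intro h''
        exact h' (eq_of_heq (Sigma.mk.inj_iff.1 h'').2)
    · simp only [f]
      rw [T.e_mul_ne _ _ _ h, if_neg]
      intro h''
      exact h (Sigma.mk.inj_iff.1 h'').1
  obtain ⟨α', hinj, hα'⟩ := perturb α (δ := ε / 4 / (∑ p, ‖f p‖ + 1)) (by positivity)
  obtain ⟨a', ha'⟩ : ∃ a', a' = ∑ p, α' p • f p := ⟨_, rfl⟩
  have hda' : ‖a₁ - a'‖ ≤ ε / 4 := by
    have h1 : a₁ - a' = ∑ p, (α p - α' p) • f p := by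
      rw [ha', ← hα, ← Finset.sum_sub_distrib]
      exact Finset.sum_congr rfl fun p _ => (sub_smul _ _ _).symm
    rw [h1]
    refine (norm_sum_le _ _).trans ?_
    have h2 : ∑ p, ‖(α p - α' p) • f p‖ ≤ ∑ p, ε / 4 / (∑ p, ‖f p‖ + 1) * ‖f p‖ := by
      refine Finset.sum_le_sum fun p _ => ?_
      rw [norm_smul, Real.norm_eq_abs, abs_sub_comm]
      exact mul_le_mul_of_nonneg_right (hα' p).2 (norm_nonneg _)
    refine h2.trans ?_
    rw [← Finset.mul_sum, div_mul_eq_mul_div, div_le_iff₀ (by positivity)]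
    nlinarith
  have ha's : star a' = a' := by
    rw [ha', star_sum]
    refine Finset.sum_congr rfl fun p _ => ?_
    rw [star_smul]
    simp [f, T.e_star]
  have ha'V : a' ∈ T.Vr k := by
    rw [ha']
    exact Submodule.sum_mem _ fun p _ => Submodule.smul_mem _ _ (Submodule.subset_span ⟨p, rfl⟩)
  -- the off-diagonal part
  obtain ⟨c, hc⟩ : ∃ c, c = T.pert d k σ τ + star (T.pert d k σ τ) := ⟨_, rfl⟩
  have hcs : star c = c := by rw [hc, star_add, star_star, add_comm]
  obtain ⟨η, hη⟩ : ∃ η : ℝ, η = ε / 4 / (‖c‖ + 1) := ⟨_, rfl⟩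
  have hη0 : 0 < η := by rw [hη]; positivity
  obtain ⟨b', hb'⟩ : ∃ b', b' = b₁ + (η : ℂ) • c := ⟨_, rfl⟩
  have hb's : star b' = b' := by
    rw [hb', star_add, hb₁s, star_smul, hcs]
    simp
  have hdb' : ‖b₁ - b'‖ ≤ ε / 4 := by
    rw [hb', sub_add_cancel_left, norm_neg, norm_smul, Complex.norm_real, Real.norm_eq_abs,
      abs_of_pos hη0, hη, div_mul_eq_mul_div, div_le_iff₀ (by positivity)]
    nlinarith [norm_nonneg c]
  -- the new candidate
  obtain ⟨G', hG'⟩ : ∃ G', G' = (1 / 2 : ℂ) • (a' + Complex.I • b') := ⟨_, rfl⟩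
  have hG's : star G' = (1 / 2 : ℂ) • (a' - Complex.I • b') := by
    rw [hG', star_smul, star_add, star_smul, ha's, hb's]
    simp [sub_eq_add_neg]
  have hre : a' = G' + star G' := by
    rw [hG's, hG', ← smul_add, add_add_sub_cancel, ← two_smul ℂ a', smul_smul]
    norm_num
  have him : b' = -Complex.I • (G' - star G') := by
    rw [hG's, hG', ← smul_sub, add_sub_sub_cancel, ← two_smul ℂ (Complex.I • b'), smul_smul,
      smul_smul, smul_smul]
    rw [show -Complex.I * (1 / 2) * 2 * Complex.I = -(Complex.I * Complex.I) by ring]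
    simp
  obtain ⟨S, hS⟩ : ∃ S, S = NonUnitalStarAlgebra.adjoin ℂ ({G'} : Set B) := ⟨_, rfl⟩
  have hG'S : G' ∈ S := by
    rw [hS]; exact NonUnitalStarAlgebra.subset_adjoin ℂ _ (Set.mem_singleton G')
  have ha'S : a' ∈ S := by rw [hre]; exact add_mem hG'S (star_mem hG'S)
  have hb'S : b' ∈ S := by
    rw [him]; exact SMulMemClass.smul_mem _ (sub_mem hG'S (star_mem hG'S))
  have hdiag : ∀ j s, T.e k j s s ∈ S := fun j s =>
    diag_mem S f hf α' hinj (fun x => (hα' x).1) (by rw [← ha']; exact ha'S) ⟨j, s⟩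
  obtain ⟨h1, h2⟩ := T.core S d k σ τ (fun j s => hcomm d hd k j s) hστ hσσ hτσ hστ' hττ hconn b₁
    (fun j s => T.C_sandwich D hcomm j s _ (hQ2 j _ _ (hσ j s)) hb₁C)
    (fun j s => T.C_sandwich D hcomm j s _ (hQ2 j _ _ (hτ j s)) hb₁C)
    η (by exact_mod_cast hη0.ne') hdiag (by rw [← hc, ← hb']; exact hb'S)
  refine ⟨G', ?_, ?_, by rw [← hS]; exact h2, fun j s t => ?_⟩
  · refine subset_closure ⟨k, ?_⟩
    rw [← hre]; exact ha'V
  · have h3 : G - G' = (1 / 2 : ℂ) • ((a - a₁) + (a₁ - a') + Complex.I • ((b - b₁) + (b₁ - b'))) := by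
      rw [hGab, hG', ← smul_sub]
      congr 1
      rw [sub_add_sub_cancel, sub_add_sub_cancel, smul_sub]
      abel
    rw [h3, norm_smul]
    have h4 := norm_add_le ((a - a₁) + (a₁ - a')) (Complex.I • ((b - b₁) + (b₁ - b')))
    rw [norm_smul, Complex.norm_I, one_mul] at h4
    have h5 := norm_add_le (a - a₁) (a₁ - a')
    have h6 := norm_add_le (b - b₁) (b₁ - b')
    rw [show ‖(1 / 2 : ℂ)‖ = 1 / 2 by norm_num]
    linarith
  · rw [← hS]
    have h3 : ∀ x ∈ T.W k, x ∈ S := by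
      intro x hx
      induction hx using Submodule.span_induction with
      | zero => exact zero_mem _
      | add a b _ _ ha hb => exact add_mem ha hb
      | smul c a _ ha => exact SMulMemClass.smul_mem _ ha
      | mem a ha =>
        obtain ⟨j, s, t, rfl⟩ := ha
        exact h1 j s t
    exact h3 _ (T.W_mono (hik.trans hk) (T.e_mem_W _ _ _ _))

lemma unitsSet_countable : T.unitsSet.Countable := by
  have : T.unitsSet = Set.range (fun p : Σ i : ℕ, Σ j : Fin (T.K i), Fin (T.n i j) × Fin (T.n i j) =>
      T.e p.1 p.2.1 p.2.2.1 p.2.2.2) := by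
    ext x; constructor
    · rintro ⟨i, j, s, t, rfl⟩; exact ⟨⟨i, j, s, t⟩, rfl⟩
    · rintro ⟨⟨i, j, s, t⟩, rfl⟩; exact ⟨i, j, s, t, rfl⟩
  rw [this]
  exact Set.countable_range _

end core

end MatrixUnitTower

/-- a C*-algebra with an AF-action is singly generated. -/
theorem singly_generated_of_AFAction
    {B : Type*} [CStarAlgebra B] (T : MatrixUnitTower B)
    (hA_infdim : ¬ FiniteDimensional ℂ T.Aalg)
    (hA_simple : T.ASimple)
    (D : StarSubalgebra ℂ B)
    (hD_closed : IsClosed (D : Set B))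
    (hD_sep : TopologicalSpace.IsSeparable (D : Set B))
    (hB_gen : cstarGen ((T.Aalg : Set B) ∪ (D : Set B)) = Set.univ)
    (hcomm : ∀ d ∈ D, ∀ d' ∈ T.D0, d * d' = d' * d)
    (hconj : ∀ d ∈ D, ∀ i j s t, T.e i j s t * d * star (T.e i j s t) ∈ D) :
    ∃ G : B, cstarGen {G} = Set.univ := by
  have hcomm' : ∀ d ∈ D, ∀ i j s, d * T.e i j s s = T.e i j s s * d := fun d hd i j s =>
    hcomm d hd _ (subset_closure (NonUnitalStarAlgebra.subset_adjoin ℂ _ ⟨i, j, s, rfl⟩))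
  have hconj' : ∀ d ∈ D, ∀ i j s t, T.e i j s t * d * T.e i j t s ∈ D := fun d hd i j s t => by
    have := hconj d hd i j s t
    rwa [T.e_star] at this
  have hdense := T.dense_core hA_infdim hA_simple D hB_gen hcomm' hconj'
  obtain ⟨t, htD, htc, htd⟩ := hD_sep.exists_countable_dense_subset
  let C : Set B := t ∪ T.unitsSet
  have hC : C.Countable := htc.union T.unitsSet_countable
  have : Countable C := hC.to_subtype
  have : CompleteSpace T.X := T.X_closed.completeSpace_coe
  let U : C × ℕ → Set T.X := fun p =>
    {G | ∃ y ∈ NonUnitalStarAlgebra.adjoin ℂ ({(G : B)} : Set B), ‖y - p.1‖ < 1 / ((p.2 : ℝ) + 1)}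
  have hopen : ∀ p, IsOpen (U p) := by
    intro p
    rw [isOpen_iff_mem_nhds]
    rintro G ⟨y, hy, hlt⟩
    obtain ⟨f, hf, rfl, hf'⟩ := adjoin_cont hy
    have hc : Continuous fun G' : T.X => ‖f (G' : B) - p.1‖ := by fun_prop
    filter_upwards [hc.continuousAt.eventually_lt continuousAt_const hlt] with G' hG'
    exact ⟨f G', hf' _, hG'⟩
  have hdn : ∀ p, Dense (U p) := by
    rintro ⟨⟨c, hc⟩, m⟩
    rw [Metric.dense_iff]
    intro G ε hε
    have : ∃ G' ∈ T.X, ‖(G : B) - G'‖ < ε ∧ c ∈ NonUnitalStarAlgebra.adjoin ℂ ({G'} : Set B) := by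
      rcases hc with hc | ⟨i, j, s, u, rfl⟩
      · obtain ⟨G', h1, h2, h3, _⟩ := hdense G G.2 ε hε c (htD hc) 0
        exact ⟨G', h1, h2, h3⟩
      · obtain ⟨G', h1, h2, _, h3⟩ := hdense G G.2 ε hε 1 (one_mem D) i
        exact ⟨G', h1, h2, h3 _ _ _⟩
    obtain ⟨G', h1, h2, h3⟩ := this
    refine ⟨⟨G', h1⟩, ?_, c, h3, ?_⟩
    · rw [Metric.mem_ball, dist_comm, Subtype.dist_eq, dist_eq_norm]
      exact h2
    · rw [sub_self, norm_zero]; positivity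
  have : Nonempty T.X := ⟨⟨0, T.X_zero⟩⟩
  obtain ⟨G, hG⟩ := (dense_iInter_of_isOpen hopen hdn).nonempty
  rw [Set.mem_iInter] at hG
  refine ⟨G, ?_⟩
  let M := (NonUnitalStarAlgebra.adjoin ℂ ({(G : B)} : Set B)).topologicalClosure
  have hMc : IsClosed (M : Set B) := NonUnitalStarSubalgebra.isClosed_topologicalClosure _
  have hCM : ∀ c ∈ C, c ∈ M := by
    intro c hc
    refine Metric.mem_closure_iff.2 fun ε hε => ?_
    obtain ⟨m, hm⟩ := exists_nat_one_div_lt hε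
    obtain ⟨y, hy, hlt⟩ := hG (⟨c, hc⟩, m)
    refine ⟨y, hy, ?_⟩
    rw [dist_comm, dist_eq_norm]
    exact hlt.trans hm
  have hDM : (D : Set B) ⊆ M :=
    htd.trans (closure_minimal (fun c hc => hCM c (Or.inl hc)) hMc)
  have hWM : ∀ i, ∀ x ∈ T.W i, x ∈ M := by
    intro i x hx
    induction hx using Submodule.span_induction with
    | zero => exact zero_mem _
    | add a b _ _ ha hb => exact add_mem ha hb
    | smul c a _ ha => exact SMulMemClass.smul_mem _ ha
    | mem a ha =>
      obtain ⟨j, s, t, rfl⟩ := ha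
      exact hCM _ (Or.inr ⟨i, j, s, t, rfl⟩)
  have hAM : (T.Aalg : Set B) ⊆ M := by
    intro x hx
    rw [← hMc.closure_eq]
    refine Metric.mem_closure_iff.2 fun ε hε => ?_
    obtain ⟨i, y, hy, hd⟩ := T.Aalg_approx hx hε
    exact ⟨y, hWM i y hy, by rwa [dist_eq_norm]⟩
  refine Set.eq_univ_of_univ_subset ?_
  rw [← hB_gen]
  have hle : NonUnitalStarAlgebra.adjoin ℂ ((T.Aalg : Set B) ∪ (D : Set B)) ≤ M :=
    NonUnitalStarAlgebra.adjoin_le (Set.union_subset hAM hDM)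
  exact closure_minimal (s := ((NonUnitalStarAlgebra.adjoin ℂ
      ((T.Aalg : Set B) ∪ (D : Set B)) : NonUnitalStarSubalgebra ℂ B) : Set B)) hle hMc
end

section
/- Let B be a unital C*-algebra with an AF-action given by data (e^{(i)}_{j;s,t}, A, D) as described. Let p = e^{(i')}_{j';s,s} be any diagonal matrix unit of the system (for some i' ∈ ℕ, 1 ≤ j' ≤ K_{i'}, 1 ≤ s ≤ n_{i',j'}), and let d_1, …, d_m ∈ pDp = {pdp : d ∈ D} be self-adjoint elements. Then there exists an element g ∈ pBp that is invertible in the unital C*-algebra pBp such that d_1, …, d_m ∈ C*({g}). -/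
open Filter Topology in
/-- If `x` lies in a closed star-subalgebra `C`, `q x = x` and `x z = q` for a self-adjoint `q`,
then `q ∈ C`. -/
theorem afx_proj_mem {B : Type*} [CStarAlgebra B] (C : NonUnitalStarSubalgebra ℂ B)
    (hC : IsClosed (C : Set B)) (q x z : B) (hq : star q = q) (hx : x ∈ C)
    (hqx : q * x = x) (hxz : x * z = q) : q ∈ C := by
  have hqq : q * q = q := by
    calc q * q = q * (x * z) := by rw [hxz]
      _ = q := by rw [← mul_assoc, hqx, hxz]
  let C' : NonUnitalStarSubalgebra ℂ B :=
    { carrier := {c | c ∈ C ∧ q * c = c ∧ c * q = c}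
      add_mem' := by
        rintro a b ⟨h1, h2, h3⟩ ⟨h4, h5, h6⟩
        exact ⟨add_mem h1 h4, by rw [mul_add, h2, h5], by rw [add_mul, h3, h6]⟩
      zero_mem' := ⟨zero_mem C, by simp, by simp⟩
      mul_mem' := by
        rintro a b ⟨h1, h2, h3⟩ ⟨h4, h5, h6⟩
        exact ⟨mul_mem h1 h4, by rw [← mul_assoc, h2], by rw [mul_assoc, h6]⟩
      smul_mem' := by
        rintro c a ⟨h1, h2, h3⟩
        exact ⟨C.smul_mem' c h1, by rw [mul_smul_comm, h2], by rw [smul_mul_assoc, h3]⟩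
      star_mem' := by
        rintro a ⟨h1, h2, h3⟩
        refine ⟨star_mem h1, ?_, ?_⟩
        · have := congrArg star h3
          rwa [star_mul, hq] at this
        · have := congrArg star h2
          rwa [star_mul, hq] at this }
  have hC'mem : ∀ c, c ∈ C' ↔ (c ∈ C ∧ q * c = c ∧ c * q = c) := fun c => Iff.rfl
  have hC'closed : IsClosed (C' : Set B) := by
    have h1 : IsClosed {c : B | q * c = c} := isClosed_eq (by fun_prop) (by fun_prop)
    have h2 : IsClosed {c : B | c * q = c} := isClosed_eq (by fun_prop) (by fun_prop)
    exact hC.inter (h1.inter h2)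
  have : IsClosed (C' : Set B) := hC'closed
  let _ : NonUnitalCStarAlgebra C' := NonUnitalStarSubalgebra.nonUnitalCStarAlgebra C' (h_closed := hC'closed)
  let _ : PartialOrder C' := CStarAlgebra.spectralOrder C'
  have : StarOrderedRing C' := CStarAlgebra.spectralOrderedRing C'
  have hau := CStarAlgebra.increasingApproximateUnit C'
  have hne := hau.neBot
  have hh : x * star x ∈ C' := by
    refine (hC'mem _).2 ⟨mul_mem hx (star_mem hx), by rw [← mul_assoc, hqx], ?_⟩
    have := congrArg star hqx
    rw [star_mul, hq] at this
    rw [mul_assoc, this]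
  set l := CStarAlgebra.approximateUnit C' with hl
  have ht : Tendsto (fun u : C' => (u : B) * (x * star x)) l (𝓝 (x * star x)) :=
    (continuous_subtype_val.tendsto _).comp (hau.tendsto_mul_right ⟨_, hh⟩)
  have ht2 : Tendsto (fun u : C' => ‖(u : B) * x - x‖) l (𝓝 0) := by
    have h0 : Tendsto (fun u : C' => Real.sqrt (‖(u : B) * (x * star x) - x * star x‖ * 2)) l (𝓝 0) := by
      have := (tendsto_iff_norm_sub_tendsto_zero.1 ht).mul_const 2
      have := (Real.continuous_sqrt.tendsto _).comp this
      rw [zero_mul, Real.sqrt_zero] at this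
      exact this
    refine squeeze_zero' (Eventually.of_forall fun u => norm_nonneg _) ?_ h0
    filter_upwards [hau.eventually_norm] with u hu
    apply Real.le_sqrt_of_sq_le
    have hu' : ‖(u : B)‖ ≤ 1 := hu
    have e1 : ((u : B) * x - x) * star ((u : B) * x - x)
        = ((u : B) * (x * star x) - x * star x) * star (u : B)
          - ((u : B) * (x * star x) - x * star x) := by
      simp only [star_sub, star_mul]; noncomm_ring
    calc ‖(u : B) * x - x‖ ^ 2 = ‖((u : B) * x - x) * star ((u : B) * x - x)‖ := by
          rw [CStarRing.norm_self_mul_star, sq]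
      _ ≤ ‖((u : B) * (x * star x) - x * star x) * star (u : B)‖ +
          ‖(u : B) * (x * star x) - x * star x‖ := by rw [e1]; exact norm_sub_le _ _
      _ ≤ ‖(u : B) * (x * star x) - x * star x‖ * 1 + ‖(u : B) * (x * star x) - x * star x‖ := by
          gcongr
          refine (norm_mul_le _ _).trans ?_
          rw [norm_star]
          gcongr
      _ = _ := by ring
  have ht3 : Tendsto (fun u : C' => (u : B) * x) l (𝓝 x) :=
    tendsto_iff_norm_sub_tendsto_zero.2 ht2
  have ht4 : Tendsto (fun u : C' => (u : B)) l (𝓝 q) := by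
    have := ht3.mul_const z
    rw [hxz] at this
    refine this.congr fun u => ?_
    rw [mul_assoc, hxz]
    exact ((hC'mem _).1 u.2).2.2
  exact hC.mem_of_tendsto ht4 (Eventually.of_forall fun u => ((hC'mem _).1 u.2).1)

/-- Invertibility of upper triangular elements with nonzero scalar diagonal. -/
theorem afx_triang_inv {B : Type*} [Ring B] [Algebra ℂ B] {ι : Type*} [LinearOrder ι]
    (q : ι → B) (hqq : ∀ a, q a * q a = q a) (hqo : ∀ a b, a ≠ b → q a * q b = 0)
    (g : B) (lam : ι → ℂ) (hdiag : ∀ a, q a * g * q a = lam a • q a)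
    (hlow : ∀ a b, b < a → q a * g * q b = 0) (s : Finset ι) (hne : ∀ a ∈ s, lam a ≠ 0) :
    ∃ y, (∑ a ∈ s, q a) * y = y ∧ y * (∑ a ∈ s, q a) = y ∧
      (∑ a ∈ s, q a) * g * y = ∑ a ∈ s, q a ∧
      y * g * (∑ a ∈ s, q a) = ∑ a ∈ s, q a := by
  induction s using Finset.induction_on_max with
  | empty => exact ⟨0, by simp⟩
  | insert a s hs ih =>
    obtain ⟨y, h1, h2, h3, h4⟩ := ih fun b hb => hne b (Finset.mem_insert_of_mem hb)
    have ha : a ∉ s := fun h => lt_irrefl _ (hs a h)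
    have hl := hne a (Finset.mem_insert_self _ _)
    rw [Finset.sum_insert ha]
    set P := ∑ b ∈ s, q b with hP
    have hQP : q a * P = 0 := by
      rw [hP, Finset.mul_sum]
      exact Finset.sum_eq_zero fun b hb => hqo _ _ (hs b hb).ne'
    have hPQ : P * q a = 0 := by
      rw [hP, Finset.sum_mul]
      exact Finset.sum_eq_zero fun b hb => hqo _ _ (hs b hb).ne
    have hQgP : q a * g * P = 0 := by
      rw [hP, Finset.mul_sum]
      exact Finset.sum_eq_zero fun b hb => hlow _ _ (hs b hb)
    have hQy : q a * y = 0 := by rw [← h1, ← mul_assoc, hQP, zero_mul]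
    have hyQ : y * q a = 0 := by rw [← h2, mul_assoc, hPQ, mul_zero]
    have hQgy : q a * g * y = 0 := by rw [← h1, ← mul_assoc, hQgP, zero_mul]
    have hdiag' := hdiag a
    refine ⟨y - (lam a)⁻¹ • (y * g * q a) + (lam a)⁻¹ • q a, ?_, ?_, ?_, ?_⟩
    · have e1 : q a * (y * g * q a) = 0 := by rw [← mul_assoc, ← mul_assoc, hQy]; simp
      have e2 : P * (y * g * q a) = y * g * q a := by rw [← mul_assoc, ← mul_assoc, h1]
      simp only [add_mul, mul_add, mul_sub, mul_smul_comm, hQy, h1, e1, e2, hqq, hPQ]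
      simp
    · have e1 : (y * g * q a) * q a = y * g * q a := by rw [mul_assoc, hqq]
      have e2 : (y * g * q a) * P = 0 := by rw [mul_assoc, hQP, mul_zero]
      simp only [add_mul, mul_add, sub_mul, smul_mul_assoc, hyQ, h2, e1, e2, hqq, hQP]
      simp
      abel
    · have e1 : q a * g * (y * g * q a) = 0 := by
        rw [← mul_assoc, ← mul_assoc, hQgy]; simp
      have e2 : P * g * (y * g * q a) = P * g * q a := by
        rw [← mul_assoc, ← mul_assoc, h3]
      simp only [add_mul, mul_add, mul_sub, mul_smul_comm, hQgy, h3, e1, e2, hdiag']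
      simp [smul_smul, hl]
      abel
    · have e1 : (y * g * q a) * g * P = 0 := by
        rw [mul_assoc, mul_assoc, ← mul_assoc (q a), hQgP, mul_zero]
      have e2 : (y * g * q a) * g * q a = lam a • (y * g * q a) := by
        rw [mul_assoc, mul_assoc, ← mul_assoc (q a), hdiag', mul_smul_comm]
      simp only [add_mul, mul_add, sub_mul, smul_mul_assoc, h4, e1, e2, hdiag', hQgP]
      simp [smul_smul, hl]

/-- The diagonal projections of an upper triangular element with distinct scalar diagonal
entries lie in every closed star-subalgebra containing the element and the sum of the
projections. -/
theorem afx_diag_mem {B : Type*} [CStarAlgebra B] (C : NonUnitalStarSubalgebra ℂ B)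
    (hC : IsClosed (C : Set B)) {ι : Type*} [LinearOrder ι]
    (q : ι → B) (hqs : ∀ a, star (q a) = q a)
    (hqq : ∀ a, q a * q a = q a) (hqo : ∀ a b, a ≠ b → q a * q b = 0)
    (g : B) (hg : g ∈ C) (lam : ι → ℂ) (hinj : Function.Injective lam)
    (hdiag : ∀ a, q a * g * q a = lam a • q a)
    (hlow : ∀ a b, b < a → q a * g * q b = 0) (s : Finset ι) (hs : ∑ a ∈ s, q a ∈ C) :
    ∀ a ∈ s, q a ∈ C := by
  induction s using Finset.induction_on_max with
  | empty => simp
  | insert a s hlt ih =>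
    have ha : a ∉ s := fun h => lt_irrefl _ (hlt a h)
    rw [Finset.sum_insert ha] at hs
    have hPs : star (∑ b ∈ s, q b) = ∑ b ∈ s, q b := by
      rw [star_sum]; exact Finset.sum_congr rfl fun b _ => hqs b
    have hQP : q a * (∑ b ∈ s, q b) = 0 := by
      rw [Finset.mul_sum]
      exact Finset.sum_eq_zero fun b hb => hqo _ _ (hlt b hb).ne'
    have hPQ : (∑ b ∈ s, q b) * q a = 0 := by
      rw [Finset.sum_mul]
      exact Finset.sum_eq_zero fun b hb => hqo _ _ (hlt b hb).ne
    have hQgP : q a * g * (∑ b ∈ s, q b) = 0 := by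
      rw [Finset.mul_sum]
      exact Finset.sum_eq_zero fun b hb => hlow _ _ (hlt b hb)
    have hPP : (∑ b ∈ s, q b) * (∑ b ∈ s, q b) = (∑ b ∈ s, q b) := by
      rw [Finset.sum_mul]
      refine Finset.sum_congr rfl fun b hb => ?_
      rw [Finset.mul_sum, Finset.sum_eq_single_of_mem b hb, hqq]
      intro c _ hc
      exact hqo _ _ hc.symm
    obtain ⟨y, h1, h2, h3, h4⟩ := afx_triang_inv q hqq hqo (g - lam a • 1)
      (fun b => lam b - lam a)
      (fun b => by simp [mul_sub, sub_mul, hdiag, hqq, sub_smul])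
      (fun b c hbc => by simp [mul_sub, sub_mul, hlow b c hbc, hqo b c hbc.ne']) s
      (fun b hb => sub_ne_zero.2 (hinj.ne (hlt b hb).ne))
    set P := ∑ b ∈ s, q b with hP
    have hPmem : P ∈ C := by
      refine afx_proj_mem C hC P ((q a + P) * g * (q a + P) - lam a • (q a + P)) y hPs ?_ ?_ ?_
      · exact sub_mem (mul_mem (mul_mem hs hg) hs) (C.smul_mem' _ hs)
      · have e1 : P * (q a + P) = P := by rw [mul_add, hPQ, hPP, zero_add]
        have e2 : (q a + P) * g * (q a + P) = P * g * (q a + P) + lam a • q a := by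
          rw [add_mul, add_mul, mul_add, hdiag, hQgP]; abel
        rw [mul_sub, ← mul_assoc, ← mul_assoc, mul_smul_comm, e1, e2, smul_add]
        abel
      · have e1 : (q a + P) * y = y := by
          rw [add_mul, h1, ← h1, ← mul_assoc, hQP]; simp
        have e2 : q a * g * y = 0 := by rw [← h1, ← mul_assoc, hQgP, zero_mul]
        rw [sub_mul, mul_assoc, e1, smul_mul_assoc, e1, add_mul, add_mul, e2, zero_add]
        rw [mul_sub, sub_mul] at h3
        simpa [h1] using h3
    have hQmem : q a ∈ C := by
      have := sub_mem hs hPmem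
      simpa using this
    intro b hb
    rcases Finset.mem_insert.1 hb with rfl | hb
    · exact hQmem
    · exact ih hPmem b hb

/-- Packing finitely many off-diagonal entries into one generator. -/
theorem afx_pack {B : Type*} [CStarAlgebra B] {ι σ : Type*} [LinearOrder ι] [Fintype ι]
    [Fintype σ] (q : ι → B) (hqs : ∀ a, star (q a) = q a)
    (hqq : ∀ a, q a * q a = q a) (hqo : ∀ a b, a ≠ b → q a * q b = 0)
    (al be : σ → ι) (hlt : ∀ x, al x < be x)
    (hinj : ∀ x y, al x = al y → be x = be y → x = y)
    (w : σ → B) (hw1 : ∀ x, q (al x) * w x = w x) (hw2 : ∀ x, w x * q (be x) = w x) :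
    ∃ g : B, (∑ a, q a) * g * (∑ a, q a) = g ∧ cornerInvertible (∑ a, q a) g ∧
      ∀ C : NonUnitalStarSubalgebra ℂ B, IsClosed (C : Set B) → g ∈ C →
        (∀ a, q a ∈ C) ∧ (∀ x, w x ∈ C) := by
  classical
  obtain ⟨lam, hlam, hlam0⟩ : ∃ lam : ι → ℂ, Function.Injective lam ∧ ∀ a, lam a ≠ 0 := by
    refine ⟨fun a => ((Fintype.equivFin ι a : ℕ) : ℂ) + 1, ?_, ?_⟩
    · intro a b h
      have h' : ((Fintype.equivFin ι a : ℕ) : ℂ) = ((Fintype.equivFin ι b : ℕ) : ℂ) :=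
        add_right_cancel h
      exact (Fintype.equivFin ι).injective (Fin.ext (Nat.cast_injective h'))
    · intro a
      exact Nat.cast_add_one_ne_zero _
  have hPq : ∀ a, (∑ b, q b) * q a = q a := fun a => by
    rw [Finset.sum_mul, Finset.sum_eq_single a, hqq]
    · intro b _ hb; exact hqo _ _ hb
    · simp
  have hqP : ∀ a, q a * (∑ b, q b) = q a := fun a => by
    rw [Finset.mul_sum, Finset.sum_eq_single a, hqq]
    · intro b _ hb; exact hqo _ _ hb.symm
    · simp
  have hPP : (∑ b, q b) * (∑ b, q b) = ∑ b, q b := by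
    rw [Finset.sum_mul]; exact Finset.sum_congr rfl fun a _ => hqP a
  have hPw : ∀ x, (∑ b, q b) * w x = w x := fun x => by rw [← hw1 x, ← mul_assoc, hPq]
  have hwP : ∀ x, w x * (∑ b, q b) = w x := fun x => by rw [← hw2 x, mul_assoc, hqP]
  have hqw : ∀ a x, a ≠ al x → q a * w x = 0 := fun a x h => by
    rw [← hw1 x, ← mul_assoc, hqo _ _ h, zero_mul]
  have hwq : ∀ a x, be x ≠ a → w x * q a = 0 := fun a x h => by
    rw [← hw2 x, mul_assoc, hqo _ _ h, mul_zero]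
  have hent : ∀ a b, q a * (∑ c, lam c • q c + ∑ x, w x) * q b
      = (if a = b then lam a • q a else 0) + ∑ x, q a * w x * q b := by
    intro a b
    rw [mul_add, add_mul, Finset.mul_sum, Finset.sum_mul, Finset.mul_sum, Finset.sum_mul]
    congr 1
    rw [Finset.sum_eq_single a]
    · split_ifs with h
      · subst h; simp [hqq]
      · simp [hqq, hqo _ _ h]
    · intro c _ hc
      simp [hqo _ _ hc.symm]
    · simp
  set g := ∑ c, lam c • q c + ∑ x, w x with hg
  have hdiag : ∀ a, q a * g * q a = lam a • q a := fun a => by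
    rw [hent, if_pos rfl, Finset.sum_eq_zero, add_zero]
    intro x _
    by_cases h : a = al x
    · rw [mul_assoc, hwq, mul_zero]
      rw [h]; exact (hlt x).ne'
    · rw [hqw _ _ h, zero_mul]
  have hlow : ∀ a b, b < a → q a * g * q b = 0 := fun a b hab => by
    rw [hent, if_neg hab.ne', Finset.sum_eq_zero, add_zero]
    intro x _
    by_cases h : a = al x
    · rw [mul_assoc, hwq, mul_zero]
      rw [h] at hab; exact (hab.trans (hlt x)).ne'
    · rw [hqw _ _ h, zero_mul]
  have hwent : ∀ x, q (al x) * g * q (be x) = w x := fun x => by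
    rw [hent, if_neg (hlt x).ne, zero_add, Finset.sum_eq_single x, hw1, hw2]
    · intro y _ hy
      by_cases h : al x = al y
      · rw [mul_assoc, hwq, mul_zero]
        intro h'
        exact hy (hinj y x h.symm h')
      · rw [hqw _ _ h, zero_mul]
    · simp
  have hPg : (∑ b, q b) * g = g := by
    rw [hg, mul_add, Finset.mul_sum, Finset.mul_sum]
    congr 1
    · exact Finset.sum_congr rfl fun a _ => by rw [mul_smul_comm, hPq]
    · exact Finset.sum_congr rfl fun a _ => by rw [hPw]
  have hgP : g * (∑ b, q b) = g := by
    rw [hg, add_mul, Finset.sum_mul (f := fun c => lam c • q c), Finset.sum_mul (f := w)]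
    congr 1
    · exact Finset.sum_congr rfl fun a _ => by rw [smul_mul_assoc, hqP]
    · exact Finset.sum_congr rfl fun a _ => by rw [hwP]
  obtain ⟨y, h1, h2, h3, h4⟩ := afx_triang_inv q hqq hqo g lam hdiag hlow Finset.univ
    fun a _ => hlam0 a
  rw [hPg] at h3
  rw [mul_assoc, hgP] at h4
  refine ⟨g, by rw [hPg, hgP], ⟨y, by rw [h1, h2], h3, h4⟩, ?_⟩
  intro C hC hgC
  have hPC : (∑ b, q b) ∈ C := by
    refine afx_proj_mem C hC _ g y ?_ hgC hPg h3
    rw [star_sum]; exact Finset.sum_congr rfl fun b _ => hqs b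
  have hqC : ∀ a, q a ∈ C := fun a =>
    afx_diag_mem C hC q hqs hqq hqo g hgC lam hlam hdiag hlow Finset.univ hPC a
      (Finset.mem_univ a)
  refine ⟨hqC, fun x => ?_⟩
  rw [← hwent x]
  exact mul_mem (mul_mem (hqC _) hgC) (hqC _)

/-- In a finite subset of a linear order with at least `2 * m + 3` elements, there are enough pairs
above the minimum. -/
theorem afx_slots_block {ι : Type*} [LinearOrder ι] (F : Finset ι) (m : ℕ)
    (hF : 2 * m + 3 ≤ F.card) :
    ∃ b ∈ F, (∀ x ∈ F, b ≤ x) ∧ ∃ phi : F × Fin m → ι × ι, Function.Injective phi ∧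
      ∀ z, (phi z).1 ∈ F ∧ (phi z).2 ∈ F ∧ b < (phi z).1 ∧ (phi z).1 < (phi z).2 := by
  classical
  have hne : F.Nonempty := Finset.card_pos.1 (by omega)
  refine ⟨F.min' hne, F.min'_mem hne, fun x hx => F.min'_le x hx, ?_⟩
  set b := F.min' hne with hb
  set G := F.erase b with hG
  have hGc : G.card + 1 = F.card := Finset.card_erase_add_one (F.min'_mem hne)
  set P := (G ×ˢ G).filter (fun z => z.1 < z.2) with hP
  have h1 : G.offDiag.card ≤ P.card + (P.image Prod.swap).card := by
    refine le_trans (Finset.card_le_card ?_) (Finset.card_union_le _ _)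
    rintro ⟨x, y⟩ hxy
    rw [Finset.mem_offDiag] at hxy
    obtain ⟨hx, hy, hxy⟩ := hxy
    rw [Finset.mem_union]
    rcases lt_or_gt_of_ne hxy with h | h
    · left
      exact Finset.mem_filter.2 ⟨Finset.mem_product.2 ⟨hx, hy⟩, h⟩
    · right
      exact Finset.mem_image.2 ⟨(y, x), Finset.mem_filter.2 ⟨Finset.mem_product.2 ⟨hy, hx⟩, h⟩, rfl⟩
  have h2 : (P.image Prod.swap).card ≤ P.card := Finset.card_image_le
  rw [Finset.offDiag_card] at h1
  have h3 : Fintype.card (F × Fin m) ≤ Fintype.card P := by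
    rw [Fintype.card_prod, Fintype.card_coe, Fintype.card_coe, Fintype.card_fin]
    have h4 : G.card * G.card ≤ 2 * P.card + G.card := by omega
    rw [← hGc] at hF ⊢
    nlinarith
  obtain ⟨f⟩ := Function.Embedding.nonempty_of_card_le h3
  refine ⟨fun z => (f z : ι × ι), fun x y h => f.injective (Subtype.ext h), fun z => ?_⟩
  have hz := Finset.mem_filter.1 (f z).2
  rw [Finset.mem_product] at hz
  obtain ⟨⟨hz1, hz2⟩, hz3⟩ := hz
  rw [hG, Finset.mem_erase] at hz1 hz2
  exact ⟨hz1.2, hz2.2, lt_of_le_of_ne (F.min'_le _ hz1.2) hz1.1.symm, hz3⟩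

theorem afx_slots {ι κ : Type*} [LinearOrder ι] [Fintype ι] [DecidableEq κ] (bl : ι → κ) (m : ℕ)
    (hF : ∀ a, 2 * m + 3 ≤ (Finset.univ.filter fun x => bl x = bl a).card) :
    ∃ (base : ι → ι) (phi : ι × Fin m → ι × ι),
      (∀ a, bl (base a) = bl a) ∧ (∀ a, base a ≤ a) ∧
      (∀ a b, bl a = bl b → base a = base b) ∧
      Function.Injective phi ∧
      ∀ a k, bl (phi (a, k)).1 = bl a ∧ bl (phi (a, k)).2 = bl a ∧
        base a < (phi (a, k)).1 ∧ (phi (a, k)).1 < (phi (a, k)).2 := by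
  classical
  choose b hbF hmin phi hphi hz using fun F : Finset ι => afx_slots_block F m
  have hmem : ∀ a x, x ∈ (Finset.univ.filter fun x => bl x = bl a) ↔ bl x = bl a := by simp
  set F : ι → Finset ι := fun a => Finset.univ.filter fun x => bl x = bl a with hFdef
  have hFeq : ∀ a c, bl a = bl c → F a = F c := fun a c h => by simp [hFdef, h]
  have key : ∀ (F1 F2 : Finset ι) (h1 h2) (z1 : F1 × Fin m) (z2 : F2 × Fin m), F1 = F2 →
      phi F1 h1 z1 = phi F2 h2 z2 → (z1.1 : ι) = z2.1 ∧ z1.2 = z2.2 := by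
    rintro F1 F2 h1 h2 z1 z2 rfl h
    have := hphi _ _ h
    subst this
    exact ⟨rfl, rfl⟩
  refine ⟨fun a => b (F a) (hF a), fun z => phi (F z.1) (hF z.1) (⟨z.1, (hmem _ _).2 rfl⟩, z.2),
    fun a => (hmem _ _).1 (hbF (F a) (hF a)), fun a => hmin (F a) (hF a) a ((hmem _ _).2 rfl),
    ?_, ?_, ?_⟩
  · intro a c h
    have := hFeq a c h
    simp only [this]
  · rintro ⟨a, k⟩ ⟨c, l⟩ h
    have ha := (hmem _ _).1 (hz (F a) (hF a) (⟨a, (hmem _ _).2 rfl⟩, k)).1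
    have hc := (hmem _ _).1 (hz (F c) (hF c) (⟨c, (hmem _ _).2 rfl⟩, l)).1
    have h' : phi (F a) (hF a) (⟨a, (hmem _ _).2 rfl⟩, k)
      = phi (F c) (hF c) (⟨c, (hmem _ _).2 rfl⟩, l) := h
    rw [h'] at ha
    have := key _ _ _ _ _ _ (hFeq a c (ha.symm.trans hc)) h'
    exact Prod.ext this.1 this.2
  · intro a k
    have := hz (F a) (hF a) (⟨a, (hmem _ _).2 rfl⟩, k)
    exact ⟨(hmem _ _).1 this.1, (hmem _ _).1 this.2.1, this.2.2.1, this.2.2.2⟩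

/-- The generator theorem in terms of an abstract system of matrix units with large blocks. -/
theorem afx_blocks {B : Type*} [CStarAlgebra B] {ι κ : Type*} [Fintype ι] [LinearOrder ι]
    [DecidableEq κ] (bl : ι → κ) (f : ι → ι → B)
    (hmul : ∀ a b c, bl a = bl b → bl b = bl c → f a b * f b c = f a c)
    (horth : ∀ a b, a ≠ b → f a a * f b b = 0)
    (hstar : ∀ a b, bl a = bl b → star (f a b) = f b a)
    (m : ℕ) (hF : ∀ a, 2 * m + 3 ≤ (Finset.univ.filter fun x => bl x = bl a).card)
    (d : Fin m → B) (hd : ∀ k, d k = ∑ a, f a a * d k * f a a) :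
    ∃ g : B, (∑ a, f a a) * g * (∑ a, f a a) = g ∧ cornerInvertible (∑ a, f a a) g ∧
      ∀ C : NonUnitalStarSubalgebra ℂ B, IsClosed (C : Set B) → g ∈ C → ∀ k, d k ∈ C := by
  classical
  obtain ⟨base, phi, hb1, hb2, hb3, hphi, hph⟩ := afx_slots bl m hF
  have hbb : ∀ a, base (base a) = base a := fun a => hb3 _ _ (hb1 a)
  have hnb : ∀ a k x, (phi (a, k)).1 ≠ base x := by
    intro a k x h
    have h1 := (hph a k).2.2.1
    have h2 := hb3 _ _ (hph a k).1
    rw [← h2, h, hbb] at h1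
    exact lt_irrefl _ h1
  obtain ⟨g, hg1, hg2, hg3⟩ := afx_pack (σ := {x : ι // base x ≠ x} ⊕ (ι × Fin m))
    (fun a => f a a) (fun a => hstar a a rfl) (fun a => hmul a a a rfl rfl) horth
    (Sum.elim (fun x => base x.1) (fun z => (phi z).1))
    (Sum.elim (fun x => x.1) (fun z => (phi z).2))
    (by
      rintro (x | ⟨a, k⟩)
      · exact lt_of_le_of_ne (hb2 _) x.2
      · exact (hph a k).2.2.2)
    (by
      rintro (x | ⟨a, k⟩) (y | ⟨c, l⟩) h1 h2
      · exact congrArg _ (Subtype.ext h2)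
      · exact absurd h1.symm (hnb _ _ _)
      · exact absurd h1 (hnb _ _ _)
      · exact congrArg _ (hphi (Prod.ext h1 h2)))
    (Sum.elim (fun x => f (base x.1) x.1)
      (fun z => f (phi z).1 z.1 * d z.2 * f z.1 (phi z).2))
    (by
      rintro (x | ⟨a, k⟩)
      · exact hmul _ _ _ rfl (hb1 _)
      · simp only [Sum.elim_inr]
        rw [← mul_assoc, ← mul_assoc, hmul _ _ _ rfl (hph a k).1])
    (by
      rintro (x | ⟨a, k⟩)
      · exact hmul _ _ _ (hb1 _) rfl
      · simp only [Sum.elim_inr]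
        rw [mul_assoc, hmul _ _ _ (hph a k).2.1.symm rfl])
  refine ⟨g, hg1, hg2, fun C hC hgC k => ?_⟩
  obtain ⟨hq, hw⟩ := hg3 C hC hgC
  have hbase : ∀ x, f (base x) x ∈ C := by
    intro x
    by_cases h : base x = x
    · rw [h]; exact hq x
    · exact hw (Sum.inl ⟨x, h⟩)
  have hall : ∀ x y, bl x = bl y → f x y ∈ C := by
    intro x y h
    have h1 : f x (base x) ∈ C := by
      rw [← hstar _ _ (hb1 x)]; exact star_mem (hbase x)
    rw [← hmul x (base x) y (hb1 x).symm ((hb1 x).trans h)]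
    refine mul_mem h1 ?_
    rw [hb3 x y h]; exact hbase y
  rw [hd k]
  refine sum_mem fun a _ => ?_
  have h1 := hw (Sum.inr (a, k))
  simp only [Sum.elim_inr] at h1
  obtain ⟨p1, p2, -, -⟩ := hph a k
  have h2 := mul_mem (mul_mem (hall a (phi (a, k)).1 p1.symm) h1) (hall (phi (a, k)).2 a p2)
  have e : f a (phi (a, k)).1 * (f (phi (a, k)).1 a * d k * f a (phi (a, k)).2)
      * f (phi (a, k)).2 a = f a a * d k * f a a := by
    have e1 := hmul a (phi (a, k)).1 a p1.symm p1
    have e2 := hmul a (phi (a, k)).2 a p2.symm p2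
    calc f a (phi (a, k)).1 * (f (phi (a, k)).1 a * d k * f a (phi (a, k)).2)
          * f (phi (a, k)).2 a
        = (f a (phi (a, k)).1 * f (phi (a, k)).1 a) * d k *
          (f a (phi (a, k)).2 * f (phi (a, k)).2 a) := by noncomm_ring
      _ = _ := by rw [e1, e2]
  rw [e] at h2
  exact h2
namespace MatrixUnitTower

variable {B : Type*} [CStarAlgebra B]

theorem afx_child (T : MatrixUnitTower B) (i : ℕ) (j' : Fin (T.K i)) (j : Fin (T.K (i + 1)))
    (t : Fin (T.m i j' j)) (l k : Fin (T.n i j')) :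
    T.e i j' l k * T.e (i + 1) j (T.L i j' j t k) (T.L i j' j t k)
      = T.e (i + 1) j (T.L i j' j t l) (T.L i j' j t k) := by
  rw [T.e_compat, Finset.sum_mul, Finset.sum_eq_single j]
  · rw [Finset.sum_mul, Finset.sum_eq_single t]
    · rw [T.e_mul_same, if_pos rfl]
    · intro t' _ ht
      rw [T.e_mul_same, if_neg]
      intro h
      have := (T.L_bij i j).1 (a₁ := ⟨j', t', k⟩) (a₂ := ⟨j', t, k⟩) h
      simp at this
      exact ht this
    · simp
  · intro j1 _ hj
    rw [Finset.sum_mul]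
    exact Finset.sum_eq_zero fun t' _ => T.e_mul_ne _ _ _ hj _ _ _ _
  · simp

theorem afx_step (T : MatrixUnitTower B) (i : ℕ) (j : Fin (T.K i)) (l k : Fin (T.n i j))
    (j2 : Fin (T.K (i + 1))) (u : Fin (T.n (i + 1) j2)) :
    T.e i j l k * T.e (i + 1) j2 u u = 0 ∨
      ∃ u', T.e i j l k * T.e (i + 1) j2 u u = T.e (i + 1) j2 u' u := by
  obtain ⟨⟨j', t, v⟩, rfl⟩ := (T.L_bij i j2).2 u
  dsimp only
  have h := T.afx_child i j' j2 t v v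
  by_cases hj : j = j'
  · subst hj
    by_cases hk : k = v
    · subst hk
      exact Or.inr ⟨_, T.afx_child i j j2 t l k⟩
    · left
      rw [← h, ← mul_assoc, T.e_mul_same, if_neg hk, zero_mul]
  · left
    rw [← h, ← mul_assoc, T.e_mul_ne _ _ _ hj, zero_mul]

theorem afx_mul (T : MatrixUnitTower B) (i : ℕ) (j : Fin (T.K i)) (l k : Fin (T.n i j))
    (i2 : ℕ) (hi : i ≤ i2) : ∀ (j2 : Fin (T.K i2)) (u : Fin (T.n i2 j2)),
    T.e i j l k * T.e i2 j2 u u = 0 ∨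
      ∃ u', T.e i j l k * T.e i2 j2 u u = T.e i2 j2 u' u := by
  induction i2, hi using Nat.le_induction with
  | base =>
    intro j2 u
    by_cases hj : j = j2
    · subst hj
      rw [T.e_mul_same]
      split_ifs with h
      · subst h; exact Or.inr ⟨_, rfl⟩
      · exact Or.inl rfl
    · exact Or.inl (T.e_mul_ne _ _ _ hj _ _ _ _)
  | succ i2 hi ih =>
    intro j3 u
    obtain ⟨⟨j', t, v⟩, rfl⟩ := (T.L_bij i2 j3).2 u
    dsimp only
    have h := T.afx_child i2 j' j3 t v v
    rcases ih j' v with h0 | ⟨v', h0⟩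
    · left
      rw [← h, ← mul_assoc, h0, zero_mul]
    · rw [← h, ← mul_assoc, h0]
      exact T.afx_step _ _ _ _ _ _

/-- Index set of the diagonal matrix units at level `i`. -/
abbrev afxX (T : MatrixUnitTower B) (i : ℕ) : Type := Σ j : Fin (T.K i), Fin (T.n i j)

/-- Diagonal matrix unit. -/
noncomputable def afxq (T : MatrixUnitTower B) (i : ℕ) (x : T.afxX i) : B := T.e i x.1 x.2 x.2

theorem afxq_ne (T : MatrixUnitTower B) (i : ℕ) (x : T.afxX i) : T.afxq i x ≠ 0 :=
  T.e_ne_zero _ _ _ _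

theorem afxq_star (T : MatrixUnitTower B) (i : ℕ) (x : T.afxX i) :
    star (T.afxq i x) = T.afxq i x := T.e_star _ _ _ _

theorem afxq_idem (T : MatrixUnitTower B) (i : ℕ) (x : T.afxX i) :
    T.afxq i x * T.afxq i x = T.afxq i x := by
  rw [afxq, T.e_mul_same, if_pos rfl]

theorem afxq_orth (T : MatrixUnitTower B) (i : ℕ) (x y : T.afxX i) (h : x ≠ y) :
    T.afxq i x * T.afxq i y = 0 := by
  obtain ⟨j, u⟩ := x
  obtain ⟨j', v⟩ := y
  simp only [afxq]
  by_cases hj : j = j'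
  · subst hj
    rw [T.e_mul_same, if_neg]
    rintro rfl
    exact h rfl
  · exact T.e_mul_ne _ _ _ hj _ _ _ _

theorem afxq_sum (T : MatrixUnitTower B) (i : ℕ) : ∑ x, T.afxq i x = 1 := by
  rw [← T.sum_diag_eq_one i, Fintype.sum_sigma]
  rfl

theorem afxq_mul (T : MatrixUnitTower B) (i i2 : ℕ) (hi : i ≤ i2) (x : T.afxX i)
    (y : T.afxX i2) (h : T.afxq i x * T.afxq i2 y ≠ 0) :
    T.afxq i x * T.afxq i2 y = T.afxq i2 y := by
  obtain ⟨j, t⟩ := x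
  obtain ⟨j2, u⟩ := y
  have hid := T.afxq_idem i ⟨j, t⟩
  simp only [afxq] at h hid ⊢
  rcases T.afx_mul i j t t i2 hi j2 u with h0 | ⟨u', h0⟩
  · exact absurd h0 h
  by_cases hu : u = u'
  · rw [h0, hu]
  exfalso
  have e1 : star (T.e i j t t * T.e i2 j2 u u) * (T.e i j t t * T.e i2 j2 u u)
      = T.e i2 j2 u u * (T.e i j t t * T.e i2 j2 u u) := by
    rw [star_mul, T.e_star, T.e_star, mul_assoc, ← mul_assoc (T.e i j t t), hid]
  rw [h0, T.e_star, T.e_mul_same, T.e_mul_same, if_pos rfl, if_neg hu] at e1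
  exact T.e_ne_zero _ _ _ _ e1

theorem afxq_cover (T : MatrixUnitTower B) (i i2 : ℕ) (y : T.afxX i2) :
    ∃ x : T.afxX i, T.afxq i x * T.afxq i2 y ≠ 0 := by
  by_contra! h
  apply T.afxq_ne i2 y
  rw [← one_mul (T.afxq i2 y), ← T.afxq_sum i, Finset.sum_mul]
  exact Finset.sum_eq_zero fun x _ => h x

/-- Descendants at level `i2`. -/
noncomputable def afxDesc (T : MatrixUnitTower B) (i : ℕ) (x : T.afxX i) (i2 : ℕ) :
    Finset (T.afxX i2) :=
  open Classical in Finset.univ.filter fun y => T.afxq i x * T.afxq i2 y ≠ 0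

theorem mem_afxDesc (T : MatrixUnitTower B) (i : ℕ) (x : T.afxX i) (i2 : ℕ) (y : T.afxX i2) :
    y ∈ T.afxDesc i x i2 ↔ T.afxq i x * T.afxq i2 y ≠ 0 := by
  simp [afxDesc]

theorem afxDesc_trans (T : MatrixUnitTower B) (i i2 i3 : ℕ) (h1 : i ≤ i2) (h2 : i2 ≤ i3)
    (x : T.afxX i) (y : T.afxX i2) (z : T.afxX i3) (hy : y ∈ T.afxDesc i x i2)
    (hz : z ∈ T.afxDesc i2 y i3) : z ∈ T.afxDesc i x i3 := by
  rw [mem_afxDesc] at *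
  rw [← T.afxq_mul _ _ h2 _ _ hz, ← mul_assoc, T.afxq_mul _ _ h1 _ _ hy]
  exact hz

theorem afxDesc_unique (T : MatrixUnitTower B) (i i2 : ℕ) (h1 : i ≤ i2)
    (x x' : T.afxX i) (y : T.afxX i2) (hy : y ∈ T.afxDesc i x i2)
    (hz : y ∈ T.afxDesc i x' i2) : x = x' := by
  rw [mem_afxDesc] at *
  by_contra h
  apply hy
  rw [← T.afxq_mul _ _ h1 _ _ hz, ← mul_assoc, T.afxq_orth _ _ _ h, zero_mul]

theorem afxDesc_card (T : MatrixUnitTower B) (i i2 : ℕ) (h1 : i ≤ i2) (j : Fin (T.K i))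
    (t t' : Fin (T.n i j)) :
    (T.afxDesc i ⟨j, t⟩ i2).card ≤ (T.afxDesc i ⟨j, t'⟩ i2).card := by
  have key : ∀ y ∈ T.afxDesc i ⟨j, t⟩ i2, ∃ u' : Fin (T.n i2 y.1),
      T.e i j t' t * T.e i2 y.1 y.2 y.2 = T.e i2 y.1 u' y.2 := by
    intro y hy
    have hy' := T.afxq_mul _ _ h1 _ _ ((T.mem_afxDesc _ _ _ _).1 hy)
    rcases T.afx_mul i j t' t i2 h1 y.1 y.2 with h0 | h0
    · exfalso
      apply T.afxq_ne _ y
      rw [← hy']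
      simp only [afxq]
      have : T.e i j t t = T.e i j t t' * T.e i j t' t := by rw [T.e_mul_same, if_pos rfl]
      rw [this, mul_assoc, h0, mul_zero]
    · exact h0
  have hnon : ∀ y : T.afxX i2, Nonempty (Fin (T.n i2 y.1)) := fun y => ⟨y.2⟩
  choose! u' hu' using key
  have hback : ∀ y ∈ T.afxDesc i ⟨j, t⟩ i2,
      T.e i j t t' * T.e i2 y.1 (u' y) (u' y) = T.e i2 y.1 y.2 (u' y) := by
    intro y hy
    have hy' := T.afxq_mul _ _ h1 _ _ ((T.mem_afxDesc _ _ _ _).1 hy)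
    simp only [afxq] at hy'
    have e1 : T.e i2 y.1 (u' y) (u' y) = T.e i2 y.1 (u' y) y.2 * T.e i2 y.1 y.2 (u' y) := by
      rw [T.e_mul_same, if_pos rfl]
    rw [e1, ← hu' y hy, ← mul_assoc, ← mul_assoc, T.e_mul_same, if_pos rfl, hy',
      T.e_mul_same, if_pos rfl]
  refine Finset.card_le_card_of_injOn (fun y => ⟨y.1, u' y⟩) ?_ ?_
  · intro y hy
    have hb := hback y hy
    rw [Finset.mem_coe, mem_afxDesc]
    simp only [afxq]
    intro h0
    have e1 : T.e i j t t' = T.e i j t t' * T.e i j t' t' := by rw [T.e_mul_same, if_pos rfl]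
    rw [e1, mul_assoc, h0, mul_zero] at hb
    exact T.e_ne_zero _ _ _ _ hb.symm
  · rintro ⟨j1, u1⟩ hy ⟨j2, u2⟩ hz h
    have hb1 := hback _ hy
    have hb2 := hback _ hz
    obtain ⟨rfl, h2⟩ := Sigma.mk.inj_iff.1 h
    have h2 := eq_of_heq h2
    dsimp only at h2 hb1 hb2
    rw [h2, hb2] at hb1
    by_contra hne
    have hne' : u1 ≠ u2 := fun h => hne (by rw [h])
    have := congrArg (fun z => T.e i2 j1 u1 u1 * z) hb1
    simp only [T.e_mul_same, if_pos, if_neg hne'] at this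
    exact T.e_ne_zero _ _ _ _ this.symm

end MatrixUnitTower
namespace MatrixUnitTower

variable {B : Type*} [CStarAlgebra B]

/-- Linear span of the level `i` matrix units. -/
noncomputable def afxA (T : MatrixUnitTower B) (i : ℕ) : Submodule ℂ B :=
  Submodule.span ℂ (Set.range fun z : (Σ j : Fin (T.K i), Fin (T.n i j) × Fin (T.n i j)) =>
    T.e i z.1 z.2.1 z.2.2)

theorem afxA_mem (T : MatrixUnitTower B) (i : ℕ) (j : Fin (T.K i)) (s t : Fin (T.n i j)) :
    T.e i j s t ∈ T.afxA i :=
  Submodule.subset_span ⟨⟨j, s, t⟩, rfl⟩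

theorem afxA_le (T : MatrixUnitTower B) (i : ℕ) (M : Submodule ℂ B)
    (h : ∀ j s t, T.e i j s t ∈ M) : T.afxA i ≤ M := by
  refine Submodule.span_le.2 ?_
  rintro _ ⟨⟨j, s, t⟩, rfl⟩
  exact h j s t

theorem afxA_mono (T : MatrixUnitTower B) : Monotone T.afxA := by
  refine monotone_nat_of_le_succ fun i => ?_
  refine T.afxA_le i _ fun j s t => ?_
  rw [T.e_compat]
  exact sum_mem fun _ _ => sum_mem fun _ _ => T.afxA_mem _ _ _ _

theorem afxA_mul (T : MatrixUnitTower B) (i : ℕ) (x y : B) (hx : x ∈ T.afxA i)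
    (hy : y ∈ T.afxA i) : x * y ∈ T.afxA i := by
  have h : T.afxA i * T.afxA i ≤ T.afxA i := by
    rw [afxA, Submodule.span_mul_span, Submodule.span_le]
    rintro _ ⟨_, ⟨⟨j, s, t⟩, rfl⟩, _, ⟨⟨j', s', t'⟩, rfl⟩, rfl⟩
    change T.e i j s t * T.e i j' s' t' ∈ T.afxA i
    by_cases hj : j = j'
    · subst hj
      rw [T.e_mul_same]
      split_ifs
      · exact T.afxA_mem _ _ _ _
      · exact zero_mem _
    · rw [T.e_mul_ne _ _ _ hj]
      exact zero_mem _
  exact h (Submodule.mul_mem_mul hx hy)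

theorem afxA_star (T : MatrixUnitTower B) (i : ℕ) (x : B) (hx : x ∈ T.afxA i) :
    star x ∈ T.afxA i := by
  induction hx using Submodule.span_induction with
  | mem x h =>
    obtain ⟨⟨j, s, t⟩, rfl⟩ := h
    dsimp only
    rw [T.e_star]
    exact T.afxA_mem _ _ _ _
  | zero => rw [star_zero]; exact zero_mem _
  | add x y _ _ hx hy => rw [star_add]; exact add_mem hx hy
  | smul a x _ hx => rw [star_smul]; exact Submodule.smul_mem _ _ hx

theorem afxA_one (T : MatrixUnitTower B) (i : ℕ) : (1 : B) ∈ T.afxA i := by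
  rw [← T.sum_diag_eq_one i]
  exact sum_mem fun _ _ => sum_mem fun _ _ => T.afxA_mem _ _ _ _

theorem afxA_exists (T : MatrixUnitTower B) (x : B)
    (hx : x ∈ StarAlgebra.adjoin ℂ T.unitsSet) : ∃ i, x ∈ T.afxA i := by
  induction hx using StarAlgebra.adjoin_induction with
  | mem x h =>
    obtain ⟨i, j, s, t, rfl⟩ := h
    exact ⟨i, T.afxA_mem _ _ _ _⟩
  | algebraMap r =>
    refine ⟨0, ?_⟩
    rw [Algebra.algebraMap_eq_smul_one]
    exact Submodule.smul_mem _ _ (T.afxA_one 0)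
  | add x y _ _ h1 h2 =>
    obtain ⟨a, ha⟩ := h1
    obtain ⟨b, hb⟩ := h2
    exact ⟨max a b, add_mem (T.afxA_mono (le_max_left _ _) ha)
      (T.afxA_mono (le_max_right _ _) hb)⟩
  | mul x y _ _ h1 h2 =>
    obtain ⟨a, ha⟩ := h1
    obtain ⟨b, hb⟩ := h2
    exact ⟨max a b, T.afxA_mul _ _ _ (T.afxA_mono (le_max_left _ _) ha)
      (T.afxA_mono (le_max_right _ _) hb)⟩
  | star x _ h =>
    obtain ⟨a, ha⟩ := h
    exact ⟨a, T.afxA_star _ _ ha⟩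

instance afxA_fd (T : MatrixUnitTower B) (i : ℕ) : FiniteDimensional ℂ (T.afxA i) :=
  FiniteDimensional.span_of_finite ℂ (Set.finite_range _)

/-- Infinite-dimensionality forces the number of diagonal units to be unbounded. -/
theorem afx_unbounded (T : MatrixUnitTower B) (hA : ¬ FiniteDimensional ℂ T.Aalg)
    (I W : ℕ) : ∃ i, I ≤ i ∧ W ≤ Fintype.card (T.afxX i) := by
  by_contra! hcon
  apply hA
  have hbd : ∀ i, Module.finrank ℂ (T.afxA i) ≤ W * W := by
    intro i
    refine le_trans (Submodule.finrank_mono (T.afxA_mono (le_max_left i I))) ?_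
    refine (finrank_range_le_card _).trans ?_
    have h1 := hcon (max i I) (le_max_right _ _)
    have h2 : Fintype.card (Σ j : Fin (T.K (max i I)), Fin (T.n (max i I) j) × Fin (T.n (max i I) j))
        ≤ Fintype.card (T.afxX (max i I) × T.afxX (max i I)) := by
      refine Fintype.card_le_of_injective
        (fun z => ((⟨z.1, z.2.1⟩, ⟨z.1, z.2.2⟩) : T.afxX (max i I) × T.afxX (max i I))) ?_
      rintro ⟨j, s, t⟩ ⟨j', s', t'⟩ h
      simp only [Prod.mk.injEq, Sigma.mk.injEq] at h
      obtain ⟨⟨rfl, h1⟩, ⟨-, h2⟩⟩ := h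
      rw [eq_of_heq h1, eq_of_heq h2]
    rw [Fintype.card_prod] at h2
    exact h2.trans (Nat.mul_le_mul h1.le h1.le)
  obtain ⟨i0, hi0⟩ : ∃ i0, ∀ i, Module.finrank ℂ (T.afxA i) ≤ Module.finrank ℂ (T.afxA i0) := by
    have hfin : (Set.range fun i => Module.finrank ℂ (T.afxA i)).Finite :=
      (Set.finite_Iic (W * W)).subset (by rintro _ ⟨i, rfl⟩; exact hbd i)
    obtain ⟨_, ⟨⟨i0, rfl⟩, h⟩⟩ := hfin.exists_maximal (Set.range_nonempty _)
    exact ⟨i0, fun i => by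
      by_contra hlt
      exact hlt (h ⟨i, rfl⟩ (not_le.1 hlt).le)⟩
  have hle : ∀ i, T.afxA i ≤ T.afxA i0 := by
    intro i
    have h1 : T.afxA i0 ≤ T.afxA (max i i0) := T.afxA_mono (le_max_right _ _)
    have h2 := Submodule.eq_of_le_of_finrank_le h1 (hi0 _)
    rw [h2]
    exact T.afxA_mono (le_max_left _ _)
  have hsub : Subalgebra.toSubmodule T.Aalg.toSubalgebra ≤ T.afxA i0 := by
    intro x hx
    have hcl : IsClosed (T.afxA i0 : Set B) := Submodule.closed_of_finiteDimensional _
    have hx' : x ∈ closure ((StarAlgebra.adjoin ℂ T.unitsSet : StarSubalgebra ℂ B) : Set B) := hx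
    refine closure_minimal ?_ hcl hx'
    intro y hy
    obtain ⟨i, hi⟩ := T.afxA_exists y hy
    exact hle i hi
  exact Submodule.finiteDimensional_of_le hsub

open Filter in
/-- Simplicity forces every diagonal unit to meet every block eventually. -/
theorem afx_full (T : MatrixUnitTower B) (hA : T.ASimple) (i : ℕ) (x : T.afxX i) :
    ∀ᶠ i2 in atTop, ∀ j : Fin (T.K i2), ∃ u, (⟨j, u⟩ : T.afxX i2) ∈ T.afxDesc i x i2 := by
  set p := T.afxq i x with hp
  set A0 := StarAlgebra.adjoin ℂ T.unitsSet with hA0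
  let J : Submodule ℂ B := Submodule.span ℂ {y | ∃ a ∈ A0, ∃ b ∈ A0, y = a * p * b}
  have hJl : ∀ a ∈ A0, ∀ y ∈ J, a * y ∈ J := by
    intro a ha y hy
    induction hy using Submodule.span_induction with
    | mem y h =>
      obtain ⟨c, hc, b, hb, rfl⟩ := h
      exact Submodule.subset_span ⟨a * c, mul_mem ha hc, b, hb, by noncomm_ring⟩
    | zero => rw [mul_zero]; exact zero_mem _
    | add y z _ _ h1 h2 => rw [mul_add]; exact add_mem h1 h2
    | smul r y _ h => rw [mul_smul_comm]; exact Submodule.smul_mem _ _ h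
  have hJr : ∀ y ∈ J, ∀ a ∈ A0, y * a ∈ J := by
    intro y hy a ha
    induction hy using Submodule.span_induction with
    | mem y h =>
      obtain ⟨c, hc, b, hb, rfl⟩ := h
      exact Submodule.subset_span ⟨c, hc, b * a, mul_mem hb ha, by noncomm_ring⟩
    | zero => rw [zero_mul]; exact zero_mem _
    | add y z _ _ h1 h2 => rw [add_mul]; exact add_mem h1 h2
    | smul r y _ h => rw [smul_mul_assoc]; exact Submodule.smul_mem _ _ h
  have hAcl : ∀ a : T.Aalg, (a : B) ∈ closure (A0 : Set B) := fun a => a.2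
  let I : TwoSidedIdeal T.Aalg := TwoSidedIdeal.mk' {a | (a : B) ∈ closure (J : Set B)}
    (subset_closure (zero_mem J))
    (fun {a b} ha hb => map_mem_closure₂ continuous_add ha hb fun y hy z hz => J.add_mem hy hz)
    (fun {a} ha => map_mem_closure (f := fun b : B => -b) continuous_neg
      (show (a : B) ∈ closure (J : Set B) from ha) fun y hy => J.neg_mem hy)
    (fun {a b} hb => map_mem_closure₂ continuous_mul (hAcl a) hb fun y hy z hz => hJl y hy z hz)
    (fun {a b} ha => map_mem_closure₂ continuous_mul ha (hAcl b) fun y hy z hz => hJr y hy z hz)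
  have hImem : ∀ a, a ∈ I ↔ (a : B) ∈ closure (J : Set B) := fun a => by
    exact TwoSidedIdeal.mem_mk' _ _ _ _ _ _ a
  have hIcl : IsClosed (I : Set T.Aalg) := by
    have : (I : Set T.Aalg) = (fun a : T.Aalg => (a : B)) ⁻¹' closure (J : Set B) := by
      ext a; exact hImem a
    rw [this]
    exact isClosed_closure.preimage continuous_subtype_val
  have hpA0 : p ∈ A0 := StarAlgebra.subset_adjoin ℂ _ ⟨i, x.1, x.2, x.2, rfl⟩
  have hpA : p ∈ T.Aalg := subset_closure hpA0
  have hpI : (⟨p, hpA⟩ : T.Aalg) ∈ I := by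
    rw [hImem]
    exact subset_closure (Submodule.subset_span ⟨1, one_mem _, 1, one_mem _, by simp⟩)
  have htop : I = ⊤ := by
    rcases hA I hIcl with h | h
    · exfalso
      rw [h, TwoSidedIdeal.mem_bot] at hpI
      exact T.afxq_ne i x (congrArg Subtype.val hpI)
    · exact h
  have h1 : (1 : B) ∈ closure (J : Set B) := by
    have : (1 : T.Aalg) ∈ I := by rw [htop]; trivial
    exact (hImem 1).1 this
  obtain ⟨y, hyJ, hy⟩ := Metric.mem_closure_iff.1 h1 1 one_pos
  have key : ∀ᶠ i2 in atTop, ∀ j : Fin (T.K i2),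
      (∀ u, p * T.e i2 j u u = 0) → ∀ u, T.e i2 j u u * y = 0 := by
    clear hy
    induction hyJ using Submodule.span_induction with
    | mem y h =>
      obtain ⟨a, ha, b, hb, rfl⟩ := h
      obtain ⟨k, hk⟩ := T.afxA_exists a ha
      filter_upwards [eventually_ge_atTop k] with i2 hi2 j hj u
      have hk2 := T.afxA_mono hi2 hk
      have : T.e i2 j u u * a * p = 0 := by
        clear ha hk
        induction hk2 using Submodule.span_induction with
        | mem a h =>
          obtain ⟨⟨j', s, t⟩, rfl⟩ := h
          dsimp only
          by_cases hjj : j = j'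
          · subst hjj
            rw [T.e_mul_same]
            split_ifs
            · have h2 := congrArg star (hj t)
              rw [star_mul, T.e_star, T.afxq_star, star_zero] at h2
              have e1 : T.e i2 j u t = T.e i2 j u t * T.e i2 j t t := by
                rw [T.e_mul_same, if_pos rfl]
              rw [e1, mul_assoc, h2, mul_zero]
            · rw [zero_mul]
          · rw [T.e_mul_ne _ _ _ hjj, zero_mul]
        | zero => simp
        | add a b _ _ h1 h2 => rw [mul_add, add_mul, h1, h2, add_zero]
        | smul r a _ h => rw [mul_smul_comm, smul_mul_assoc, h, smul_zero]
      rw [← mul_assoc, ← mul_assoc, this, zero_mul]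
    | zero => simp
    | add y z _ _ h1 h2 =>
      filter_upwards [h1, h2] with i2 h1 h2 j hj u
      rw [mul_add, h1 j hj u, h2 j hj u, add_zero]
    | smul r y _ h =>
      filter_upwards [h] with i2 h j hj u
      rw [mul_smul_comm, h j hj u, smul_zero]
  filter_upwards [key] with i2 h j
  by_contra! hcon
  have h0 : ∀ u, p * T.e i2 j u u = 0 := by
    intro u
    have := hcon u
    rw [mem_afxDesc, not_not] at this
    exact this
  let u : Fin (T.n i2 j) := ⟨0, T.n_pos i2 j⟩
  have h2 := h j h0 u
  have h3 : T.e i2 j u u = T.e i2 j u u * (1 - y) := by rw [mul_sub, h2, mul_one, sub_zero]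
  have hpos : 0 < ‖T.e i2 j u u‖ := norm_pos_iff.2 (T.e_ne_zero _ _ _ _)
  have h4 : ‖T.e i2 j u u‖ ≤ ‖T.e i2 j u u‖ * ‖1 - y‖ := by
    nth_rewrite 1 [h3]
    exact norm_mul_le _ _
  rw [dist_eq_norm] at hy
  nlinarith

open Filter in
/-- Growth of multiplicities. -/
theorem afx_growth (T : MatrixUnitTower B) (hA : ¬ FiniteDimensional ℂ T.Aalg)
    (hS : T.ASimple) (i : ℕ) (x : T.afxX i) (M : ℕ) :
    ∃ i3, i ≤ i3 ∧ ∀ j : Fin (T.K i3), ∃ S : Finset (Fin (T.n i3 j)), M ≤ S.card ∧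
      ∀ u ∈ S, (⟨j, u⟩ : T.afxX i3) ∈ T.afxDesc i x i3 := by
  classical
  obtain ⟨i1, hi1, hfull⟩ := ((eventually_ge_atTop i).and (T.afx_full hS i x)).exists
  obtain ⟨i2, hi2, hcard⟩ := T.afx_unbounded hA i1 (M * Fintype.card (T.afxX i1))
  have hx1 : ∃ x1 : T.afxX i1, M ≤ (T.afxDesc i1 x1 i2).card := by
    by_contra! hcon
    have hne : (Finset.univ : Finset (T.afxX i1)).Nonempty :=
      ⟨⟨⟨0, T.K_pos i1⟩, ⟨0, T.n_pos _ _⟩⟩, Finset.mem_univ _⟩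
    have h1 : Fintype.card (T.afxX i2) ≤ ∑ x1 : T.afxX i1, (T.afxDesc i1 x1 i2).card := by
      rw [← Finset.card_univ]
      refine le_trans (Finset.card_le_card ?_) Finset.card_biUnion_le
      intro y _
      obtain ⟨x1, h⟩ := T.afxq_cover i1 i2 y
      exact Finset.mem_biUnion.2 ⟨x1, Finset.mem_univ _, (T.mem_afxDesc _ _ _ _).2 h⟩
    have h2 : ∑ x1 : T.afxX i1, (T.afxDesc i1 x1 i2).card < ∑ x1 : T.afxX i1, M :=
      Finset.sum_lt_sum_of_nonempty hne fun x1 _ => hcon x1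
    rw [Finset.sum_const, Finset.card_univ, smul_eq_mul, mul_comm] at h2
    omega
  obtain ⟨⟨j1, u1⟩, hM⟩ := hx1
  obtain ⟨u1', hu1'⟩ := hfull j1
  have hM2 : M ≤ (T.afxDesc i x i2).card := by
    refine (hM.trans (T.afxDesc_card i1 i2 hi2 j1 u1 u1')).trans (Finset.card_le_card ?_)
    intro y hy
    exact T.afxDesc_trans _ _ _ hi1 hi2 _ _ _ hu1' hy
  have hall : ∀ᶠ i3 in atTop, ∀ y : T.afxX i2, ∀ j : Fin (T.K i3), ∃ u,
      (⟨j, u⟩ : T.afxX i3) ∈ T.afxDesc i2 y i3 :=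
    eventually_all.2 fun y => T.afx_full hS i2 y
  obtain ⟨i3, hi3, hf⟩ := ((eventually_ge_atTop i2).and hall).exists
  refine ⟨i3, hi1.trans (hi2.trans hi3), fun j => ?_⟩
  choose u hu using fun y => hf y j
  refine ⟨(T.afxDesc i x i2).image u, ?_, ?_⟩
  · rwa [Finset.card_image_of_injective]
    intro y z h
    have h1 := hu y
    rw [h] at h1
    exact T.afxDesc_unique _ _ hi3 _ _ _ h1 (hu z)
  · intro v hv
    obtain ⟨y, hy, rfl⟩ := Finset.mem_image.1 hv
    exact T.afxDesc_trans _ _ _ (hi1.trans hi2) hi3 _ _ _ hy (hu y)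

end MatrixUnitTower

namespace MatrixUnitTower

/-- Matrix units indexed by pairs of diagonal indices (zero across blocks). -/
noncomputable def afxf {B : Type*} [CStarAlgebra B] (T : MatrixUnitTower B) (i : ℕ)
    (x y : T.afxX i) : B :=
  if h : y.1 = x.1 then T.e i x.1 x.2 (h ▸ y.2) else 0

end MatrixUnitTower

/-- for any diagonal matrix unit `p = e i' j' s s` of the system and
self-adjoint elements `d 1, …, d m ∈ pDp`, there is `g ∈ pBp`, invertible in the
corner `pBp`, with each `d k ∈ C*({g})`. -/
theorem exists_corner_generator_of_AFAction
    {B : Type*} [CStarAlgebra B] (T : MatrixUnitTower B)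
    (hA_infdim : ¬ FiniteDimensional ℂ T.Aalg)
    (hA_simple : T.ASimple)
    (D : StarSubalgebra ℂ B)
    (hD_closed : IsClosed (D : Set B))
    (hD_sep : TopologicalSpace.IsSeparable (D : Set B))
    (hB_gen : cstarGen ((T.Aalg : Set B) ∪ (D : Set B)) = Set.univ)
    (hcomm : ∀ d ∈ D, ∀ d' ∈ T.D0, d * d' = d' * d)
    (hconj : ∀ d ∈ D, ∀ i j s t, T.e i j s t * d * star (T.e i j s t) ∈ D)
    (i' : ℕ) (j' : Fin (T.K i')) (s : Fin (T.n i' j'))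
    (m : ℕ) (d : Fin m → B)
    (hd_mem : ∀ k, ∃ x ∈ D, d k = T.e i' j' s s * x * T.e i' j' s s)
    (hd_sa : ∀ k, IsSelfAdjoint (d k)) :
    ∃ g : B, T.e i' j' s s * g * T.e i' j' s s = g ∧
      cornerInvertible (T.e i' j' s s) g ∧
      ∀ k, d k ∈ cstarGen {g} := by
  classical
  obtain ⟨N, hN, hS⟩ := T.afx_growth hA_infdim hA_simple i' ⟨j', s⟩ (2 * m + 3)
  set p := T.e i' j' s s with hp
  have hpq : p = T.afxq i' ⟨j', s⟩ := rfl
  have hpp : p * p = p := T.afxq_idem i' ⟨j', s⟩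
  let ι := {x : T.afxX N // x ∈ T.afxDesc i' ⟨j', s⟩ N}
  letI : LinearOrder ι := LinearOrder.lift' (Fintype.equivFin ι) (Fintype.equivFin ι).injective
  have hff : ∀ x, T.afxf N x x = T.afxq N x := fun x => by
    simp [MatrixUnitTower.afxf, MatrixUnitTower.afxq]
  have hsum : ∑ a : ι, T.afxf N a.1 a.1 = p := by
    simp only [hff]
    rw [← mul_one p, ← T.afxq_sum N, Finset.mul_sum]
    rw [Finset.sum_coe_sort (T.afxDesc i' ⟨j', s⟩ N) (fun x => T.afxq N x)]
    rw [← Finset.sum_subset (Finset.subset_univ (T.afxDesc i' ⟨j', s⟩ N))]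
    · refine Finset.sum_congr rfl fun x hx => ?_
      rw [hpq, T.afxq_mul _ _ hN _ _ ((T.mem_afxDesc _ _ _ _).1 hx)]
    · intro x _ hx
      rw [T.mem_afxDesc, not_not] at hx
      exact hx
  have heD0 : ∀ i x, T.afxq i x ∈ T.D0 := fun i x =>
    subset_closure (NonUnitalStarAlgebra.subset_adjoin ℂ _ ⟨i, x.1, x.2, rfl⟩)
  have hpD : p ∈ D := by
    have := hconj 1 (one_mem D) i' j' s s
    rw [mul_one, T.e_star] at this
    rwa [← hpp]
  have hdD : ∀ k, d k ∈ D := fun k => by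
    obtain ⟨x, hx, h⟩ := hd_mem k
    rw [h]
    exact mul_mem (mul_mem hpD hx) hpD
  have hpd : ∀ k, p * d k = d k := fun k => by
    obtain ⟨x, hx, h⟩ := hd_mem k
    rw [h, ← mul_assoc, ← mul_assoc, hpp]
  obtain ⟨g, hg1, hg2, hg3⟩ := afx_blocks (ι := ι) (fun a => a.1.1) (fun a b => T.afxf N a.1 b.1)
    (by
      rintro ⟨⟨j, u⟩, ha⟩ ⟨⟨j1, v⟩, hb⟩ ⟨⟨j2, w⟩, hc⟩ h1 h2
      dsimp only at h1 h2
      subst h1 h2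
      simp [MatrixUnitTower.afxf, T.e_mul_same])
    (by
      intro a b hab
      rw [hff, hff]
      exact T.afxq_orth N _ _ fun h => hab (Subtype.ext h))
    (by
      rintro ⟨⟨j, u⟩, ha⟩ ⟨⟨j1, v⟩, hb⟩ h1
      dsimp only at h1
      subst h1
      simp [MatrixUnitTower.afxf, T.e_star])
    m
    (by
      rintro ⟨⟨j, u⟩, ha⟩
      obtain ⟨S, hS1, hS2⟩ := hS j
      refine hS1.trans ?_
      rw [← Finset.card_attach]
      refine Finset.card_le_card_of_injOn (fun v => (⟨⟨j, v.1⟩, hS2 v.1 v.2⟩ : ι)) ?_ ?_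
      · intro v _
        simp
      · intro v _ w _ h
        have h' := congrArg Subtype.val h
        dsimp only at h'
        exact Subtype.ext (eq_of_heq (Sigma.mk.inj_iff.1 h').2))
    d
    (by
      intro k
      have h1 : ∀ a : ι, T.afxf N a.1 a.1 * d k * T.afxf N a.1 a.1 = T.afxf N a.1 a.1 * d k := by
        intro a
        rw [hff, mul_assoc, hcomm _ (hdD k) _ (heD0 N a.1), ← mul_assoc, T.afxq_idem]
      rw [Finset.sum_congr rfl fun a _ => h1 a, ← Finset.sum_mul, hsum, hpd])
  rw [hsum] at hg1 hg2
  refine ⟨g, hg1, hg2, fun k => ?_⟩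
  exact hg3 (NonUnitalStarAlgebra.adjoin ℂ {g}).topologicalClosure
    (NonUnitalStarSubalgebra.isClosed_topologicalClosure _)
    (subset_closure (NonUnitalStarAlgebra.subset_adjoin ℂ _ rfl)) k
end

section
/- Let B be a unital C*-algebra with an AF-action given by data (e^{(i)}_{j;s,t}, A, D) as described. Fix i ∈ ℕ. For each 1 ≤ j ≤ K_i, choose a diagonal matrix unit p_j = e^{(i)}_{j;s_j,s_j} and pairwise distinct level-i matrix units v_{j,1}, …, v_{j,n_{i,j}} of the j-th summand (each of the form e^{(i)}_{j;s,t}) such that v_{j,1} = p_j and v_{j,k} v_{j,k}* = p_j for all 1 ≤ k ≤ n_{i,j}. Then, for every self-adjoint element d ∈ D, there exist elements g_1, …, g_{K_i} ∈ B such that: (a) g_j ∈ p_j B p_j for each j; (b) g_j is invertible in the unital C*-algebra p_j B p_j for each j; (c) d ∈ C*({v_{j,k} : 1 ≤ j ≤ K_i, 1 ≤ k ≤ n_{i,j}} ∪ {g_1, …, g_{K_i}}). -/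
section Core
variable {B : Type*} [CStarAlgebra B]

lemma corner_shift (p g0 : B) (hp : p * p = p) (h1 : p * g0 = g0) (h2 : g0 * p = g0) :
    ∃ c : ℂ, cornerInvertible p (g0 + c • p) := by
  have hpos : (0:ℝ) < ‖g0‖ + 1 := by positivity
  set c : ℂ := ((‖g0‖ + 1 : ℝ) : ℂ) with hc
  have hc0 : c ≠ 0 := by
    rw [hc]; exact_mod_cast hpos.ne'
  have hn : ‖-(c⁻¹ • g0)‖ < 1 := by
    rw [norm_neg, norm_smul, norm_inv, hc, Complex.norm_real, Real.norm_of_nonneg hpos.le,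
      inv_mul_lt_iff₀ hpos]
    linarith
  have hu : IsUnit (1 - -(c⁻¹ • g0)) := isUnit_one_sub_of_norm_lt_one hn
  obtain ⟨u, hu⟩ := hu
  have hug : (c • (u : B)) * p = g0 + c • p := by
    rw [hu]; simp [smul_add, add_mul, hc0, h2, add_comm]
  have hpu : p * u = u * p := by
    rw [hu]; simp [mul_add, add_mul, h1, h2]
  have hpu' : p * (↑u⁻¹ : B) = ↑u⁻¹ * p := by
    have : Commute p (u : B) := hpu
    exact this.units_inv_right
  refine ⟨c, c⁻¹ • ((↑u⁻¹ : B) * p), ?_, ?_, ?_⟩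
  · rw [mul_smul_comm, smul_mul_assoc, ← mul_assoc, hpu', mul_assoc, mul_assoc, hp, hp]
  · rw [← hug, smul_mul_assoc, smul_mul_assoc, mul_smul_comm, smul_smul, mul_inv_cancel₀ hc0,
      one_smul, ← hpu', mul_assoc, ← mul_assoc p p, hp, hpu', ← mul_assoc, u.mul_inv, one_mul]
  · rw [← hug, smul_mul_assoc, smul_mul_assoc, mul_smul_comm, smul_smul, inv_mul_cancel₀ hc0,
      one_smul, mul_assoc, ← mul_assoc p, hpu, mul_assoc (u:B), hp, ← mul_assoc, u.inv_mul, one_mul]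

open Classical in
lemma core_gen {ι : Type*} [Fintype ι] (p : B) (q : ι → B) (w : ι → ι → B)
    (hqq : ∀ i, q i * q i = q i) (hqo : ∀ i j, i ≠ j → q i * q j = 0)
    (hqs : ∀ i, star (q i) = q i) (hsum : ∑ i, q i = p)
    (hwl : ∀ i j, q i * w i j = w i j) (hwr : ∀ i j, w i j * q j = w i j)
    (hw0 : ∀ i j, w i j = 0 ∨ w j i = 0) :
    ∃ g : B, p * g * p = g ∧ cornerInvertible p g ∧
      ∀ C : NonUnitalStarSubalgebra ℂ B, p ∈ C → g ∈ C →
        (∀ i, q i ∈ C) ∧ ∀ i j, w i j ∈ C := by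
  have hpq : ∀ i, p * q i = q i := by
    intro i
    rw [← hsum, Finset.sum_mul, Finset.sum_eq_single i (fun j _ hj => hqo j i hj) (by simp), hqq]
  have hqp : ∀ i, q i * p = q i := by
    intro i
    rw [← hsum, Finset.mul_sum, Finset.sum_eq_single i (fun j _ hj => hqo i j hj.symm) (by simp), hqq]
  have hps : star p = p := by rw [← hsum, star_sum]; simp [hqs]
  have hpp : p * p = p := by
    conv_lhs => rw [← hsum]
    rw [Finset.sum_mul]; simp [hqp, hsum]
  have hpw : ∀ i j, p * w i j = w i j := fun i j => by
    rw [← hwl i j, ← mul_assoc, hpq]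
  have hwp : ∀ i j, w i j * p = w i j := fun i j => by
    rw [← hwr i j, mul_assoc, hqp]
  let lam : ι → ℝ := fun i => ((Fintype.equivFin ι i : ℕ) : ℝ)
  have hlam : Function.Injective lam := by
    intro a b h
    have : ((Fintype.equivFin ι a : ℕ)) = (Fintype.equivFin ι b : ℕ) := by
      simp only [lam] at h
      exact_mod_cast h
    exact (Fintype.equivFin ι).injective (Fin.ext this)
  let Φ : (ι → ℂ) → B := fun c => ∑ i, c i • q i
  let a : B := Φ (fun i => (lam i : ℂ))
  let b : B := ∑ i, ∑ j, w i j
  let h : B := b + star b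
  have ha_star : star a = a := by
    simp [a, Φ, star_sum, star_smul, hqs]
  have hh_star : star h = h := by simp [h, add_comm]
  have hpa : p * a = a := by simp [a, Φ, Finset.mul_sum, hpq]
  have hap : a * p = a := by simp [a, Φ, Finset.sum_mul, hqp]
  have hpb : p * b = b := by simp [b, Finset.mul_sum, hpw]
  have hbp : b * p = b := by simp [b, Finset.sum_mul, hwp]
  have hpsb : p * star b = star b := by
    have := congrArg star hbp; rwa [star_mul, hps] at this
  have hsbp : star b * p = star b := by
    have := congrArg star hpb; rwa [star_mul, hps] at this
  have hph : p * h = h := by simp [h, mul_add, hpb, hpsb]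
  have hhp : h * p = h := by simp [h, add_mul, hbp, hsbp]
  set g0 : B := a + Complex.I • h with hg0
  have h1 : p * g0 = g0 := by simp [hg0, mul_add, hpa, hph]
  have h2 : g0 * p = g0 := by simp [hg0, add_mul, hap, hhp]
  obtain ⟨c, hc⟩ := corner_shift p g0 hpp h1 h2
  refine ⟨g0 + c • p, ?_, hc, ?_⟩
  · simp [mul_add, add_mul, h1, h2, hpp]
  intro C hpC hgC
  have hg0C : g0 ∈ C := by
    have := C.sub_mem hgC (C.smul_mem c hpC)
    simpa using this
  have hsg : star g0 = a - Complex.I • h := by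
    simp [hg0, ha_star, hh_star, star_smul, sub_eq_add_neg]
  have hsgC : a - Complex.I • h ∈ C := hsg ▸ star_mem hg0C
  have haC : a ∈ C := by
    have := C.smul_mem (1/2 : ℂ) (C.add_mem hg0C hsgC)
    have e : a = (1/2 : ℂ) • (g0 + (a - Complex.I • h)) := by rw [hg0]; module
    rw [e]; exact this
  have hhC : h ∈ C := by
    have := C.smul_mem (-Complex.I/2 : ℂ) (C.sub_mem hg0C hsgC)
    suffices e : h = (-Complex.I/2 : ℂ) • (g0 - (a - Complex.I • h)) by rw [e]; exact this
    rw [hg0, show a + Complex.I • h - (a - Complex.I • h) = (2 * Complex.I) • h by module, smul_smul]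
    rw [show -Complex.I/2 * (2 * Complex.I) = -(Complex.I * Complex.I) by ring, Complex.I_mul_I]
    simp
  have hΦmul : ∀ c d : ι → ℂ, Φ (c * d) = Φ c * Φ d := by
    intro c d
    simp only [Φ, Finset.sum_mul, Finset.mul_sum]
    refine Finset.sum_congr rfl fun i _ => ?_
    rw [Finset.sum_eq_single i]
    · simp [hqq, smul_smul, mul_comm]
    · intro j _ hj; simp [hqo j i hj]
    · simp
  have hΦ1 : Φ 1 = p := by simp [Φ, hsum]
  have hΦprod : ∀ (s : Finset ι) (F : ι → ι → ℂ), (∀ k, Φ (F k) ∈ C) → Φ (∏ k ∈ s, F k) ∈ C := by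
    intro s F hF
    induction s using Finset.induction_on with
    | empty => simpa [hΦ1] using hpC
    | insert k s hk ih => rw [Finset.prod_insert hk, hΦmul]; exact C.mul_mem (hF k) ih
  have hq : ∀ i, q i ∈ C := by
    intro i
    have key := hΦprod (Finset.univ.erase i)
      (fun k => fun m => ((lam i : ℂ) - lam k)⁻¹ * (lam m - lam k)) (by
        intro k
        have : Φ (fun m => ((lam i : ℂ) - lam k)⁻¹ * (lam m - lam k))
            = ((lam i : ℂ) - lam k)⁻¹ • (a - (lam k : ℂ) • p) := by
          simp only [Φ, a, ← hsum, Finset.smul_sum, ← Finset.sum_sub_distrib]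
          refine Finset.sum_congr rfl fun m _ => ?_
          module
        rw [this]
        exact C.smul_mem _ (C.sub_mem haC (C.smul_mem _ hpC)))
    convert key
    simp only [Φ, Finset.prod_apply]
    rw [Finset.sum_eq_single i]
    · rw [Finset.prod_eq_one, one_smul]
      intro k hk
      apply inv_mul_cancel₀
      rw [sub_ne_zero]
      exact fun hh => (Finset.ne_of_mem_erase hk) (hlam (by exact_mod_cast hh)).symm
    · intro m _ hm
      rw [Finset.prod_eq_zero (i := m)]
      · simp
      · simp [hm]
      · simp
    · simp
  refine ⟨hq, fun i j => ?_⟩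
  have hqb : ∀ i j, q i * b * q j = w i j := by
    intro i j
    simp only [b, Finset.mul_sum, Finset.sum_mul]
    rw [Finset.sum_eq_single i, Finset.sum_eq_single j]
    · rw [hwl, hwr]
    · intro k _ hk; rw [hwl, ← hwr i k, mul_assoc, hqo k j hk, mul_zero]
    · simp
    · intro k _ hk
      refine Finset.sum_eq_zero fun m _ => ?_
      rw [← hwl k m, ← mul_assoc, hqo i k hk.symm, zero_mul, zero_mul]
    · simp
  have hqh : q i * h * q j = w i j + star (w j i) := by
    rw [← hqb i j, ← hqb j i]
    simp [h, hqs, mul_add, add_mul, mul_assoc]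
  rcases hw0 i j with h0 | h0
  · rw [h0]; exact C.zero_mem
  · rw [h0, star_zero, add_zero] at hqh
    rw [← hqh]
    exact C.mul_mem (C.mul_mem (hq i) hhC) (hq j)

end Core
lemma comb_lemma {ι κ : Type*} [DecidableEq ι] [Fintype κ] [Nonempty κ] (F : Finset ι)
    (hF : 4 * Fintype.card κ + 2 ≤ F.card) :
    ∃ (ρ : ι) (X Y : Finset ι) (φ : ι → ι → κ × ι), ρ ∈ F ∧ X ⊆ F ∧ Y ⊆ F ∧ ρ ∉ X ∧ ρ ∉ Y ∧
      Disjoint X Y ∧ (∀ s ∈ X, ∀ t ∈ Y, (φ s t).2 ∈ F) ∧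
      (∀ k, ∀ r ∈ F, ∃ s ∈ X, ∃ t ∈ Y, φ s t = (k, r)) := by
  obtain ⟨ρ, hρ⟩ : F.Nonempty := Finset.card_pos.mp (by omega)
  obtain ⟨X, hX, hXc⟩ : ∃ X ⊆ F.erase ρ, X.card = 2 * Fintype.card κ :=
    Finset.exists_subset_card_eq (by rw [Finset.card_erase_of_mem hρ]; omega)
  let Y := (F.erase ρ) \ X
  have hYc : Y.card + 2 * Fintype.card κ + 1 = F.card := by
    have := Finset.card_sdiff_add_card_eq_card hX
    rw [Finset.card_erase_of_mem hρ] at this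
    simp only [Y]; omega
  have hcard : Fintype.card (κ × F) ≤ Fintype.card (X × Y) := by
    simp only [Fintype.card_prod, Fintype.card_coe, hXc]
    nlinarith
  obtain ⟨emb⟩ := Function.Embedding.nonempty_of_card_le hcard
  have : Nonempty (κ × F) := ⟨⟨Classical.arbitrary κ, ⟨ρ, hρ⟩⟩⟩
  let ψ := Function.invFun emb
  have hψ : ∀ x, ψ (emb x) = x := Function.leftInverse_invFun emb.injective
  let φ : ι → ι → κ × ι := fun s t =>
    if h : s ∈ X ∧ t ∈ Y then ((ψ (⟨s, h.1⟩, ⟨t, h.2⟩)).1, ((ψ (⟨s, h.1⟩, ⟨t, h.2⟩)).2 : ι))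
    else (Classical.arbitrary κ, ρ)
  refine ⟨ρ, X, Y, φ, hρ, hX.trans (Finset.erase_subset _ _), Finset.sdiff_subset.trans
        (Finset.erase_subset _ _), fun h => by simpa using hX h, by simp [Y],
        Finset.disjoint_sdiff, ?_, ?_⟩
  · intro s hs t ht
    simp only [φ, hs, ht, and_self, dite_true]
    exact (ψ (⟨s, hs⟩, ⟨t, ht⟩)).2.2
  · intro k r hr
    rcases h : emb (k, ⟨r, hr⟩) with ⟨⟨s, hs⟩, ⟨t, ht⟩⟩
    refine ⟨s, hs, t, ht, ?_⟩
    simp only [φ, hs, ht, and_self, dite_true]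
    rw [← h, hψ]
open Classical in
lemma mid_gen {B : Type*} [CStarAlgebra B] {ι J κ : Type*} [Fintype ι] [Fintype κ] [Nonempty κ]
    (blk : ι → J) (f : ι → ι → B) (p : B) (x : κ → B)
    (hmul : ∀ a b c, blk a = blk b → blk b = blk c → f a b * f b c = f a c)
    (horth : ∀ a b, a ≠ b → f a a * f b b = 0)
    (hstar : ∀ a b, blk a = blk b → star (f a b) = f b a)
    (hsum : ∑ a, f a a = p)
    (hxl : ∀ k, p * x k = x k)
    (hcomm : ∀ k a, x k * f a a = f a a * x k)
    (hcard : ∀ j, 4 * Fintype.card κ + 2 ≤ (Finset.univ.filter (fun a => blk a = j)).card) :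
    ∃ g : B, p * g * p = g ∧ cornerInvertible p g ∧
      ∀ C : NonUnitalStarSubalgebra ℂ B, p ∈ C → g ∈ C → ∀ k, x k ∈ C := by
  choose ρ X Y φ hρ hX hY hρX hρY hXY hφ hsurj using
    fun j => comb_lemma (κ := κ) (Finset.univ.filter (fun a => blk a = j)) (hcard j)
  simp only [Finset.mem_filter, Finset.mem_univ, true_and] at hρ hφ hsurj
  have hX' : ∀ j a, a ∈ X j → blk a = j := fun j a ha => by simpa using hX j ha
  have hY' : ∀ j a, a ∈ Y j → blk a = j := fun j a ha => by simpa using hY j ha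
  let w : ι → ι → B := fun a b =>
    if blk a = blk b ∧ a = ρ (blk a) ∧ b ≠ a then f a b
    else if blk a = blk b ∧ a ∈ X (blk a) ∧ b ∈ Y (blk a) then
      f a (φ (blk a) a b).2 * x (φ (blk a) a b).1 * f (φ (blk a) a b).2 b
    else 0
  obtain ⟨g, hg1, hg2, hg3⟩ := core_gen p (fun a => f a a) w (fun a => hmul a a a rfl rfl)
    horth (fun a => hstar a a rfl) hsum
    (by
      intro a b
      simp only [w]
      split_ifs with h1 h2
      · exact hmul _ _ _ rfl h1.1
      · rw [← mul_assoc, ← mul_assoc, hmul a a _ rfl (hφ _ a h2.2.1 b h2.2.2).symm]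
      · simp)
    (by
      intro a b
      simp only [w]
      split_ifs with h1 h2
      · exact hmul _ _ _ h1.1 rfl
      · rw [mul_assoc, hmul _ b b ((hφ _ a h2.2.1 b h2.2.2).trans h2.1) rfl]
      · simp)
    (by
      intro a b
      by_cases hab : blk a = blk b
      · by_contra hcon
        push Not at hcon
        obtain ⟨ha, hb⟩ := hcon
        simp only [w] at ha hb
        rw [← hab] at hb
        have e1 : (a = ρ (blk a) ∧ b ≠ a) ∨ (a ∈ X (blk a) ∧ b ∈ Y (blk a)) := by
          by_contra hh
          apply ha
          rw [if_neg (by tauto), if_neg (by tauto)]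
        have e2 : (b = ρ (blk a) ∧ a ≠ b) ∨ (b ∈ X (blk a) ∧ a ∈ Y (blk a)) := by
          by_contra hh
          apply hb
          rw [if_neg (by tauto), if_neg (by tauto)]
        have d := Finset.disjoint_left.mp (hXY (blk a))
        have r1 := hρX (blk a)
        have r2 := hρY (blk a)
        rcases e1 with ⟨e1, e1'⟩ | ⟨e1, e1'⟩ <;> rcases e2 with ⟨e2, e2'⟩ | ⟨e2, e2'⟩
        · exact e1' (e2.trans e1.symm)
        · exact r2 (e1 ▸ e2' : ρ (blk a) ∈ Y (blk a))
        · exact r2 (e2 ▸ e1' : ρ (blk a) ∈ Y (blk a))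
        · exact d e1 e2'
      · left; simp [w, hab])
  refine ⟨g, hg1, hg2, fun C hp hg k => ?_⟩
  obtain ⟨hq, hw⟩ := hg3 C hp hg
  have hroot : ∀ b, f (ρ (blk b)) b ∈ C := by
    intro b
    by_cases hb : b = ρ (blk b)
    · rw [← hb]; exact hq b
    · have := hw (ρ (blk b)) b
      simp only [w] at this
      rwa [if_pos ⟨hρ _, by rw [hρ], hb⟩] at this
  have hall : ∀ a b, blk a = blk b → f a b ∈ C := by
    intro a b hab
    rw [← hmul a (ρ (blk b)) b (by rw [hρ, hab]) (hρ _)]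
    refine mul_mem ?_ (hroot b)
    rw [← hab, ← hstar _ _ (hρ _)]
    exact star_mem (hroot a)
  have hpiece : ∀ r, f r r * x k ∈ C := by
    intro r
    obtain ⟨s, hs, t, ht, hst⟩ := hsurj (blk r) k r rfl
    have hs' := hX' _ _ hs
    have ht' := hY' _ _ ht
    have h := hw s t
    simp only [w] at h
    rw [if_neg, if_pos ⟨hs'.trans ht'.symm, hs' ▸ hs, hs' ▸ ht⟩, hs', hst] at h
    · simp only at h
      have h2 : _ ∈ C := mul_mem (mul_mem (hall r s hs'.symm) h) (hall t r ht')
      convert h2 using 1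
      rw [mul_assoc (f r s), mul_assoc _ (f r t), hmul r t r ht'.symm ht', ← mul_assoc, ← mul_assoc,
        hmul r s r hs'.symm hs', mul_assoc, hcomm, ← mul_assoc, hmul r r r rfl rfl]
    · rintro ⟨_, h2, _⟩
      rw [hs'] at h2
      exact hρX _ (h2 ▸ hs)
  rw [← hxl k, ← hsum, Finset.sum_mul]
  exact sum_mem fun r _ => hpiece r
namespace MatrixUnitTower
variable {B : Type*} [CStarAlgebra B] (T : MatrixUnitTower B)

noncomputable def lev (l : ℕ) : Submodule ℂ B :=
  Submodule.span ℂ {x | ∃ j s t, x = T.e l j s t}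

lemma e_mem_lev (l j s t) : T.e l j s t ∈ T.lev l := Submodule.subset_span ⟨j, s, t, rfl⟩

lemma lev_succ (l : ℕ) : T.lev l ≤ T.lev (l + 1) := by
  refine Submodule.span_le.mpr ?_
  rintro _ ⟨j, s, t, rfl⟩
  rw [T.e_compat]
  exact sum_mem fun j _ => sum_mem fun t _ => T.e_mem_lev _ _ _ _

lemma lev_mono : Monotone T.lev := monotone_nat_of_le_succ T.lev_succ

lemma one_mem_lev (l : ℕ) : (1 : B) ∈ T.lev l := by
  rw [← T.sum_diag_eq_one l]
  exact sum_mem fun j _ => sum_mem fun t _ => T.e_mem_lev _ _ _ _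

lemma mul_mem_lev {l : ℕ} {x y : B} (hx : x ∈ T.lev l) (hy : y ∈ T.lev l) :
    x * y ∈ T.lev l := by
  induction hx, hy using Submodule.span_induction₂ with
  | mem_mem x y hx hy =>
    obtain ⟨j, s, t, rfl⟩ := hx
    obtain ⟨j', s', t', rfl⟩ := hy
    by_cases h : j = j'
    · subst h
      rw [T.e_mul_same]
      split_ifs
      · exact T.e_mem_lev _ _ _ _
      · exact zero_mem _
    · rw [T.e_mul_ne _ _ _ h]; exact zero_mem _
  | zero_left y hy => simp
  | zero_right x hx => simp
  | add_left x y z _ _ _ h1 h2 => rw [add_mul]; exact add_mem h1 h2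
  | add_right x y z _ _ _ h1 h2 => rw [mul_add]; exact add_mem h1 h2
  | smul_left r x y _ _ h => rw [smul_mul_assoc]; exact Submodule.smul_mem _ _ h
  | smul_right r x y _ _ h => rw [mul_smul_comm]; exact Submodule.smul_mem _ _ h

lemma star_mem_lev {l : ℕ} {x : B} (hx : x ∈ T.lev l) : star x ∈ T.lev l := by
  induction hx using Submodule.span_induction with
  | mem x hx =>
    obtain ⟨j, s, t, rfl⟩ := hx
    rw [T.e_star]; exact T.e_mem_lev _ _ _ _
  | zero => simp
  | add x y _ _ h1 h2 => rw [star_add]; exact add_mem h1 h2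
  | smul r x _ h => rw [star_smul]; exact Submodule.smul_mem _ _ h

/-- the algebraic union -/
abbrev A0 : StarSubalgebra ℂ B := StarAlgebra.adjoin ℂ T.unitsSet

lemma mem_A0_lev {x : B} (hx : x ∈ T.A0) : ∃ l, x ∈ T.lev l := by
  induction hx using StarAlgebra.adjoin_induction with
  | mem x hx => obtain ⟨i, j, s, t, rfl⟩ := hx; exact ⟨i, T.e_mem_lev _ _ _ _⟩
  | algebraMap r => exact ⟨0, by rw [Algebra.algebraMap_eq_smul_one]; exact Submodule.smul_mem _ _ (T.one_mem_lev 0)⟩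
  | add x y _ _ h1 h2 =>
    obtain ⟨l, h1⟩ := h1
    obtain ⟨m, h2⟩ := h2
    exact ⟨max l m, add_mem (T.lev_mono (le_max_left _ _) h1) (T.lev_mono (le_max_right _ _) h2)⟩
  | mul x y _ _ h1 h2 =>
    obtain ⟨l, h1⟩ := h1
    obtain ⟨m, h2⟩ := h2
    exact ⟨max l m, T.mul_mem_lev (T.lev_mono (le_max_left _ _) h1) (T.lev_mono (le_max_right _ _) h2)⟩
  | star x _ h => obtain ⟨l, h⟩ := h; exact ⟨l, T.star_mem_lev h⟩

lemma e_mem_A0 (i j s t) : T.e i j s t ∈ T.A0 :=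
  StarAlgebra.subset_adjoin ℂ _ ⟨i, j, s, t, rfl⟩

/-- the algebraic ideal of `A0` generated by `p` -/
noncomputable def J0 (p : B) : Submodule ℂ B := Submodule.span ℂ {x | ∃ a ∈ T.A0, ∃ b ∈ T.A0, x = a * p * b}

lemma J0_left {p a x : B} (ha : a ∈ T.A0) (hx : x ∈ T.J0 p) : a * x ∈ T.J0 p := by
  induction hx using Submodule.span_induction with
  | mem x hx =>
    obtain ⟨b, hb, c, hc, rfl⟩ := hx
    exact Submodule.subset_span ⟨a * b, mul_mem ha hb, c, hc, by simp [mul_assoc]⟩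
  | zero => simp
  | add x y _ _ h1 h2 => rw [mul_add]; exact add_mem h1 h2
  | smul r x _ h => rw [mul_smul_comm]; exact Submodule.smul_mem _ _ h

lemma J0_right {p a x : B} (ha : a ∈ T.A0) (hx : x ∈ T.J0 p) : x * a ∈ T.J0 p := by
  induction hx using Submodule.span_induction with
  | mem x hx =>
    obtain ⟨b, hb, c, hc, rfl⟩ := hx
    exact Submodule.subset_span ⟨b, hb, c * a, mul_mem hc ha, by simp [mul_assoc]⟩
  | zero => simp
  | add x y _ _ h1 h2 => rw [add_mul]; exact add_mem h1 h2
  | smul r x _ h => rw [smul_mul_assoc]; exact Submodule.smul_mem _ _ h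

lemma exists_unit_J0 (hA : T.ASimple) (p : B) (hp : p ∈ T.A0) (hp0 : p ≠ 0) :
    ∃ y : Bˣ, (y : B) ∈ T.J0 p := by
  have hAc : ∀ a : T.Aalg, (a : B) ∈ closure (T.A0 : Set B) := fun a => a.2
  let M : Submodule ℂ B := (T.J0 p).topologicalClosure
  have hMc : (M : Set B) = closure (T.J0 p : Set B) := Submodule.topologicalClosure_coe _
  have hM : ∀ x, x ∈ M ↔ x ∈ closure (T.J0 p : Set B) := fun x => by
    rw [← hMc]; rfl
  let I : TwoSidedIdeal T.Aalg := TwoSidedIdeal.mk' {x | (x : B) ∈ M}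
    (by simp) (fun {x y} hx hy => by simpa using add_mem hx hy)
    (fun {x} hx => by simpa using hx)
    (fun {x y} hy => by
      simp only [Set.mem_ofPred_eq, hM] at hy ⊢
      exact map_mem_closure₂ continuous_mul (hAc x) hy fun a ha b hb => T.J0_left ha hb)
    (fun {x y} hx => by
      simp only [Set.mem_ofPred_eq, hM] at hx ⊢
      exact map_mem_closure₂ continuous_mul hx (hAc y) fun a ha b hb => T.J0_right hb ha)
  have hI : ∀ x, x ∈ I ↔ (x : B) ∈ M := fun x => TwoSidedIdeal.mem_mk' _ _ _ _ _ _ _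
  have hIc : IsClosed (I : Set T.Aalg) := by
    have : (I : Set T.Aalg) = Subtype.val ⁻¹' (M : Set B) := by
      ext x; exact hI x
    rw [this]
    exact (Submodule.isClosed_topologicalClosure _).preimage continuous_subtype_val
  have hpA : p ∈ T.Aalg := StarSubalgebra.le_topologicalClosure _ hp
  have hpI : (⟨p, hpA⟩ : T.Aalg) ∈ I := by
    rw [hI]
    exact Submodule.le_topologicalClosure _
      (Submodule.subset_span ⟨1, one_mem _, 1, one_mem _, by simp⟩)
  rcases hA I hIc with h | h
  · rw [h, TwoSidedIdeal.mem_bot] at hpI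
    exact absurd (congrArg Subtype.val hpI) hp0
  · have h1 : (1 : T.Aalg) ∈ I := by rw [h]; exact TwoSidedIdeal.mem_top _
    rw [hI, hM] at h1
    obtain ⟨y, hy, hd⟩ := Metric.mem_closure_iff.mp h1 1 one_pos
    have : IsUnit (1 - (1 - y)) := isUnit_one_sub_of_norm_lt_one (by
      simpa [dist_eq_norm] using hd)
    rw [sub_sub_cancel] at this
    obtain ⟨u, rfl⟩ := this
    exact ⟨u, hy⟩

lemma J0_central {p y : B} (hy : y ∈ T.J0 p) : ∃ l0, ∀ l ≥ l0, ∀ z : B,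
    (∀ a ∈ T.lev l, z * a = a * z) → z * p = 0 → z * y = 0 := by
  induction hy using Submodule.span_induction with
  | mem x hx =>
    obtain ⟨b, hb, c, hc, rfl⟩ := hx
    obtain ⟨l, hl⟩ := T.mem_A0_lev hb
    refine ⟨l, fun m hm z hz hzp => ?_⟩
    rw [← mul_assoc, ← mul_assoc, hz b (T.lev_mono hm hl), mul_assoc b, hzp]
    simp
  | zero => exact ⟨0, by simp⟩
  | add x y _ _ h1 h2 =>
    obtain ⟨l1, h1⟩ := h1
    obtain ⟨l2, h2⟩ := h2
    refine ⟨max l1 l2, fun m hm z hz hzp => ?_⟩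
    rw [mul_add, h1 m (le_trans (le_max_left _ _) hm) z hz hzp,
      h2 m (le_trans (le_max_right _ _) hm) z hz hzp, add_zero]
  | smul r x _ h =>
    obtain ⟨l1, h1⟩ := h
    refine ⟨l1, fun m hm z hz hzp => ?_⟩
    rw [mul_smul_comm, h1 m hm z hz hzp, smul_zero]

lemma J0_findim {p y y' : B} (hp : ∀ x ∈ T.A0, ∃ c : ℂ, p * x * p = c • p)
    (hy : y ∈ T.J0 p) (hy' : y' ∈ T.J0 p) :
    ∃ W : Submodule ℂ B, FiniteDimensional ℂ W ∧ ∀ x ∈ T.A0, y * x * y' ∈ W := by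
  induction hy, hy' using Submodule.span_induction₂ with
  | mem_mem x y hx hy =>
    obtain ⟨a, ha, b, hb, rfl⟩ := hx
    obtain ⟨a', ha', b', hb', rfl⟩ := hy
    refine ⟨Submodule.span ℂ {a * p * b'}, inferInstance, fun x hx => ?_⟩
    obtain ⟨c, hc⟩ := hp (b * x * a') (mul_mem (mul_mem hb hx) ha')
    rw [Submodule.mem_span_singleton]
    refine ⟨c, ?_⟩
    calc c • (a * p * b') = a * (c • p) * b' := by simp
      _ = _ := by rw [← hc]; simp [mul_assoc]
  | zero_left y hy => exact ⟨⊥, inferInstance, by simp⟩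
  | zero_right x hx => exact ⟨⊥, inferInstance, by simp⟩
  | add_left x y z _ _ _ h1 h2 =>
    obtain ⟨W1, _, h1⟩ := h1
    obtain ⟨W2, _, h2⟩ := h2
    refine ⟨W1 ⊔ W2, inferInstance, fun x hx => ?_⟩
    rw [add_mul, add_mul]
    exact add_mem (Submodule.mem_sup_left (h1 x hx)) (Submodule.mem_sup_right (h2 x hx))
  | add_right x y z _ _ _ h1 h2 =>
    obtain ⟨W1, _, h1⟩ := h1
    obtain ⟨W2, _, h2⟩ := h2
    refine ⟨W1 ⊔ W2, inferInstance, fun x hx => ?_⟩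
    rw [mul_add]
    exact add_mem (Submodule.mem_sup_left (h1 x hx)) (Submodule.mem_sup_right (h2 x hx))
  | smul_left r x y _ _ h =>
    obtain ⟨W, hW, h⟩ := h
    refine ⟨W, hW, fun x hx => ?_⟩
    rw [smul_mul_assoc, smul_mul_assoc]; exact Submodule.smul_mem _ _ (h x hx)
  | smul_right r x y _ _ h =>
    obtain ⟨W, hW, h⟩ := h
    refine ⟨W, hW, fun x hx => ?_⟩
    rw [mul_smul_comm]; exact Submodule.smul_mem _ _ (h x hx)

lemma findim_of_minimal (hA : T.ASimple) (p : B) (hpA : p ∈ T.A0) (hp0 : p ≠ 0)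
    (hp : ∀ x ∈ T.A0, ∃ c : ℂ, p * x * p = c • p) : FiniteDimensional ℂ T.Aalg := by
  obtain ⟨u, hu⟩ := T.exists_unit_J0 hA p hpA hp0
  obtain ⟨W, hW, h⟩ := T.J0_findim hp hu hu
  let F : B →ₗ[ℂ] B := (LinearMap.mulLeft ℂ (↑u⁻¹ : B)).comp (LinearMap.mulRight ℂ (↑u⁻¹ : B))
  let W' := W.map F
  have hfin : FiniteDimensional ℂ W' := inferInstance
  have hsub : (T.A0 : Set B) ⊆ W' := by
    intro x hx
    refine ⟨_, h x hx, ?_⟩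
    simp [F, mul_assoc]
  have hcl : IsClosed (W' : Set B) := Submodule.closed_of_finiteDimensional W'
  have hle : Subalgebra.toSubmodule T.Aalg.toSubalgebra ≤ W' := by
    intro x hx
    exact closure_minimal hsub hcl hx
  have := Submodule.finiteDimensional_of_le hle
  exact this

end MatrixUnitTower
namespace MatrixUnitTower
variable {B : Type*} [CStarAlgebra B] (T : MatrixUnitTower B)

lemma diag_mul_succ (l : ℕ) (j0 : Fin (T.K l)) (j : Fin (T.K (l + 1))) (t0 : Fin (T.m l j0 j))
    (r : Fin (T.n l j0)) :
    T.e (l + 1) j (T.L l j0 j t0 r) (T.L l j0 j t0 r) * T.e l j0 r r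
      = T.e (l + 1) j (T.L l j0 j t0 r) (T.L l j0 j t0 r) := by
  rw [T.e_compat l j0 r r, Finset.mul_sum, Finset.sum_eq_single j, Finset.mul_sum,
    Finset.sum_eq_single t0]
  · rw [T.e_mul_same, if_pos rfl]
  · intro t _ ht
    rw [T.e_mul_same, if_neg]
    intro h
    have := (T.L_bij l j).1 (a₁ := ⟨j0, t0, r⟩) (a₂ := ⟨j0, t, r⟩) h
    simp at this
    exact ht this.symm
  · simp
  · intro j' _ hj'
    rw [Finset.mul_sum]
    exact Finset.sum_eq_zero fun t _ => T.e_mul_ne _ _ _ hj'.symm _ _ _ _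
  · simp

lemma diag_orth (l : ℕ) (j j' : Fin (T.K l)) (r : Fin (T.n l j)) (r' : Fin (T.n l j'))
    (h : (⟨j, r⟩ : Σ j, Fin (T.n l j)) ≠ ⟨j', r'⟩) : T.e l j r r * T.e l j' r' r' = 0 := by
  by_cases hj : j = j'
  · subst hj
    rw [T.e_mul_same, if_neg]
    rintro rfl; exact h rfl
  · exact T.e_mul_ne _ _ _ hj _ _ _ _

lemma diag_dich (i : ℕ) (j : Fin (T.K i)) (s : Fin (T.n i j)) (l : ℕ) (hl : i ≤ l) :
    ∀ (j' : Fin (T.K l)) (r : Fin (T.n l j')),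
      T.e l j' r r * T.e i j s s = T.e l j' r r ∨ T.e l j' r r * T.e i j s s = 0 := by
  induction l, hl using Nat.le_induction with
  | base =>
    intro j' r
    by_cases h : (⟨j', r⟩ : Σ j, Fin (T.n i j)) = ⟨j, s⟩
    · left
      cases h
      rw [T.e_mul_same, if_pos rfl]
    · exact Or.inr (T.diag_orth _ _ _ _ _ h)
  | succ l hl ih =>
    intro j' r
    obtain ⟨⟨j0, t0, r0⟩, rfl⟩ := (T.L_bij l j').2 r
    simp only
    rw [← T.diag_mul_succ, mul_assoc]
    rcases ih j0 r0 with h | h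
    · left; rw [h]
    · right; rw [h, mul_zero]

open Classical in
/-- indices of the diagonal units at level `l` lying under `p` -/
noncomputable def under (p : B) (l : ℕ) (j' : Fin (T.K l)) : Finset (Fin (T.n l j')) :=
  Finset.univ.filter (fun r => T.e l j' r r * p = T.e l j' r r)

lemma mem_under {p : B} {l : ℕ} {j' : Fin (T.K l)} {r : Fin (T.n l j')} :
    r ∈ T.under p l j' ↔ T.e l j' r r * p = T.e l j' r r := by simp [under]

lemma sum_under (i : ℕ) (j : Fin (T.K i)) (s : Fin (T.n i j)) (l : ℕ) (hl : i ≤ l) :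
    ∑ j', ∑ r ∈ T.under (T.e i j s s) l j', T.e l j' r r = T.e i j s s := by
  conv_rhs => rw [← one_mul (T.e i j s s), ← T.sum_diag_eq_one l, Finset.sum_mul]
  refine Finset.sum_congr rfl fun j' _ => ?_
  rw [Finset.sum_mul, under, Finset.sum_filter]
  refine Finset.sum_congr rfl fun r _ => ?_
  split_ifs with h
  · exact h.symm
  · rcases T.diag_dich i j s l hl j' r with h' | h'
    · exact absurd h' h
    · exact h'.symm

lemma corner_diag (l : ℕ) (j : Fin (T.K l)) (r : Fin (T.n l j)) {x : B} (hx : x ∈ T.lev l) :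
    ∃ c : ℂ, T.e l j r r * x * T.e l j r r = c • T.e l j r r := by
  induction hx using Submodule.span_induction with
  | mem x hx =>
    obtain ⟨j', s, t, rfl⟩ := hx
    by_cases h : j = j'
    · subst h
      rw [T.e_mul_same]
      split_ifs with h1
      · rw [T.e_mul_same]
        split_ifs with h2
        · exact ⟨1, by simp⟩
        · exact ⟨0, by simp⟩
      · exact ⟨0, by simp⟩
    · exact ⟨0, by rw [T.e_mul_ne _ _ _ h]; simp⟩
  | zero => exact ⟨0, by simp⟩
  | add x y _ _ h1 h2 =>
    obtain ⟨c, h1⟩ := h1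
    obtain ⟨d, h2⟩ := h2
    exact ⟨c + d, by rw [mul_add, add_mul, h1, h2, add_smul]⟩
  | smul a x _ h =>
    obtain ⟨c, h⟩ := h
    exact ⟨a * c, by rw [mul_smul_comm, smul_mul_assoc, h, smul_smul]⟩

lemma exists_split (hA : T.ASimple) (hinf : ¬ FiniteDimensional ℂ T.Aalg)
    (i : ℕ) (j : Fin (T.K i)) (s : Fin (T.n i j)) :
    ∃ l, i ≤ l ∧ ∃ a b : Σ j', Fin (T.n l j'), a ≠ b ∧
      a.2 ∈ T.under (T.e i j s s) l a.1 ∧ b.2 ∈ T.under (T.e i j s s) l b.1 := by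
  by_contra hcon
  push Not at hcon
  apply hinf
  refine T.findim_of_minimal hA (T.e i j s s) (T.e_mem_A0 _ _ _ _) (T.e_ne_zero _ _ _ _) ?_
  intro x hx
  obtain ⟨l0, hl0⟩ := T.mem_A0_lev hx
  let l := max i l0
  have hil : i ≤ l := le_max_left _ _
  have hxl : x ∈ T.lev l := T.lev_mono (le_max_right _ _) hl0
  have hsum := T.sum_under i j s l hil
  have huniq : ∀ a b : Σ j', Fin (T.n l j'), a.2 ∈ T.under (T.e i j s s) l a.1 →
      b.2 ∈ T.under (T.e i j s s) l b.1 → a = b := by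
    intro a b ha hb
    by_contra hab
    exact hcon l hil a b hab ha hb
  obtain ⟨a, ha⟩ : ∃ a : Σ j', Fin (T.n l j'), a.2 ∈ T.under (T.e i j s s) l a.1 := by
    by_contra hno
    push Not at hno
    apply T.e_ne_zero i j s s
    rw [← hsum]
    exact Finset.sum_eq_zero fun j' _ => Finset.sum_eq_zero fun r hr => absurd hr (hno ⟨j', r⟩)
  obtain ⟨j1, r1⟩ := a
  have hpe : T.e i j s s = T.e l j1 r1 r1 := by
    conv_lhs => rw [← hsum]
    rw [Finset.sum_eq_single j1, Finset.sum_eq_single r1]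
    · intro r hr hne
      have := huniq ⟨j1, r⟩ ⟨j1, r1⟩ hr ha
      simp at this
      exact absurd this hne
    · intro h; exact absurd ha h
    · intro j' _ hne
      refine Finset.sum_eq_zero fun r hr => ?_
      have := huniq ⟨j', r⟩ ⟨j1, r1⟩ hr ha
      exact absurd (congrArg Sigma.fst this) hne
    · simp
  rw [hpe]
  exact T.corner_diag l j1 r1 hxl

lemma central_unit (l : ℕ) (j : Fin (T.K l)) {a : B} (ha : a ∈ T.lev l) :
    (∑ r, T.e l j r r) * a = a * ∑ r, T.e l j r r := by
  induction ha using Submodule.span_induction with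
  | mem x hx =>
    obtain ⟨j', s, t, rfl⟩ := hx
    by_cases h : j = j'
    · subst h
      simp [Finset.sum_mul, Finset.mul_sum, T.e_mul_same]
    · simp [Finset.sum_mul, Finset.mul_sum, T.e_mul_ne _ _ _ h, T.e_mul_ne _ _ _ (Ne.symm h)]
  | zero => simp
  | add x y _ _ h1 h2 => rw [mul_add, add_mul, h1, h2]
  | smul a x _ h => rw [mul_smul_comm, smul_mul_assoc, h]

lemma mult_one (hA : T.ASimple) (i : ℕ) (j : Fin (T.K i)) (s : Fin (T.n i j)) :
    ∃ l0, i ≤ l0 ∧ ∀ l ≥ l0, ∀ j', 1 ≤ (T.under (T.e i j s s) l j').card := by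
  obtain ⟨u, hu⟩ := T.exists_unit_J0 hA _ (T.e_mem_A0 i j s s) (T.e_ne_zero i j s s)
  obtain ⟨l0, h⟩ := T.J0_central hu
  refine ⟨max i l0, le_max_left _ _, fun l hl j' => ?_⟩
  have hil : i ≤ l := (le_max_left _ _).trans hl
  rw [Nat.one_le_iff_ne_zero, Finset.card_ne_zero]
  by_contra hne
  have hemp : ∀ r, r ∉ T.under (T.e i j s s) l j' := fun r hr => hne ⟨r, hr⟩
  have h0 := h l ((le_max_right _ _).trans hl) (∑ r, T.e l j' r r)
    (fun a ha => T.central_unit l j' ha) (by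
      rw [Finset.sum_mul]
      refine Finset.sum_eq_zero fun r _ => ?_
      rcases T.diag_dich i j s l hil j' r with h' | h'
      · exact absurd (T.mem_under.mpr h') (hemp r)
      · exact h')
  have hz : (∑ r, T.e l j' r r) = 0 := by
    have := congrArg (· * (↑u⁻¹ : B)) h0
    simpa [mul_assoc] using this
  let r0 : Fin (T.n l j') := ⟨0, T.n_pos l j'⟩
  have := congrArg (· * T.e l j' r0 r0) hz
  simp [Finset.sum_mul, T.e_mul_same] at this
  exact T.e_ne_zero _ _ _ _ this

lemma mult_large (hA : T.ASimple) (hinf : ¬ FiniteDimensional ℂ T.Aalg) (N : ℕ) :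
    ∀ (i : ℕ) (j : Fin (T.K i)) (s : Fin (T.n i j)),
    ∃ l0, i ≤ l0 ∧ ∀ l ≥ l0, ∀ j', N + 1 ≤ (T.under (T.e i j s s) l j').card := by
  induction N with
  | zero => exact fun i j s => T.mult_one hA i j s
  | succ N ih =>
    intro i j s
    obtain ⟨l1, hl1, ⟨ja, ra⟩, ⟨jb, rb⟩, hab, ha, hb⟩ := T.exists_split hA hinf i j s
    obtain ⟨la, hla, ha'⟩ := ih l1 ja ra
    obtain ⟨lb, hlb, hb'⟩ := ih l1 jb rb
    rw [mem_under] at ha hb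
    refine ⟨max la lb, by omega, fun l hl j' => ?_⟩
    have h1 := ha' l ((le_max_left _ _).trans hl) j'
    have h2 := hb' l ((le_max_right _ _).trans hl) j'
    classical
    have hsub : T.under (T.e l1 ja ra ra) l j' ∪ T.under (T.e l1 jb rb rb) l j' ⊆
        T.under (T.e i j s s) l j' := by
      intro r hr
      rw [Finset.mem_union, mem_under, mem_under] at hr
      rw [mem_under]
      rcases hr with hr | hr
      · rw [← hr, mul_assoc, ha]
      · rw [← hr, mul_assoc, hb]
    have hdis : Disjoint (T.under (T.e l1 ja ra ra) l j') (T.under (T.e l1 jb rb rb) l j') := by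
      rw [Finset.disjoint_left]
      intro r hr hr'
      rw [mem_under] at hr hr'
      apply T.e_ne_zero l j' r r
      rw [← hr', ← hr, mul_assoc, T.diag_orth _ _ _ _ _ hab, mul_zero]
    have := Finset.card_le_card hsub
    rw [Finset.card_union_of_disjoint hdis] at this
    omega

open Classical in
lemma single_gen (hA : T.ASimple) (hinf : ¬ FiniteDimensional ℂ T.Aalg)
    (i : ℕ) (j : Fin (T.K i)) (s : Fin (T.n i j)) {κ : Type} [Fintype κ] [Nonempty κ] (x : κ → B)
    (hx : ∀ k, T.e i j s s * x k = x k)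
    (hcomm : ∀ k l j' r, x k * T.e l j' r r = T.e l j' r r * x k) :
    ∃ g : B, T.e i j s s * g * T.e i j s s = g ∧ cornerInvertible (T.e i j s s) g ∧
      ∀ C : NonUnitalStarSubalgebra ℂ B, T.e i j s s ∈ C → g ∈ C → ∀ k, x k ∈ C := by
  obtain ⟨l, hl, hc⟩ := T.mult_large hA hinf (4 * Fintype.card κ + 1) i j s
  replace hc := hc l le_rfl
  let ι := Σ j' : Fin (T.K l), {r // r ∈ T.under (T.e i j s s) l j'}
  let f : ι → ι → B := fun a b =>
    if h : a.1 = b.1 then T.e l b.1 (h ▸ a.2.1) b.2.1 else 0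
  have hff : ∀ j' (r r' : {r // r ∈ T.under (T.e i j s s) l j'}),
      f ⟨j', r⟩ ⟨j', r'⟩ = T.e l j' r.1 r'.1 := by
    intro j' r r'; simp [f]
  refine mid_gen (Sigma.fst : ι → Fin (T.K l)) f _ x ?_ ?_ ?_ ?_ hx ?_ ?_
  · rintro ⟨ja, a⟩ ⟨jb, b⟩ ⟨jc, c⟩ h1 h2
    dsimp only at h1 h2
    subst h1; subst h2
    rw [hff, hff, hff, T.e_mul_same, if_pos rfl]
  · rintro ⟨ja, a⟩ ⟨jb, b⟩ h
    rw [hff, hff]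
    apply T.diag_orth
    intro h'
    apply h
    rw [Sigma.mk.injEq] at h'
    obtain ⟨rfl, h'⟩ := h'
    rw [heq_eq_eq] at h'
    rw [Subtype.ext h']
  · rintro ⟨ja, a⟩ ⟨jb, b⟩ h1
    dsimp only at h1
    subst h1
    rw [hff, hff, T.e_star]
  · rw [Fintype.sum_sigma]
    refine Eq.trans ?_ (T.sum_under i j s l hl)
    refine Finset.sum_congr rfl fun j' _ => ?_
    simp only [hff]
    exact Finset.sum_coe_sort (T.under (T.e i j s s) l j') (fun r => T.e l j' r r)
  · rintro k ⟨j', r⟩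
    rw [hff, hcomm]
  · intro j'
    refine (hc j').trans ?_
    rw [← Fintype.card_coe, ← Finset.card_univ]
    refine Finset.card_le_card_of_injOn (fun r => (⟨j', r⟩ : ι)) ?_ ?_
    · intro r _; simp
    · intro r _ r' _ h
      simpa using h

end MatrixUnitTower
/-- with `p j = e i j (σ j) (σ j)` and, for each `j`, pairwise distinct
level-`i` matrix units `v j k` of the `j`-th summand with `v j 0 = p j` (the paper's
`v_{j,1}`) and common range projection `p j`, every self-adjoint `d ∈ D` lies in the
C*-algebra generated by the `v j k` together with suitable corner-invertible elements
`g j ∈ p j B p j`. -/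
theorem selfAdjoint_mem_cstarGen_of_AFAction
    {B : Type*} [CStarAlgebra B] (T : MatrixUnitTower B)
    (hA_infdim : ¬ FiniteDimensional ℂ T.Aalg)
    (hA_simple : T.ASimple)
    (D : StarSubalgebra ℂ B)
    (hD_closed : IsClosed (D : Set B))
    (hD_sep : TopologicalSpace.IsSeparable (D : Set B))
    (hB_gen : cstarGen ((T.Aalg : Set B) ∪ (D : Set B)) = Set.univ)
    (hcomm : ∀ d ∈ D, ∀ d' ∈ T.D0, d * d' = d' * d)
    (hconj : ∀ d ∈ D, ∀ i j s t, T.e i j s t * d * star (T.e i j s t) ∈ D)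
    (i : ℕ) (σ : (j : Fin (T.K i)) → Fin (T.n i j))
    (v : (j : Fin (T.K i)) → Fin (T.n i j) → B)
    (hv_units : ∀ j k, ∃ s t, v j k = T.e i j s t)
    (hv_inj : ∀ j, Function.Injective (v j))
    (hv_first : ∀ j, v j ⟨0, T.n_pos i j⟩ = T.e i j (σ j) (σ j))
    (hv_range : ∀ j k, v j k * star (v j k) = T.e i j (σ j) (σ j))
    (d : B) (hd_mem : d ∈ D) (hd_sa : IsSelfAdjoint d) :
    ∃ g : Fin (T.K i) → B,
      (∀ j, T.e i j (σ j) (σ j) * g j * T.e i j (σ j) (σ j) = g j) ∧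
      (∀ j, cornerInvertible (T.e i j (σ j) (σ j)) (g j)) ∧
      d ∈ cstarGen ({x | ∃ j k, x = v j k} ∪ Set.range g) := by
  have hform : ∀ j k, ∃ t, v j k = T.e i j (σ j) t := by
    intro j k
    obtain ⟨s, t, h⟩ := hv_units j k
    have hr := hv_range j k
    rw [h, T.e_star, T.e_mul_same, if_pos rfl] at hr
    have hs : s = σ j := by
      by_contra hne
      apply T.e_ne_zero i j (σ j) (σ j)
      have h2 : T.e i j s s * T.e i j (σ j) (σ j) = 0 := by rw [T.e_mul_same, if_neg hne]
      rwa [hr, T.e_mul_same, if_pos rfl] at h2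
    exact ⟨t, by rw [h, hs]⟩
  choose τ hτ using hform
  have hτinj : ∀ j, Function.Injective (τ j) := by
    intro j a b hab
    apply hv_inj j
    rw [hτ, hτ, hab]
  have hτsurj : ∀ j, Function.Surjective (τ j) := fun j => Finite.surjective_of_injective (hτinj j)
  have hdiag : ∀ l j' r, T.e l j' r r ∈ T.D0 := fun l j' r =>
    subset_closure (NonUnitalStarAlgebra.subset_adjoin ℂ _ ⟨l, j', r, rfl⟩)
  have hex : ∀ j, ∃ g : B, T.e i j (σ j) (σ j) * g * T.e i j (σ j) (σ j) = g ∧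
      cornerInvertible (T.e i j (σ j) (σ j)) g ∧
      ∀ C : NonUnitalStarSubalgebra ℂ B, T.e i j (σ j) (σ j) ∈ C → g ∈ C →
        ∀ k, v j k * d * star (v j k) ∈ C := by
    intro j
    have : Nonempty (Fin (T.n i j)) := ⟨⟨0, T.n_pos i j⟩⟩
    refine T.single_gen hA_simple hA_infdim i j (σ j) (fun k => v j k * d * star (v j k)) ?_ ?_
    · intro k
      simp only [hτ, ← mul_assoc]
      rw [T.e_mul_same, if_pos rfl]
    · intro k l j' r
      refine hcomm _ ?_ _ (hdiag l j' r)
      rw [hτ]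
      exact hconj d hd_mem _ _ _ _
  choose g hg1 hg2 hg3 using hex
  refine ⟨g, hg1, hg2, subset_closure ?_⟩
  set C : NonUnitalStarSubalgebra ℂ B :=
    NonUnitalStarAlgebra.adjoin ℂ ({x | ∃ j k, x = v j k} ∪ Set.range g) with hC
  have hvC : ∀ j k, v j k ∈ C := fun j k =>
    NonUnitalStarAlgebra.subset_adjoin ℂ _ (Or.inl ⟨j, k, rfl⟩)
  have hgC : ∀ j, g j ∈ C := fun j =>
    NonUnitalStarAlgebra.subset_adjoin ℂ _ (Or.inr ⟨j, rfl⟩)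
  have hpC : ∀ j, T.e i j (σ j) (σ j) ∈ C := fun j => hv_first j ▸ hvC j _
  show d ∈ C
  rw [← one_mul d, ← T.sum_diag_eq_one i, Finset.sum_mul]
  refine sum_mem fun j _ => ?_
  rw [Finset.sum_mul]
  refine sum_mem fun t _ => ?_
  obtain ⟨k, rfl⟩ := hτsurj j t
  have hx := hg3 j C (hpC j) (hgC j) k
  have h2 : star (v j k) * (v j k * d * star (v j k)) * v j k ∈ C :=
    mul_mem (mul_mem (star_mem (hvC j k)) hx) (hvC j k)
  have h3 : star (v j k) * v j k = T.e i j (τ j k) (τ j k) := by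
    rw [hτ, T.e_star, T.e_mul_same, if_pos rfl]
  have h4 : star (v j k) * (v j k * d * star (v j k)) * v j k = T.e i j (τ j k) (τ j k) * d := by
    calc _ = (star (v j k) * v j k) * d * (star (v j k) * v j k) := by simp only [mul_assoc]
      _ = _ := by
        rw [h3, mul_assoc, hcomm d hd_mem _ (hdiag i j _), ← mul_assoc, T.e_mul_same, if_pos rfl]
  rwa [h4] at h2
end
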